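/- Let d ≥ 1 and let F be the free group with free basis x_1, y_1, …, x_d, y_d, and let w = [x_1,y_1][x_2,y_2]⋯[x_d,y_d]. Let u ∈ F. If w and u are measure equivalent in every finite solvable group, then there exists an automorphism φ of F such that u = φ(w). -/

import Mathlib

/-- Two words `w, u` of the free group on `α` are *measure equivalent* in a group `Q` if for
every `g : Q` the fibers of the respective word maps `(α → Q) → Q` over `g` have the same
cardinality. -/
def MeasureEquivIn {α : Type*} (w u : FreeGroup α) (Q : Type*) [Group Q] : Prop :=
  ∀ g : Q, Nat.card {f : α → Q // FreeGroup.lift f w = g} =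
    Nat.card {f : α → Q // FreeGroup.lift f u = g}

open scoped commutatorElement

/-- The orientable surface relator `[x₁,y₁]⋯[x_d,y_d]`, where `xᵢ = (i, false)` and
`yᵢ = (i, true)`. -/
def orientableRelator (d : ℕ) : FreeGroup (Fin d × Bool) :=
  (List.ofFn fun i : Fin d => ⁅FreeGroup.of (i, false), FreeGroup.of (i, true)⁆).prod

section OrderedGroupSets

variable {Γ : Type*} [Group Γ]

/-- A set of group elements has finite fibers modulo `H` if it meets every left coset of `H` in a
finite set. -/
def FiniteFibers (H : Subgroup Γ) (S : Set Γ) : Prop := ∀ x, {s ∈ S | x⁻¹ * s ∈ H}.Finite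

theorem FiniteFibers.mono {H : Subgroup Γ} {S T : Set Γ} (hT : FiniteFibers H T) (h : S ⊆ T) :
    FiniteFibers H S := fun x => (hT x).subset fun _ hs => ⟨h hs.1, hs.2⟩

theorem FiniteFibers.anti {H H' : Subgroup Γ} {S : Set Γ} (hS : FiniteFibers H S) (h : H' ≤ H) :
    FiniteFibers H' S := fun x => (hS x).subset fun _ hs => ⟨hs.1, h hs.2⟩

theorem FiniteFibers.union {H : Subgroup Γ} {S T : Set Γ} (hS : FiniteFibers H S)
    (hT : FiniteFibers H T) : FiniteFibers H (S ∪ T) := fun x =>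
  ((hS x).union (hT x)).subset fun _ hs => hs.1.imp (⟨·, hs.2⟩) (⟨·, hs.2⟩)

theorem Set.Finite.finiteFibers (H : Subgroup Γ) {S : Set Γ} (hS : S.Finite) : FiniteFibers H S :=
  fun _ => hS.subset fun _ hs => hs.1

theorem finiteFibers_bot (S : Set Γ) : FiniteFibers ⊥ S := fun x =>
  (Set.finite_singleton x).subset fun s hs => by
    have := hs.2
    rw [Subgroup.mem_bot, inv_mul_eq_one] at this
    exact this.symm

variable [LinearOrder Γ]

/-- A subgroup of an ordered group all of whose elements lie below every positive element outside
of it. -/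
def ConvexSubgroup (H : Subgroup Γ) : Prop := ∀ d ∈ H, ∀ g ∉ H, 1 < g → d < g

theorem convexSubgroup_bot : ConvexSubgroup (⊥ : Subgroup Γ) := by
  rintro d hd g - hg
  rwa [Subgroup.mem_bot.1 hd]

variable [MulLeftMono Γ] [MulRightMono Γ]

omit [MulRightMono Γ] in
theorem ConvexSubgroup.mem_of_mul_mem {H : Subgroup Γ} (hH : ConvexSubgroup H) {a b : Γ}
    (ha : 1 ≤ a) (hb : 1 ≤ b) (hab : a * b ∈ H) : a ∈ H ∧ b ∈ H := by
  have key : a ∈ H := by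
    by_contra h
    have h1 : 1 < a := lt_of_le_of_ne ha fun h1 => h (h1 ▸ H.one_mem)
    exact absurd (hH _ hab a h h1) (not_lt.2 (le_mul_of_one_le_right' hb))
  exact ⟨key, (H.mul_mem_cancel_left key).1 hab⟩

theorem Set.IsPWO.mul_group {S T : Set Γ} (hS : S.IsPWO) (hT : T.IsPWO) :
    {x | ∃ s ∈ S, ∃ t ∈ T, s * t = x}.IsPWO := by
  refine ((hS.prod hT).image_of_monotone (f := fun p : Γ × Γ => p.1 * p.2)
    fun p q h => mul_le_mul' h.1 h.2).mono ?_
  rintro _ ⟨s, hs, t, ht, rfl⟩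
  exact ⟨(s, t), ⟨hs, ht⟩, rfl⟩

/-- Infinitely many products in one coset force infinitely many of the factors in one coset. -/
theorem exists_infinite_fiber {H : Subgroup Γ} [H.Normal] (hH : ConvexSubgroup H) {S T : Set Γ}
    (hS : S.IsPWO) (hT : T.IsPWO) {P : Set (Γ × Γ)} (hP : P.Infinite) (hPS : P ⊆ S ×ˢ T) {x : Γ}
    (hx : ∀ p ∈ P, x⁻¹ * (p.1 * p.2) ∈ H) :
    ∃ p₀ ∈ P, {p ∈ P | p₀.1⁻¹ * p.1 ∈ H ∧ p₀.2⁻¹ * p.2 ∈ H}.Infinite := by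
  let f := hP.natEmbedding
  obtain ⟨g, hg⟩ := hS.exists_monotone_subseq (f := fun n => (f n).1.1)
    fun n => (hPS (f n).2).1
  obtain ⟨g', hg'⟩ := hT.exists_monotone_subseq (f := fun n => (f (g n)).1.2)
    fun n => (hPS (f _).2).2
  refine ⟨f (g (g' 0)), (f _).2, ?_⟩
  refine (Set.infinite_range_of_injective (f := fun n => (f (g (g' n))).1) ?_).mono ?_
  · intro a b h
    exact g'.injective (g.injective (f.injective (Subtype.ext h)))
  rintro _ ⟨n, rfl⟩
  refine ⟨(f _).2, ?_⟩
  have hs : (f (g (g' 0))).1.1 ≤ (f (g (g' n))).1.1 := hg (g'.monotone (Nat.zero_le n))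
  have ht : (f (g (g' 0))).1.2 ≤ (f (g (g' n))).1.2 := hg' (Nat.zero_le n)
  have h0 := hx _ (f (g (g' 0))).2
  have hn := hx _ (f (g (g' n))).2
  dsimp only
  generalize (f (g (g' 0))).1 = p at *
  generalize (f (g (g' n))).1 = q at *
  have h1 : (p.2⁻¹ * (p.1⁻¹ * q.1) * p.2) * (p.2⁻¹ * q.2) ∈ H := by
    convert H.mul_mem (H.inv_mem h0) hn using 1
    group
  have h2 : 1 ≤ p.2⁻¹ * (p.1⁻¹ * q.1) * p.2 := by
    have : p.2⁻¹ * 1 * p.2 ≤ p.2⁻¹ * (p.1⁻¹ * q.1) * p.2 := by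
      gcongr
      exact le_inv_mul_iff_mul_le.2 (by simpa using hs)
    simpa using this
  have h3 : 1 ≤ p.2⁻¹ * q.2 := le_inv_mul_iff_mul_le.2 (by simpa using ht)
  obtain ⟨h4, h5⟩ := hH.mem_of_mul_mem h2 h3 h1
  refine ⟨?_, h5⟩
  have := Subgroup.Normal.conj_mem ‹_› _ h4 p.2
  simpa [mul_assoc] using this

theorem finite_pairs {H : Subgroup Γ} [H.Normal] (hH : ConvexSubgroup H) {S T : Set Γ}
    (hS : S.IsPWO) (hT : T.IsPWO) (hS' : FiniteFibers H S) (hT' : FiniteFibers H T) (x : Γ) :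
    {p : Γ × Γ | p.1 ∈ S ∧ p.2 ∈ T ∧ x⁻¹ * (p.1 * p.2) ∈ H}.Finite := by
  by_contra hinf
  obtain ⟨p₀, -, hp⟩ := exists_infinite_fiber hH hS hT hinf (fun p hp => ⟨hp.1, hp.2.1⟩)
    fun p hp => hp.2.2
  exact hp (((hS' p₀.1).prod (hT' p₀.2)).subset fun p hp =>
    ⟨⟨hp.1.1, hp.2.1⟩, ⟨hp.1.2.1, hp.2.2⟩⟩)

theorem finite_pairs_eq {S T : Set Γ} (hS : S.IsPWO) (hT : T.IsPWO) (x : Γ) :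
    {p : Γ × Γ | p.1 ∈ S ∧ p.2 ∈ T ∧ p.1 * p.2 = x}.Finite :=
  (finite_pairs convexSubgroup_bot hS hT (finiteFibers_bot S) (finiteFibers_bot T) x).subset
    fun p hp => ⟨hp.1, hp.2.1, by simp [hp.2.2]⟩

theorem FiniteFibers.mul {H : Subgroup Γ} [H.Normal] (hH : ConvexSubgroup H) {S T : Set Γ}
    (hS : S.IsPWO) (hT : T.IsPWO) (hS' : FiniteFibers H S) (hT' : FiniteFibers H T) :
    FiniteFibers H {x | ∃ s ∈ S, ∃ t ∈ T, s * t = x} := fun x => by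
  refine ((finite_pairs hH hS hT hS' hT' x).image fun p => p.1 * p.2).subset ?_
  rintro _ ⟨⟨s, hs, t, ht, rfl⟩, h⟩
  exact ⟨(s, t), ⟨hs, ht, h⟩, rfl⟩

theorem Set.IsPWO.submonoid_closure_group {S : Set Γ} (hS : S.IsPWO) (h1 : ∀ s ∈ S, 1 ≤ s) :
    (Submonoid.closure S : Set Γ).IsPWO := by
  have := Set.PartiallyWellOrderedOn.partiallyWellOrderedOn_sublistForall₂ (· ≤ ·) hS
  refine (this.image_of_monotone_on (f := List.prod) ?_).mono ?_
  · intro l₁ _ l₂ h₂ h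
    exact h.prod_le_prod' fun a ha => h1 a (h₂ a ha)
  · intro x hx
    obtain ⟨l, hl, rfl⟩ := Submonoid.exists_list_of_mem_closure hx
    exact ⟨l, hl, rfl⟩

theorem FiniteFibers.submonoid_closure {H : Subgroup Γ} [H.Normal] (hH : ConvexSubgroup H)
    {S : Set Γ} (hS : S.IsPWO) (h1 : ∀ s ∈ S, 1 < s) (hSH : ∀ s ∈ S, s ∉ H)
    (hS' : FiniteFibers H S) : FiniteFibers H (Submonoid.closure S : Set Γ) := by
  set T : Set Γ := ((Submonoid.closure S : Submonoid Γ) : Set Γ) with hTdef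
  have hT : T.IsPWO := hS.submonoid_closure_group fun s hs => (h1 s hs).le
  have hmem : ∀ t ∈ T, {t' ∈ T | t⁻¹ * t' ∈ H}.Finite := by
    by_contra! hcon
    obtain ⟨x₀, hx₀, hbad⟩ := hcon
    obtain ⟨x, hx, hmin⟩ := (hT.mono (s := {t ∈ T | {t' ∈ T | t⁻¹ * t' ∈ H}.Infinite})
      fun t ht => ht.1).exists_minimal ⟨x₀, hx₀, hbad⟩
    let P : Set (Γ × Γ) := {p | p.1 ∈ S ∧ p.2 ∈ T ∧ x⁻¹ * (p.1 * p.2) ∈ H}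
    have hP : P.Infinite := by
      intro hfin
      refine hx.2 (((hfin.image fun p => p.1 * p.2).union (Set.finite_singleton 1)).subset ?_)
      rintro t ⟨ht, hxt⟩
      obtain ⟨l, hl, rfl⟩ := Submonoid.exists_list_of_mem_closure ht
      cases l with
      | nil => right; simp
      | cons s l =>
        left
        exact ⟨(s, l.prod), ⟨hl s (by simp), Submonoid.list_prod_mem _ fun y hy =>
          Submonoid.subset_closure (hl y (by simp [hy])), by simpa using hxt⟩, by simp⟩
    obtain ⟨p, hp, hinf⟩ := exists_infinite_fiber hH hS hT hP (fun p hp => ⟨hp.1, hp.2.1⟩)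
      fun p hp => hp.2.2
    have hfib : {t' ∈ T | p.2⁻¹ * t' ∈ H}.Infinite := fun hfin =>
      hinf (((hS' p.1).prod hfin).subset fun q hq =>
        ⟨⟨hq.1.1, hq.2.1⟩, ⟨hq.1.2.1, hq.2.2⟩⟩)
    have hlt : p.2 < x := by
      have hg : 1 < p.2⁻¹ * p.1 * p.2 := by
        have := mul_lt_mul_left (mul_lt_mul_right (h1 _ hp.1) p.2⁻¹) p.2
        simpa using this
      have hgH : p.2⁻¹ * p.1 * p.2 ∉ H := fun h => hSH _ hp.1 (by
        have := Subgroup.Normal.conj_mem ‹_› _ h p.2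
        simpa [mul_assoc] using this)
      have hlt := mul_lt_mul_right (hH _ hp.2.2 _ hgH hg) x
      have h3 : p.2 * (p.2⁻¹ * p.1 * p.2) < x * (p.2⁻¹ * p.1 * p.2) := by
        simpa [mul_assoc] using hlt
      exact lt_of_mul_lt_mul_right' h3
    exact absurd (hmin (y := p.2) ⟨hp.2.1, hfib⟩ hlt.le) (not_le.2 hlt)
  intro x
  by_cases h : ∃ t ∈ T, x⁻¹ * t ∈ H
  · obtain ⟨t, ht, hxt⟩ := h
    refine (hmem t ht).subset fun s hs => ⟨hs.1, ?_⟩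
    convert H.mul_mem (H.inv_mem hxt) hs.2 using 1
    group
  · exact (Set.finite_empty).subset fun s hs => h ⟨s, hs⟩

end OrderedGroupSets

section Series

variable {Γ : Type*} [Group Γ] [LinearOrder Γ]

/-- A separated descending sequence of convex normal subgroups of an ordered group. -/
structure ConvexFiltration (Γ : Type*) [Group Γ] [LinearOrder Γ] where
  /-- The terms of the filtration. -/
  sub : ℕ → Subgroup Γ
  normal : ∀ N, (sub N).Normal
  anti : Antitone sub
  convex : ∀ N, ConvexSubgroup (sub N)
  sep : ∀ g, (∀ N, g ∈ sub N) → g = 1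

attribute [instance] ConvexFiltration.normal

namespace ConvexFiltration

/-- A partially well ordered set with finite fibers modulo some term of the filtration. -/
def Tame (D : ConvexFiltration Γ) (S : Set Γ) : Prop := S.IsPWO ∧ ∃ N, FiniteFibers (D.sub N) S

variable {D : ConvexFiltration Γ}

theorem Tame.mono {S T : Set Γ} (hT : D.Tame T) (h : S ⊆ T) : D.Tame S :=
  ⟨hT.1.mono h, hT.2.imp fun _ hN => hN.mono h⟩

theorem Tame.union {S T : Set Γ} (hS : D.Tame S) (hT : D.Tame T) : D.Tame (S ∪ T) := by
  obtain ⟨hS, N, hN⟩ := hS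
  obtain ⟨hT, M, hM⟩ := hT
  exact ⟨hS.union hT, max N M, (hN.anti (D.anti (le_max_left _ _))).union
    (hM.anti (D.anti (le_max_right _ _)))⟩

theorem _root_.Set.Finite.tame {S : Set Γ} (hS : S.Finite) : D.Tame S :=
  ⟨hS.isPWO, 0, hS.finiteFibers _⟩

variable [MulLeftMono Γ] [MulRightMono Γ]

theorem Tame.mul {S T : Set Γ} (hS : D.Tame S) (hT : D.Tame T) :
    D.Tame {x | ∃ s ∈ S, ∃ t ∈ T, s * t = x} := by
  obtain ⟨hS, N, hN⟩ := hS
  obtain ⟨hT, M, hM⟩ := hT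
  exact ⟨hS.mul_group hT, max N M, FiniteFibers.mul (D.convex _) hS hT
    (hN.anti (D.anti (le_max_left _ _))) (hM.anti (D.anti (le_max_right _ _)))⟩

end ConvexFiltration

variable {K : Type*} [Field K]

/-- The convolution product of functions on a group. -/
noncomputable def convolve (f g : Γ → K) (x : Γ) : K := ∑ᶠ a, f a * g (a⁻¹ * x)

omit [LinearOrder Γ] in
theorem convolve_eq_zero {f g : Γ → K} {x : Γ}
    (h : ¬ ∃ s ∈ f.support, ∃ t ∈ g.support, s * t = x) : convolve f g x = 0 := by
  refine finsum_eq_zero_of_forall_eq_zero fun a => ?_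
  by_contra hne
  exact h ⟨a, left_ne_zero_of_mul hne, a⁻¹ * x, right_ne_zero_of_mul hne, by group⟩

theorem single_convolve (a : Γ) (r : K) (g : Γ → K) (x : Γ) :
    convolve (Pi.single a r) g x = r * g (a⁻¹ * x) := by
  rw [convolve, finsum_eq_single _ a fun y hy => by simp [hy]]
  simp

theorem convolve_one (f : Γ → K) : convolve f (Pi.single 1 1) = f := by
  ext x
  rw [convolve, finsum_eq_single _ x fun y hy => by
    rw [Pi.single_eq_of_ne, mul_zero]
    rwa [Ne, inv_mul_eq_one]]
  simp

variable [MulLeftMono Γ] [MulRightMono Γ]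

theorem convolve_finite {f g : Γ → K} (hf : f.support.IsPWO) (hg : g.support.IsPWO) (x : Γ) :
    (Function.support fun a => f a * g (a⁻¹ * x)).Finite := by
  refine ((finite_pairs_eq hf hg x).image Prod.fst).subset fun a ha => ?_
  exact ⟨(a, a⁻¹ * x), ⟨left_ne_zero_of_mul ha, right_ne_zero_of_mul ha, by group⟩, rfl⟩

theorem convolve_assoc {f g h : Γ → K} (hf : f.support.IsPWO) (hg : g.support.IsPWO)
    (hh : h.support.IsPWO) : convolve (convolve f g) h = convolve f (convolve g h) := by
  ext x
  let F : Γ × Γ → K := fun p => f p.1 * (g (p.1⁻¹ * p.2) * h (p.2⁻¹ * x))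
  have hF : F.HasFiniteSupport := by
    have h1 := finite_pairs_eq (hf.mul_group hg) hh x
    have h2 := h1.biUnion fun p _ => (finite_pairs_eq hf hg p.1)
    refine (h2.image fun p => (p.1, p.1 * p.2)).subset ?_
    rintro ⟨a, y⟩ hay
    have ha : f a ≠ 0 := left_ne_zero_of_mul hay
    have hg' : g (a⁻¹ * y) ≠ 0 := left_ne_zero_of_mul (right_ne_zero_of_mul hay)
    have hh' : h (y⁻¹ * x) ≠ 0 := right_ne_zero_of_mul (right_ne_zero_of_mul hay)
    refine ⟨(a, a⁻¹ * y), ?_, by simp⟩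
    simp only [Set.mem_iUnion]
    exact ⟨(y, y⁻¹ * x), ⟨⟨a, ha, a⁻¹ * y, hg', by group⟩, hh', by simp⟩, ha, hg', by simp⟩
  have hL : convolve (convolve f g) h x = ∑ᶠ p : Γ × Γ, F p.swap := by
    rw [finsum_curry _ (by
      have := hF.preimage (f := Prod.swap) (Prod.swap_injective.injOn)
      exact this)]
    refine finsum_congr fun y => ?_
    rw [convolve, finsum_mul' _ _ (convolve_finite hf hg y)]
    refine finsum_congr fun a => ?_
    simp [F, mul_assoc]
  have hR : convolve f (convolve g h) x = ∑ᶠ p : Γ × Γ, F p := by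
    rw [finsum_curry _ hF]
    refine finsum_congr fun a => ?_
    rw [convolve, mul_finsum' _ _ (convolve_finite hg hh _),
      ← finsum_comp_equiv (Equiv.mulLeft a⁻¹)]
    refine finsum_congr fun y => ?_
    simp [F, mul_assoc]
  rw [hL, hR]
  exact finsum_comp_equiv (Equiv.prodComm Γ Γ) (f := F)

theorem ConvexFiltration.Tame.convolve {D : ConvexFiltration Γ} {f g : Γ → K}
    (hf : D.Tame f.support) (hg : D.Tame g.support) : D.Tame (convolve f g).support :=
  (hf.mul hg).mono fun _ hx => by_contra fun h => hx (convolve_eq_zero h)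

/-- Functions with tame support. -/
def tameSeries (D : ConvexFiltration Γ) (K : Type*) [Field K] : AddSubgroup (Γ → K) where
  carrier := {f | D.Tame f.support}
  zero_mem' := by simpa using! (Set.finite_empty.tame : D.Tame ∅)
  add_mem' hf hg := (hf.union hg).mono (Function.support_add _ _)
  neg_mem' hf := by simpa using! hf

variable {D : ConvexFiltration Γ}

noncomputable instance : Mul (tameSeries D K) := ⟨fun f g => ⟨convolve f g, f.2.convolve g.2⟩⟩

noncomputable instance : One (tameSeries D K) :=
  ⟨⟨Pi.single 1 1, ((Set.finite_singleton (1 : Γ)).tame).mono Pi.support_single_subset⟩⟩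

theorem tameSeries_mul_apply (f g : tameSeries D K) (x : Γ) :
    (f * g).1 x = ∑ᶠ a, f.1 a * g.1 (a⁻¹ * x) := rfl

omit [MulLeftMono Γ] [MulRightMono Γ] in
theorem tameSeries_one_apply (x : Γ) :
    (1 : tameSeries D K).1 x = if x = 1 then 1 else 0 := by
  change (Pi.single 1 1 : Γ → K) x = _
  rw [Pi.single_apply]

noncomputable instance : Ring (tameSeries D K) where
  __ := (inferInstance : AddCommGroup (tameSeries D K))
  left_distrib f g h := by
    ext x
    change ∑ᶠ a, f.1 a * (g.1 (a⁻¹ * x) + h.1 (a⁻¹ * x)) = _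
    simp_rw [mul_add]
    exact finsum_add_distrib (convolve_finite f.2.1 g.2.1 x) (convolve_finite f.2.1 h.2.1 x)
  right_distrib f g h := by
    ext x
    change ∑ᶠ a, (f.1 a + g.1 a) * h.1 (a⁻¹ * x) = _
    simp_rw [add_mul]
    exact finsum_add_distrib (convolve_finite f.2.1 h.2.1 x) (convolve_finite g.2.1 h.2.1 x)
  zero_mul f := by
    ext x
    change ∑ᶠ a, 0 * f.1 (a⁻¹ * x) = 0
    simp
  mul_zero f := by
    ext x
    change ∑ᶠ a, f.1 a * 0 = 0
    simp
  mul_assoc f g h := Subtype.ext (convolve_assoc f.2.1 g.2.1 h.2.1)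
  one_mul f := by
    ext x
    exact (single_convolve 1 1 f.1 x).trans (by simp)
  mul_one f := Subtype.ext (convolve_one f.1)

open Classical in
/-- The coefficients of the inverse of a series with leading term at `m`. -/
noncomputable def invCoeff {T : Set Γ} (hT : T.IsWF) (m : Γ) (S : Set Γ) (f : Γ → K) : Γ → K :=
  (Set.wellFoundedOn_iff.1 hT).fix fun t rec => if ht : t ∈ T then
    (f m)⁻¹ * ((if t = 1 then 1 else 0) - ∑ᶠ s, if hs : s ∈ S ∧ s⁻¹ * t ∈ T ∧ s⁻¹ * t < t then
      f (m * s) * rec (s⁻¹ * t) ⟨hs.2.2, hs.2.1, ht⟩ else 0) else 0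

omit [MulLeftMono Γ] [MulRightMono Γ] in
open Classical in
theorem invCoeff_eq {T : Set Γ} (hT : T.IsWF) (m : Γ) (S : Set Γ) (f : Γ → K) (t : Γ) :
    invCoeff hT m S f t = if t ∈ T then (f m)⁻¹ * ((if t = 1 then 1 else 0) -
      ∑ᶠ s, if s ∈ S ∧ s⁻¹ * t ∈ T ∧ s⁻¹ * t < t then f (m * s) * invCoeff hT m S f (s⁻¹ * t)
        else 0) else 0 := by
  rw [invCoeff, WellFounded.fix_eq]
  rfl

theorem exists_right_inverse {f : Γ → K} (hf : D.Tame f.support) (hne : f ≠ 0) :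
    ∃ g : Γ → K, D.Tame g.support ∧ convolve f g = Pi.single 1 1 := by
  classical
  have hwf := Set.isPWO_iff_isWF.1 hf.1
  have hnonempty : f.support.Nonempty := Function.support_nonempty_iff.2 hne
  set m := hwf.min hnonempty with hm
  have hmem : f m ≠ 0 := hwf.min_mem hnonempty
  have hmin : ∀ s, f s ≠ 0 → m ≤ s := fun s hs => hwf.min_le hnonempty hs
  set S : Set Γ := {s | f (m * s) ≠ 0 ∧ s ≠ 1} with hS
  have hS1 : ∀ s ∈ S, 1 < s := fun s hs => lt_of_le_of_ne (by
    have := hmin _ hs.1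
    simpa using this) hs.2.symm
  have hSt : D.Tame S := by
    refine (((Set.finite_singleton m⁻¹).tame).mul hf).mono ?_
    intro s hs
    exact ⟨m⁻¹, rfl, m * s, hs.1, by group⟩
  obtain ⟨hSP, N₀, hN₀⟩ := hSt
  obtain ⟨N, hNN₀, hN⟩ : ∃ N, N₀ ≤ N ∧ ∀ s ∈ S, s ∉ D.sub N := by
    have hfin : {s ∈ S | s ∈ D.sub N₀}.Finite := by simpa using hN₀ 1
    have hex : ∀ s ∈ hfin.toFinset, ∃ n, s ∉ D.sub n := by
      intro s hs
      by_contra! h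
      exact (hS1 s ((hfin.mem_toFinset.1 hs).1)).ne' (D.sep s h)
    choose! n hn using hex
    refine ⟨max N₀ (hfin.toFinset.sup n), le_max_left _ _, fun s hs hsN => ?_⟩
    have hs₀ : s ∈ hfin.toFinset := hfin.mem_toFinset.2 ⟨hs, D.anti (le_max_left _ _) hsN⟩
    exact hn s hs₀ (D.anti ((Finset.le_sup hs₀).trans (le_max_right _ _)) hsN)
  set T : Set Γ := ((Submonoid.closure S : Submonoid Γ) : Set Γ) with hT
  have hTt : D.Tame T := ⟨hSP.submonoid_closure_group fun s hs => (hS1 s hs).le, N,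
    FiniteFibers.submonoid_closure (D.convex N) hSP hS1 hN (hN₀.anti (D.anti hNN₀))⟩
  have hTwf : T.IsWF := hTt.1.isWF
  set h := invCoeff hTwf m S f with hh
  have hsupp : h.support ⊆ T := by
    intro t ht
    by_contra hc
    exact ht (by rw [hh, invCoeff_eq, if_neg hc])
  have hgt : D.Tame (Function.support fun z => h (z * m)) := by
    refine (hTt.mul (Set.finite_singleton m⁻¹).tame).mono ?_
    intro z hz
    exact ⟨z * m, hsupp hz, m⁻¹, rfl, by group⟩
  refine ⟨fun z => h (z * m), hgt, ?_⟩
  ext x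
  set t := m⁻¹ * x * m with ht
  have hx1 : x = 1 ↔ t = 1 := by
    constructor
    · rintro rfl
      simp [ht]
    · intro h1
      have : m * t * m⁻¹ = 1 := by rw [h1]; group
      rw [← this, ht]
      group
  have hconv : convolve f (fun z => h (z * m)) x = ∑ᶠ s, f (m * s) * h (s⁻¹ * t) := by
    rw [convolve, ← finsum_comp_equiv (Equiv.mulLeft m)]
    refine finsum_congr fun s => ?_
    simp [ht, mul_assoc]
  have hfin : (Function.support fun s => f (m * s) * h (s⁻¹ * t)).Finite := by
    refine ((convolve_finite hf.1 hgt.1 x).image fun a => m⁻¹ * a).subset fun s hs => ?_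
    refine ⟨m * s, ?_, by group⟩
    rw [Function.mem_support] at hs ⊢
    convert hs using 3
    rw [ht]
    group
  have hterm : ∀ s, f (m * s) * h (s⁻¹ * t) = (if s = 1 then f m * h t else 0) +
      (if s ∈ S ∧ s⁻¹ * t ∈ T ∧ s⁻¹ * t < t then f (m * s) * h (s⁻¹ * t) else 0) := by
    intro s
    by_cases hs1 : s = 1
    · subst hs1
      simp [hS]
    · rw [if_neg hs1, zero_add]
      split_ifs with hc
      · rfl
      · by_contra hne'
        have hsS : s ∈ S := ⟨left_ne_zero_of_mul hne', hs1⟩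
        refine hc ⟨hsS, hsupp (right_ne_zero_of_mul hne'), ?_⟩
        have := mul_lt_mul_left (inv_lt_one'.2 (hS1 s hsS)) t
        simpa using this
  have hsum : ∑ᶠ s, f (m * s) * h (s⁻¹ * t) = f m * h t +
      ∑ᶠ s, if s ∈ S ∧ s⁻¹ * t ∈ T ∧ s⁻¹ * t < t then f (m * s) * h (s⁻¹ * t) else 0 := by
    rw [finsum_congr hterm, finsum_add_distrib]
    · rw [finsum_eq_single _ 1 fun y hy => if_neg hy, if_pos rfl]
    · exact (Set.finite_singleton 1).subset fun s hs => by
        by_contra hc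
        exact hs (if_neg hc)
    · exact hfin.subset fun s hs hc => hs (by
        dsimp only at hc ⊢
        rw [hc, ite_self])
  rw [hconv, hsum, Pi.single_apply]
  by_cases htT : t ∈ T
  · have := invCoeff_eq hTwf m S f t
    rw [if_pos htT, ← hh] at this
    rw [this, mul_inv_cancel_left₀ hmem]
    simp only [hx1]
    convert sub_add_cancel _ _
  · have h1 : x ≠ 1 := fun hx => htT (by rw [hx1.1 hx]; exact Submonoid.one_mem _)
    have h2 : h t = 0 := by
      by_contra hc
      exact htT (hsupp hc)
    rw [if_neg h1, h2, mul_zero, zero_add]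
    refine finsum_eq_zero_of_forall_eq_zero fun s => if_neg fun hs => htT ?_
    have := Submonoid.mul_mem _ (Submonoid.subset_closure hs.1) hs.2.1
    simpa [hT] using this

theorem tameSeries_exists_mul_eq_one (f : tameSeries D K) (hf : f ≠ 0) : ∃ g, f * g = 1 := by
  obtain ⟨g, hg, h⟩ := exists_right_inverse f.2 (fun h => hf (Subtype.ext h))
  exact ⟨⟨g, hg⟩, Subtype.ext h⟩

open Classical in
noncomputable instance : DivisionRing (tameSeries D K) where
  inv f := if hf : f = 0 then 0 else (tameSeries_exists_mul_eq_one f hf).choose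
  exists_pair_ne := ⟨0, 1, fun h => by
    have := congrArg (fun f : tameSeries D K => f.1 1) h
    simp [tameSeries_one_apply] at this⟩
  mul_inv_cancel f hf := by
    rw [dif_neg hf]
    exact (tameSeries_exists_mul_eq_one f hf).choose_spec
  inv_zero := dif_pos rfl
  nnqsmul := _
  nnqsmul_def _ _ := rfl
  qsmul := _
  qsmul_def _ _ := rfl

end Series

section Pairing

variable {Γ : Type*} {K : Type*} [Field K]

/-- The linear extension of a function on `Γ` to the group algebra. -/
noncomputable def pairing (q : Γ → K) : MonoidAlgebra K Γ →ₗ[K] K :=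
  Finsupp.linearCombination K q ∘ₗ (MonoidAlgebra.coeffLinearEquiv K).toLinearMap

theorem pairing_single (q : Γ → K) (s : Γ) (r : K) :
    pairing q (MonoidAlgebra.single s r) = r * q s := by
  simp [pairing, MonoidAlgebra.coeffLinearEquiv]

theorem pairing_sub (q q' : Γ → K) (c : MonoidAlgebra K Γ) :
    pairing (q - q') c = pairing q c - pairing q' c := by
  induction c using MonoidAlgebra.induction_linear with
  | zero => simp
  | add f g hf hg => rw [map_add, map_add, map_add, hf, hg, add_sub_add_comm]
  | single s r => simp [pairing_single, mul_sub]

variable [Group Γ]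

theorem pairing_of_factor {H : Subgroup Γ} [H.Normal] {q : Γ → K}
    (hq : ∀ x, ∀ d ∈ H, q (d * x) = q x) {c c' : MonoidAlgebra K Γ}
    (h : MonoidAlgebra.mapDomainRingHom K (QuotientGroup.mk' H) c =
      MonoidAlgebra.mapDomainRingHom K (QuotientGroup.mk' H) c') : pairing q c = pairing q c' := by
  have key : ∀ c, pairing q c = pairing (fun z : Γ ⧸ H => q z.out)
      (MonoidAlgebra.mapDomainRingHom K (QuotientGroup.mk' H) c) := by
    intro c
    induction c using MonoidAlgebra.induction_linear with
    | zero => simp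
    | add f g hf hg => rw [map_add, map_add, map_add, hf, hg]
    | single s r =>
      simp only [MonoidAlgebra.mapDomainRingHom_apply, MonoidAlgebra.mapDomain_single,
        pairing_single]
      congr 1
      have h1 : (((QuotientGroup.mk' H s).out : Γ) : Γ ⧸ H) = (s : Γ ⧸ H) :=
        Quotient.out_eq' _
      rw [QuotientGroup.eq] at h1
      have h2 := hq (QuotientGroup.mk' H s).out _ (Subgroup.Normal.conj_mem ‹_› _ h1
        (QuotientGroup.mk' H s).out)
      rw [← h2]
      congr 1
      group
  rw [key, key, h]

theorem pairing_finsum {H : Subgroup Γ} [H.Normal] {q : Γ → K}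
    (hq : FiniteFibers H q.support) (c : MonoidAlgebra K Γ) :
    (Function.HasFiniteSupport fun d : H => pairing q (MonoidAlgebra.single d.1 1 * c)) ∧
    pairing (fun x => ∑ᶠ d : H, q (d * x)) c =
      ∑ᶠ d : H, pairing q (MonoidAlgebra.single d.1 1 * c) := by
  induction c using MonoidAlgebra.induction_linear with
  | zero => simp [Function.HasFiniteSupport]
  | add f g hf hg =>
    simp only [mul_add, map_add]
    exact ⟨hf.1.add hg.1, by rw [finsum_add_distrib hf.1 hg.1, hf.2, hg.2]⟩
  | single s r =>
    have hfin : (Function.support fun d : H => q (d * s)).Finite := by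
      refine Set.Finite.of_finite_image (f := fun d : H => d.1 * s) ((hq s).subset ?_) ?_
      · rintro _ ⟨d, hd, rfl⟩
        exact ⟨hd, by simpa [mul_assoc] using Subgroup.Normal.conj_mem ‹_› _ d.2 s⁻¹⟩
      · intro a _ b _ hab
        exact Subtype.ext (mul_right_cancel hab)
    simp only [MonoidAlgebra.single_mul_single, pairing_single, one_mul]
    refine ⟨hfin.subset fun d hd => right_ne_zero_of_mul hd, ?_⟩
    exact mul_finsum' _ _ hfin

variable {β : Type*} [Fintype β] [DecidableEq β]

/-- A family of functions with finite fibers that is orthogonal to all left multiples of the rows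
of `A` vanishes if `A` is left invertible modulo each term of the filtration. -/
theorem eq_zero_of_pairing_eq_zero {D : ℕ → Subgroup Γ} [∀ N, (D N).Normal] (hD : Antitone D)
    (hsep : ∀ g, (∀ N, g ∈ D N) → g = 1) {A : β → β → MonoidAlgebra K Γ}
    (hA : ∀ N, ∃ B : β → β → MonoidAlgebra K Γ, ∀ l i,
      MonoidAlgebra.mapDomainRingHom K (QuotientGroup.mk' (D N)) (∑ k, B l k * A k i) =
        if l = i then 1 else 0)
    {q : β → Γ → K} (hq : ∀ i, ∃ M, FiniteFibers (D M) (q i).support)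
    (h : ∀ x k, ∑ i, pairing (q i) (MonoidAlgebra.single x 1 * A k i) = 0) : q = 0 := by
  have h' : ∀ b k, ∑ i, pairing (q i) (b * A k i) = 0 := by
    intro b k
    induction b using MonoidAlgebra.induction_linear with
    | zero => simp
    | add f g hf hg => simp only [add_mul, map_add, Finset.sum_add_distrib, hf, hg, add_zero]
    | single s r =>
      have : MonoidAlgebra.single s r = r • MonoidAlgebra.single s (1 : K) := by simp
      simp only [this, smul_mul_assoc, map_smul, ← Finset.smul_sum, h, smul_zero]
  choose M hM using hq
  have main : ∀ N, (∀ i, M i ≤ N) → ∀ l x, ∑ᶠ d : D N, q l (d * x) = 0 := by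
    intro N hN l x
    have hfib : ∀ i, FiniteFibers (D N) (q i).support := fun i => (hM i).anti (hD (hN i))
    obtain ⟨B, hB⟩ := hA N
    let Q : β → Γ → K := fun i x => ∑ᶠ d : D N, q i (d * x)
    have hQ : ∀ b k, ∑ i, pairing (Q i) (b * A k i) = 0 := by
      intro b k
      rw [Finset.sum_congr rfl fun i _ => (pairing_finsum (hfib i) (b * A k i)).2,
        ← finsum_sum_comm _ _ fun i _ => (pairing_finsum (hfib i) (b * A k i)).1]
      refine finsum_eq_zero_of_forall_eq_zero fun d => ?_
      simp only [← mul_assoc, h']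
    have hinv : ∀ i x, ∀ d ∈ D N, Q i (d * x) = Q i x := by
      intro i x d hd
      simp only [Q]
      exact (finsum_congr fun a => by simp [mul_assoc]).trans
        (finsum_comp_equiv (Equiv.mulRight (⟨d, hd⟩ : D N)) (f := fun a : D N => q i (a * x)))
    have h1 : ∑ i, pairing (Q i) (MonoidAlgebra.single x 1 * if l = i then 1 else 0) = 0 := by
      have h2 : ∀ i, pairing (Q i) (MonoidAlgebra.single x 1 * if l = i then 1 else 0) =
          pairing (Q i) (MonoidAlgebra.single x 1 * ∑ k, B l k * A k i) := by
        intro i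
        refine pairing_of_factor (hinv i) ?_
        rw [map_mul, map_mul, hB]
        congr 1
        split_ifs
        · exact map_one _
        · exact map_zero _
      simp only [h2, Finset.mul_sum, map_sum, ← mul_assoc]
      rw [Finset.sum_comm]
      exact Finset.sum_eq_zero fun k _ => hQ _ k
    rw [Finset.sum_eq_single l (fun i _ hi => by rw [if_neg hi.symm, mul_zero, map_zero])
      (by simp), if_pos rfl, mul_one, pairing_single, one_mul] at h1
    exact h1
  funext l x
  by_contra hne
  have hfin : {s ∈ (q l).support | x⁻¹ * s ∈ D (M l)}.Finite := hM l x
  have hex : ∀ s, ∃ n, s ≠ x → x⁻¹ * s ∉ D n := by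
    intro s
    by_contra! hcon
    exact (hcon 0).1 (inv_mul_eq_one.1 (hsep _ fun n => (hcon n).2)).symm
  choose n hn using hex
  set N := max (Finset.univ.sup M) (hfin.toFinset.sup n) with hN
  have hMN : ∀ i, M i ≤ N := fun i => (Finset.le_sup (Finset.mem_univ i)).trans (le_max_left _ _)
  have := main N hMN l x
  rw [finsum_eq_single _ 1] at this
  · exact hne (by simpa using this)
  · intro d hd
    by_contra hq
    have hdx : x⁻¹ * (d * x) ∈ D N := by
      simpa [mul_assoc] using Subgroup.Normal.conj_mem (inferInstance : (D N).Normal) _ d.2 x⁻¹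
    have hmem : (d * x : Γ) ∈ hfin.toFinset :=
      hfin.mem_toFinset.2 ⟨hq, hD (hMN l) hdx⟩
    refine hn (d * x) ?_ (hD ((Finset.le_sup hmem).trans (le_max_right _ _)) hdx)
    intro h1
    exact hd (Subtype.ext (by simpa using h1))

end Pairing

section TwoSided

variable {Γ : Type*} [Group Γ] {K : Type*} [Field K] {β : Type*} [Fintype β] [DecidableEq β]

theorem exists_tame_inverse [LinearOrder Γ] [MulLeftMono Γ] [MulRightMono Γ]
    (D : ConvexFiltration Γ) {A : β → β → MonoidAlgebra K Γ}
    (hA : ∀ N, ∃ B : β → β → MonoidAlgebra K Γ, ∀ l i,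
      MonoidAlgebra.mapDomainRingHom K (QuotientGroup.mk' (D.sub N)) (∑ k, B l k * A k i) =
        if l = i then 1 else 0) (l : β) :
    ∃ p : β → Γ → K, (∀ i, D.Tame (p i).support) ∧ ∀ x k,
      ∑ i, pairing (p i) (MonoidAlgebra.single x 1 * A k i) = if k = l ∧ x = 1 then 1 else 0 := by
  let α : β → β → tameSeries D K := fun k i => ⟨fun s => (A k i).coeff s⁻¹,
    Set.Finite.tame (((A k i).coeff.hasFiniteSupport.preimage inv_injective.injOn))⟩
  have hα : ∀ (f : tameSeries D K) k i x,
      (f * α k i).1 x = pairing f.1 (MonoidAlgebra.single x 1 * A k i) := by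
    intro f k i x
    rw [tameSeries_mul_apply]
    have h1 : ∀ c : MonoidAlgebra K Γ, pairing f.1 (MonoidAlgebra.single x 1 * c) =
        ∑ᶠ a, f.1 a * c.coeff (x⁻¹ * a) := by
      intro c
      have h2 : ∀ c : MonoidAlgebra K Γ,
          (Function.support fun a => f.1 a * c.coeff (x⁻¹ * a)).Finite := fun c =>
        (c.coeff.hasFiniteSupport.preimage (mul_right_injective x⁻¹).injOn).subset
          fun a ha => right_ne_zero_of_mul ha
      induction c using MonoidAlgebra.induction_linear with
      | zero => simp
      | add c c' hc hc' =>
        simp only [mul_add, map_add, hc, hc', MonoidAlgebra.coeff_add, Finsupp.add_apply]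
        exact (finsum_add_distrib (h2 c) (h2 c')).symm
      | single s r =>
        rw [MonoidAlgebra.single_mul_single, pairing_single, finsum_eq_single _ (x * s)]
        · simp [mul_comm]
        · intro y hy
          rw [MonoidAlgebra.coeff_single, Finsupp.single_eq_of_ne, mul_zero]
          rintro h
          exact hy (by rw [← h]; group)
    rw [h1]
    simp [α]
  let Φ : (β → tameSeries D K) →ₗ[tameSeries D K] (β → tameSeries D K) :=
    { toFun := fun q k => ∑ i, q i * α k i
      map_add' := fun q q' => by
        ext1 k
        simp [add_mul, Finset.sum_add_distrib]
      map_smul' := fun r q => by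
        ext1 k
        simp [Finset.mul_sum, mul_assoc] }
  have hval : ∀ (q : β → tameSeries D K) k x, (∑ i, q i * α k i).1 x =
      ∑ i, pairing (q i).1 (MonoidAlgebra.single x 1 * A k i) := by
    intro q k x
    have : (∑ i, q i * α k i).1 = ∑ i, (q i * α k i).1 :=
      map_sum (tameSeries D K).subtype _ _
    rw [this, Finset.sum_apply]
    exact Finset.sum_congr rfl fun i _ => hα _ _ _ _
  have hinj : Function.Injective Φ := by
    rw [injective_iff_map_eq_zero]
    intro q hq
    have h0 : (fun i => (q i).1) = 0 := by
      refine eq_zero_of_pairing_eq_zero D.anti D.sep hA (fun i => (q i).2.2) fun x k => ?_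
      rw [← hval]
      have := congrFun hq k
      change ∑ i, q i * α k i = 0 at this
      rw [this]
      rfl
    funext i
    exact Subtype.ext (congrFun h0 i)
  obtain ⟨p, hp⟩ := LinearMap.injective_iff_surjective.1 hinj (Pi.single l 1)
  refine ⟨fun i => (p i).1, fun i => (p i).2, fun x k => ?_⟩
  rw [← hval]
  have := congrFun hp k
  change ∑ i, p i * α k i = _ at this
  rw [this, Pi.single_apply]
  by_cases hk : k = l
  · simp [hk, tameSeries_one_apply]
  · simp [hk]

omit [Group Γ] in
theorem Set.finite_of_isPWO_of_isPWO_orderDual [o : LinearOrder Γ] {S : Set Γ} (h : S.IsPWO)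
    (h' : @Set.IsPWO Γ (@OrderDual.instLinearOrder Γ o).toPreorder S) : S.Finite := by
  by_contra hinf
  let f := Set.Infinite.natEmbedding S hinf
  obtain ⟨g, hg⟩ := h.exists_monotone_subseq (f := fun n => (f n).1) fun n => (f n).2
  obtain ⟨g', hg'⟩ := @Set.IsPWO.exists_monotone_subseq Γ
    (@OrderDual.instLinearOrder Γ o).toPreorder S h' (fun n => (f (g n)).1) fun n => (f _).2
  have h1 : (f (g (g' 0))).1 ≤ (f (g (g' 1))).1 := hg (g'.monotone zero_le_one)
  have h2 : (f (g (g' 1))).1 ≤ (f (g (g' 0))).1 := hg' zero_le_one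
  have h3 := g'.injective (g.injective (f.injective (Subtype.ext (le_antisymm h1 h2))))
  exact absurd h3 zero_ne_one

/-- A square matrix over the group algebra of an ordered group that is left invertible modulo each
term of a convex filtration is right invertible. -/
theorem exists_right_inverse_of_quotients [o : LinearOrder Γ] [hl : MulLeftMono Γ]
    [hr : MulRightMono Γ] (D : ConvexFiltration Γ) {A : β → β → MonoidAlgebra K Γ}
    (hA : ∀ N, ∃ B : β → β → MonoidAlgebra K Γ, ∀ l i,
      MonoidAlgebra.mapDomainRingHom K (QuotientGroup.mk' (D.sub N)) (∑ k, B l k * A k i) =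
        if l = i then 1 else 0) :
    ∃ C : β → β → MonoidAlgebra K Γ, ∀ k l, ∑ i, A k i * C i l = if k = l then 1 else 0 := by
  have hmem_of_neg : ∀ N, ∀ d ∈ D.sub N, ∀ g ∉ D.sub N, g < 1 → g < d := fun N d hd g hg h => by
    have := D.convex N d⁻¹ (inv_mem hd) g⁻¹ (fun h => hg (by simpa using inv_mem h)) (by simpa)
    simpa using this
  let D' : @ConvexFiltration Γ _ (@OrderDual.instLinearOrder Γ o) :=
    @ConvexFiltration.mk Γ _ (@OrderDual.instLinearOrder Γ o) D.sub D.normal D.anti hmem_of_neg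
      D.sep
  choose p hp hpA using exists_tame_inverse D hA
  choose p' hp' hpA' using @exists_tame_inverse Γ _ K _ β _ _ (@OrderDual.instLinearOrder Γ o)
    ⟨fun a b c h => mul_le_mul_right (α := Γ) (show c ≤ b from h) a⟩
    ⟨fun a b c h => mul_le_mul_left (α := Γ) (show c ≤ b from h) a⟩ D' A hA
  have hpp : ∀ l, p l = p' l := by
    intro l
    rw [← sub_eq_zero]
    refine eq_zero_of_pairing_eq_zero D.anti D.sep hA (fun i => ?_) fun x k => ?_
    · obtain ⟨N, hN⟩ := (hp l i).2
      obtain ⟨N', hN'⟩ := (hp' l i).2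
      exact ⟨max N N', ((hN.anti (D.anti (le_max_left _ _))).union
        (hN'.anti (D.anti (le_max_right _ _)))).mono (Function.support_sub _ _)⟩
    · simp only [Pi.sub_apply, pairing_sub, Finset.sum_sub_distrib, hpA, hpA', sub_self]
  have hfin : ∀ l i, (p l i).support.Finite := fun l i =>
    Set.finite_of_isPWO_of_isPWO_orderDual (hp l i).1 (hpp l ▸ (hp' l i).1)
  let C : β → β → MonoidAlgebra K Γ := fun i l =>
    ∑ s ∈ (hfin l i).toFinset, MonoidAlgebra.single s⁻¹ (p l i s)
  have hC : ∀ i l x, (C i l).coeff x = p l i x⁻¹ := by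
    intro i l x
    simp only [C, MonoidAlgebra.coeff_sum, Finsupp.finsetSum_apply, MonoidAlgebra.coeff_single]
    rw [Finset.sum_eq_single x⁻¹]
    · simp
    · intro s _ hs
      rw [Finsupp.single_eq_of_ne]
      rintro rfl
      exact hs (inv_inv s).symm
    · intro h
      simpa using h
  have hmul : ∀ (c : MonoidAlgebra K Γ) i l x,
      (c * C i l).coeff x = pairing (p l i) (MonoidAlgebra.single x⁻¹ 1 * c) := by
    intro c i l x
    induction c using MonoidAlgebra.induction_linear with
    | zero => simp
    | add c c' hc hc' =>
      simp only [add_mul, mul_add, map_add, MonoidAlgebra.coeff_add, Finsupp.add_apply, hc, hc']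
    | single s r =>
      rw [MonoidAlgebra.single_mul_single, pairing_single, one_mul,
        MonoidAlgebra.coeff_single_mul_apply, hC]
      simp
  refine ⟨C, fun k l => ?_⟩
  ext x
  rw [MonoidAlgebra.coeff_sum, Finsupp.finsetSum_apply, Finset.sum_congr rfl fun i _ =>
    hmul (A k i) i l x, hpA]
  by_cases hk : k = l
  · by_cases hx : x = 1
    · simp [hk, hx, MonoidAlgebra.one_def]
    · simp [hk, hx, MonoidAlgebra.one_def]
  · simp [hk]

end TwoSided

section GenericPairs

variable {S : Type*} [CommRing S] {M M' : Type*} [AddCommGroup M] [Module S M] [AddCommGroup M']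
  [Module S M']

/-- The localization of `W / W'` at the prime `π` is torsion-free and has no nonzero divisible
elements, phrased in terms of elements. -/
structure PureSeparated (π : S) (W' W : Submodule S M) : Prop where
  pure : ∀ y ∈ W, ∀ s, ¬ π ∣ s → (s * π) • y ∈ W' → ∃ a, ¬ π ∣ a ∧ a • y ∈ W'
  sep : ∀ (y : ℕ → M) (s r : ℕ → S), (∀ n, y n ∈ W) → (∀ n, ¬ π ∣ s n) → (∀ n, ¬ π ∣ r n) →
    (∀ n, s n • y n - (r n * π) • y (n + 1) ∈ W') → ∃ a, ¬ π ∣ a ∧ a • y 0 ∈ W'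

namespace PureSeparated

variable {π : S}

theorem of_forall_mem {W' W : Submodule S M}
    (h : ∀ y ∈ W, ∃ a, ¬ π ∣ a ∧ a • y ∈ W') : PureSeparated π W' W :=
  ⟨fun y hy _ _ _ => h y hy, fun _ _ _ hy _ _ _ => h _ (hy 0)⟩

theorem of_le (hπ : Prime π) {W' W : Submodule S M} (h : W ≤ W') : PureSeparated π W' W :=
  of_forall_mem fun y hy => ⟨1, hπ.not_dvd_one, by simpa using h hy⟩

theorem sup_map {φ : M' →ₗ[S] M} {V : Submodule S M} {U : Submodule S M'}
    (h : PureSeparated π (U ⊓ V.comap φ) U) : PureSeparated π V (V ⊔ U.map φ) := by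
  have hdec : ∀ y ∈ V ⊔ U.map φ, ∃ u ∈ U, y - φ u ∈ V := by
    intro y hy
    obtain ⟨v, hv, _, ⟨u, hu, rfl⟩, rfl⟩ := Submodule.mem_sup.1 hy
    exact ⟨u, hu, by simpa using hv⟩
  have hback : ∀ y u, y - φ u ∈ V → (∃ a, ¬ π ∣ a ∧ a • u ∈ U ⊓ V.comap φ) →
      ∃ a, ¬ π ∣ a ∧ a • y ∈ V := by
    rintro y u hyu ⟨a, ha, -, hau⟩
    refine ⟨a, ha, ?_⟩
    have := V.add_mem (V.smul_mem a hyu) hau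
    simpa [smul_sub] using this
  refine ⟨fun y hy s hs hsy => ?_, fun y s r hy hs hr hrel => ?_⟩
  · obtain ⟨u, hu, hyu⟩ := hdec y hy
    refine hback y u hyu (h.pure u hu s hs ⟨U.smul_mem _ hu, ?_⟩)
    have := V.sub_mem hsy (V.smul_mem (s * π) hyu)
    simpa [smul_sub] using this
  · choose u hu hyu using fun n => hdec (y n) (hy n)
    refine hback _ _ (hyu 0) (h.sep u s r hu hs hr fun n => ⟨U.sub_mem (U.smul_mem _ (hu n))
      (U.smul_mem _ (hu (n + 1))), ?_⟩)
    have := V.add_mem (V.sub_mem (hrel n) (V.smul_mem (s n) (hyu n)))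
      (V.smul_mem (r n * π) (hyu (n + 1)))
    change φ (_ - _) ∈ V
    rw [map_sub, map_smul, map_smul]
    convert this using 1
    module

theorem map {W' W : Submodule S M} (h : PureSeparated π W' W) (φ : M →ₗ[S] M')
    (hφ : Function.Injective φ) (hW : W' ≤ W) : PureSeparated π (W'.map φ) (W.map φ) := by
  have := sup_map (π := π) (φ := φ) (V := W'.map φ) (U := W)
  rwa [Submodule.comap_map_eq_of_injective hφ, inf_eq_right.2 hW,
    sup_eq_right.2 (Submodule.map_mono hW), imp_iff_right h] at this

theorem iSup (hπ : Prime π) {c : ℕ → Submodule S M} (hc : Monotone c)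
    (h : ∀ n, PureSeparated π (c n) (c (n + 1))) : PureSeparated π (c 0) (⨆ n, c n) := by
  have hmul : ∀ {a b}, ¬ π ∣ a → ¬ π ∣ b → ¬ π ∣ a * b := fun ha hb => hπ.not_dvd_mul ha hb
  have hmem : ∀ {y}, y ∈ ⨆ n, c n ↔ ∃ n, y ∈ c n := fun {y} =>
    Submodule.mem_iSup_of_directed _ hc.directed_le
  have hpure : ∀ j k, ∀ y ∈ c (j + k), ∀ s, ¬ π ∣ s → (s * π) • y ∈ c j →
      ∃ a, ¬ π ∣ a ∧ a • y ∈ c j := by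
    intro j k
    induction k with
    | zero => exact fun y hy _ _ _ => ⟨1, hπ.not_dvd_one, by simpa using hy⟩
    | succ k ih =>
      intro y hy s hs hsy
      obtain ⟨a, ha, hay⟩ := (h (j + k)).pure y hy s hs (hc (Nat.le_add_right _ _) hsy)
      obtain ⟨b, hb, hby⟩ := ih _ hay s hs (by
        rw [smul_comm]
        exact (c j).smul_mem _ hsy)
      exact ⟨b * a, hmul hb ha, by rwa [mul_smul]⟩
  have hrescale : ∀ {y : ℕ → M} {s r a : ℕ → S},
      (∀ n, s n • y n - (r n * π) • y (n + 1) ∈ c 0) → ∀ n,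
      (s n * a (n + 1)) • a n • y n - ((r n * a n) * π) • a (n + 1) • y (n + 1) ∈ c 0 := by
    intro y s r a hrel n
    convert (c 0).smul_mem (a n * a (n + 1)) (hrel n) using 1
    module
  have hsep : ∀ i, ∀ (y : ℕ → M) (s r : ℕ → S), (∀ n, y n ∈ c i) → (∀ n, ¬ π ∣ s n) →
      (∀ n, ¬ π ∣ r n) → (∀ n, s n • y n - (r n * π) • y (n + 1) ∈ c 0) →
      ∃ a, ¬ π ∣ a ∧ a • y 0 ∈ c 0 := by
    intro i
    induction i with
    | zero => exact fun y _ _ hy _ _ _ => ⟨1, hπ.not_dvd_one, by simpa using hy 0⟩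
    | succ i ih =>
      intro y s r hy hs hr hrel
      choose a ha hay using fun m => (h i).sep (fun n => y (m + n)) (fun n => s (m + n))
        (fun n => r (m + n)) (fun n => hy _) (fun n => hs _) (fun n => hr _)
        (fun n => hc (Nat.zero_le i) (hrel (m + n)))
      obtain ⟨b, hb, hby⟩ := ih (fun n => a n • y n) _ _ hay (fun n => hmul (hs n) (ha (n + 1)))
        (fun n => hmul (hr n) (ha n)) (hrescale hrel)
      exact ⟨b * a 0, hmul hb (ha 0), by rwa [mul_smul]⟩
  refine ⟨fun y hy s hs hsy => ?_, fun y s r hy hs hr hrel => ?_⟩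
  · obtain ⟨i, hi⟩ := hmem.1 hy
    exact hpure 0 i y (by rwa [zero_add]) s hs hsy
  · obtain ⟨i, hi⟩ := hmem.1 (hy 0)
    have hall : ∀ n, ∃ a, ¬ π ∣ a ∧ a • y n ∈ c i := by
      intro n
      induction n with
      | zero => exact ⟨1, hπ.not_dvd_one, by simpa using hi⟩
      | succ n ih =>
        obtain ⟨a, ha, hay⟩ := ih
        obtain ⟨k, hk⟩ := hmem.1 (hy (n + 1))
        refine hpure i k _ (hc (Nat.le_add_left _ _) hk) (a * r n) (hmul ha (hr n)) ?_
        have h1 := (c i).smul_mem a (hc (Nat.zero_le i) (hrel n))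
        have h2 := (c i).sub_mem ((c i).smul_mem (s n) hay) h1
        convert h2 using 1
        module
    choose a ha hay using hall
    obtain ⟨b, hb, hby⟩ := hsep i (fun n => a n • y n) _ _ hay
      (fun n => hmul (hs n) (ha (n + 1))) (fun n => hmul (hr n) (ha n)) (hrescale hrel)
    exact ⟨b * a 0, hmul hb (ha 0), by rwa [mul_smul]⟩

theorem trans (hπ : Prime π) {W₁ W₂ W₃ : Submodule S M} (h : PureSeparated π W₁ W₂)
    (h' : PureSeparated π W₂ W₃) (h₁ : W₁ ≤ W₂) (h₂ : W₂ ≤ W₃) : PureSeparated π W₁ W₃ := by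
  let c : ℕ → Submodule S M := fun n => if n = 0 then W₁ else if n = 1 then W₂ else W₃
  have hc : ∀ n, c (n + 2) = W₃ := fun n => by simp [c]
  have hle : ∀ n, c n ≤ c (n + 1) := by
    rintro (_ | _ | n)
    exacts [h₁, h₂, by rw [hc, hc]]
  have := iSup hπ (monotone_nat_of_le_succ hle) (by
    rintro (_ | _ | n)
    exacts [h, h', of_le hπ (by rw [hc, hc])])
  have hsup : ⨆ n, c n = W₃ := by
    refine le_antisymm (iSup_le ?_) ((hc 0).ge.trans (le_iSup c 2))
    rintro (_ | _ | n)
    exacts [h₁.trans h₂, h₂, (hc n).le]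
  rwa [hsup] at this

theorem of_ideal [IsDomain S] [WfDvdMonoid S] (I : Ideal S) :
    ∃ f : S, f ≠ 0 ∧ ∀ π, Prime π → ¬ π ∣ f → PureSeparated π I ⊤ := by
  by_cases hI : I = ⊥
  · subst hI
    refine ⟨1, one_ne_zero, fun π hπ _ => ⟨fun y _ s hs hsy => ?_, fun y s r _ hs hr hrel => ?_⟩⟩
    · refine ⟨1, hπ.not_dvd_one, ?_⟩
      have hs0 : s ≠ 0 := by
        rintro rfl
        exact hs (dvd_zero _)
      simpa [hs0, hπ.ne_zero] using hsy
    · refine ⟨1, hπ.not_dvd_one, ?_⟩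
      have key : ∀ k n, π ^ k ∣ y n := by
        intro k
        induction k with
        | zero => simp
        | succ k ih =>
          intro n
          have h1 := hrel n
          rw [Submodule.mem_bot, sub_eq_zero, smul_eq_mul, smul_eq_mul] at h1
          refine hπ.pow_dvd_of_dvd_mul_left _ (hs n) ?_
          rw [h1, pow_succ', mul_assoc]
          exact (mul_dvd_mul_left _ (ih _)).mul_left _
      rw [one_smul, Submodule.mem_bot]
      by_contra hne
      obtain ⟨m, hm⟩ := FiniteMultiplicity.of_not_isUnit hπ.not_isUnit hne
      exact hm (key _ 0)
  · obtain ⟨f, hf, hf0⟩ := Submodule.exists_mem_ne_zero_of_ne_bot hI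
    exact ⟨f, hf0, fun π hπ hπf => of_forall_mem fun y _ => ⟨f, hπf, I.mul_mem_right y hf⟩⟩

end PureSeparated

end GenericPairs

section RelativelyFinitelyGenerated

variable {G : Type*} [Group G] {S : Type*} [CommRing S] {M : Type*} [AddCommGroup M] [Module S M]
  [DistribMulAction G M] [SMulCommClass G S M]

/-- A submodule stable under the action of a subgroup. -/
def StableUnder (L : Subgroup G) (W : Submodule S M) : Prop := ∀ g ∈ L, ∀ w ∈ W, g • w ∈ W

/-- `W` is a stable submodule that is finitely generated over the stable submodule `W'`. -/
structure RelFG (L : Subgroup G) (W' W : Submodule S M) : Prop where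
  stable' : StableUnder L W'
  stable : StableUnder L W
  le : W' ≤ W
  fg : ∃ X : Set M, X.Finite ∧ X ⊆ W ∧
    ∀ U : Submodule S M, StableUnder L U → W' ≤ U → X ⊆ U → W ≤ U

/-- A group of operators for which the finitely generated relative modules are Noetherian and
generically free. -/
structure GenericallyFree (S M : Type*) [CommRing S] [AddCommGroup M] [Module S M]
    [DistribMulAction G M] (L : Subgroup G) : Prop where
  noeth : ∀ {W' W : Submodule S M}, RelFG L W' W → ∀ E : ℕ → Submodule S M, Monotone E →
    (∀ n, StableUnder L (E n)) → (∀ n, W' ≤ E n) → (∀ n, E n ≤ W) → ∃ N, ∀ n, N ≤ n → E n = E N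
  generic : ∀ {W' W : Submodule S M}, RelFG L W' W →
    ∃ f : S, f ≠ 0 ∧ ∀ π, Prime π → ¬ π ∣ f → PureSeparated π W' W

omit [SMulCommClass G S M] in
theorem StableUnder.sup {L : Subgroup G} {W U : Submodule S M} (hW : StableUnder L W)
    (hU : StableUnder L U) : StableUnder L (W ⊔ U) := by
  intro g hg x hx
  obtain ⟨w, hw, u, hu, rfl⟩ := Submodule.mem_sup.1 hx
  rw [smul_add]
  exact Submodule.add_mem_sup (hW g hg w hw) (hU g hg u hu)

omit [SMulCommClass G S M] in
theorem StableUnder.inf {L : Subgroup G} {W U : Submodule S M} (hW : StableUnder L W)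
    (hU : StableUnder L U) : StableUnder L (W ⊓ U) :=
  fun g hg x hx => ⟨hW g hg x hx.1, hU g hg x hx.2⟩

omit [SMulCommClass G S M] in
theorem StableUnder.mono {L L' : Subgroup G} {W : Submodule S M} (hW : StableUnder L W)
    (h : L' ≤ L) : StableUnder L' W := fun g hg => hW g (h hg)

omit [SMulCommClass G S M] in
theorem StableUnder.smul_mem_iff {L : Subgroup G} {W : Submodule S M} (hW : StableUnder L W)
    {g : G} (hg : g ∈ L) {w : M} : g • w ∈ W ↔ w ∈ W :=
  ⟨fun h => by simpa using hW g⁻¹ (inv_mem hg) _ h, hW g hg w⟩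

omit [SMulCommClass G S M] in
theorem RelFG.of_intermediate {L : Subgroup G} {W' W V : Submodule S M} (h : RelFG L W' W)
    (hV : StableUnder L V) (h1 : W' ≤ V) (h2 : V ≤ W) : RelFG L V W :=
  ⟨hV, h.stable, h2, by
    obtain ⟨X, hX, hXW, hU⟩ := h.fg
    exact ⟨X, hX, hXW, fun U hUs hVU => hU U hUs (h1.trans hVU)⟩⟩

omit [SMulCommClass G S M] in
theorem GenericallyFree.of_trivial [IsDomain S] [IsPrincipalIdealRing S] {L : Subgroup G}
    (hL : ∀ g ∈ L, ∀ m : M, g • m = m) : GenericallyFree S M L := by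
  have hst : ∀ W : Submodule S M, StableUnder L W := fun W g hg w hw => by rwa [hL g hg]
  refine ⟨fun {W' W} h E hE _ hW'E hEW => ?_, fun {W' W} h => ?_⟩
  · obtain ⟨X, hX, hXW, hU⟩ := h.fg
    have hWX : W ≤ W' ⊔ Submodule.span S X :=
      hU _ (hst _) le_sup_left (Submodule.subset_span.trans (le_sup_right (a := W')))
    have hfg : (Submodule.span S X).FG := Submodule.fg_span hX
    have : IsNoetherian S (Submodule.span S X) := isNoetherian_of_fg_of_noetherian _ hfg
    obtain ⟨N, hN⟩ := monotone_stabilizes_iff_noetherian.2 this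
      ⟨fun n => (E n).comap (Submodule.span S X).subtype, fun m n h => Submodule.comap_mono (hE h)⟩
    refine ⟨N, fun n hn => le_antisymm (fun e he => ?_) (hE hn)⟩
    obtain ⟨w, hw, x, hx, rfl⟩ := Submodule.mem_sup.1 (hWX (hEW n he))
    have hxn : x ∈ E n := by
      simpa using (E n).sub_mem he (hW'E n hw)
    have h2 : (⟨x, hx⟩ : Submodule.span S X) ∈ (E n).comap (Submodule.span S X).subtype := hxn
    have h3 := hN n hn
    change _ = Submodule.comap _ (E n) at h3
    rw [← h3] at h2
    exact (E N).add_mem (hW'E N hw) h2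
  · obtain ⟨X, hX, hXW, hU⟩ := h.fg
    have hW : W = W' ⊔ Submodule.span S X :=
      le_antisymm (hU _ (hst _) le_sup_left (Submodule.subset_span.trans (le_sup_right (a := W'))))
        (sup_le h.le (Submodule.span_le.2 hXW))
    rw [hW]
    clear h hU hW hXW
    induction X, hX using Set.Finite.induction_on with
    | empty => exact ⟨1, one_ne_zero, fun π hπ _ => .of_le hπ (by simp)⟩
    | @insert x X _ _ ih =>
      obtain ⟨f, hf, h1⟩ := ih
      let V := W' ⊔ Submodule.span S X
      obtain ⟨f', hf', h2⟩ := PureSeparated.of_ideal (V.comap (LinearMap.toSpanSingleton S M x))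
      refine ⟨f * f', mul_ne_zero hf hf', fun π hπ hdvd => ?_⟩
      have h3 : PureSeparated π V (V ⊔ Submodule.map (LinearMap.toSpanSingleton S M x) ⊤) :=
        .sup_map (by
          rw [top_inf_eq]
          exact h2 π hπ fun h => hdvd (h.mul_left _))
      have h4 := (h1 π hπ fun h => hdvd (h.mul_right _)).trans hπ h3 le_sup_left le_sup_left
      convert h4 using 1
      rw [Submodule.map_top, LinearMap.range_toSpanSingleton, Submodule.span_insert, sup_assoc,
        sup_comm (Submodule.span S X)]

end RelativelyFinitelyGenerated

section Extension

variable {G : Type*} [Group G] {S : Type*} [CommRing S] {M : Type*} [AddCommGroup M] [Module S M]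
  [DistribMulAction G M] [SMulCommClass G S M]

theorem StableUnder.map {L : Subgroup G} [L.Normal] {W : Submodule S M} (hW : StableUnder L W)
    (t : G) : StableUnder L (W.map (DistribSMul.toLinearMap S M t)) := by
  rintro g hg _ ⟨w, hw, rfl⟩
  refine ⟨(t⁻¹ * g * t⁻¹⁻¹) • w, hW _ (Subgroup.Normal.conj_mem ‹_› g hg t⁻¹) w hw, ?_⟩
  simp [smul_smul, mul_assoc]

theorem StableUnder.comap {L : Subgroup G} [L.Normal] {W : Submodule S M} (hW : StableUnder L W)
    (t : G) : StableUnder L (W.comap (DistribSMul.toLinearMap S M t)) := by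
  intro g hg w hw
  have := hW _ (Subgroup.Normal.conj_mem ‹_› g hg t) _ hw
  simpa [smul_smul, mul_assoc] using this

/-- The layers `W' + W₀ + t W₀ + ⋯ + tⁿ⁻¹ W₀`. -/
def layers (t : G) (W' W₀ : Submodule S M) : ℕ → Submodule S M
  | 0 => W'
  | n + 1 => layers t W' W₀ n ⊔ W₀.map (DistribSMul.toLinearMap S M (t ^ n))

theorem layers_mono (t : G) (W' W₀ : Submodule S M) : Monotone (layers t W' W₀) :=
  monotone_nat_of_le_succ fun _ => le_sup_left

theorem le_iSup_layers (t : G) (W' W₀ : Submodule S M) : W₀ ≤ ⨆ n, layers t W' W₀ n :=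
  le_trans (b := layers t W' W₀ 1) (fun y hy => Submodule.mem_sup_right ⟨y, hy, by simp⟩)
    (le_iSup _ 1)

theorem layers_le {L : Subgroup G} {t : G} (ht : t ∈ L) {W' W₀ W : Submodule S M}
    (hW : StableUnder L W) (h' : W' ≤ W) (h₀ : W₀ ≤ W) (n : ℕ) : layers t W' W₀ n ≤ W := by
  induction n with
  | zero => exact h'
  | succ n ih =>
    refine sup_le ih ?_
    rintro _ ⟨w, hw, rfl⟩
    exact hW _ (pow_mem ht n) w (h₀ hw)

theorem layers_stable {L : Subgroup G} [L.Normal] (t : G) {W' W₀ : Submodule S M}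
    (h' : StableUnder L W') (h₀ : StableUnder L W₀) (n : ℕ) :
    StableUnder L (layers t W' W₀ n) := by
  induction n with
  | zero => exact h'
  | succ n ih => exact ih.sup (h₀.map _)

theorem smul_mem_layers {L : Subgroup G} {t : G} (ht : t ∈ L) {W' W₀ : Submodule S M}
    (h' : StableUnder L W') (n : ℕ) {x : M} (hx : x ∈ layers t W' W₀ n) :
    t • x ∈ layers t W' W₀ (n + 1) := by
  induction n generalizing x with
  | zero => exact Submodule.mem_sup_left (h' t ht x hx)
  | succ n ih =>
    obtain ⟨v, hv, _, ⟨w, hw, rfl⟩, rfl⟩ := Submodule.mem_sup.1 hx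
    rw [smul_add]
    refine Submodule.add_mem_sup (ih hv) ⟨w, hw, ?_⟩
    simp [smul_smul, pow_succ']

theorem smul_mem_iSup_layers {L : Subgroup G} {t : G} (ht : t ∈ L) {W' W₀ : Submodule S M}
    (h' : StableUnder L W') {x : M} (hx : x ∈ ⨆ n, layers t W' W₀ n) :
    t • x ∈ ⨆ n, layers t W' W₀ n := by
  rw [Submodule.mem_iSup_of_directed _ (layers_mono t W' W₀).directed_le] at hx ⊢
  obtain ⟨n, hn⟩ := hx
  exact ⟨n + 1, smul_mem_layers ht h' n hn⟩

theorem iSup_layers_stable {L : Subgroup G} [L.Normal] (t : G) {W' W₀ : Submodule S M}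
    (h' : StableUnder L W') (h₀ : StableUnder L W₀) : StableUnder L (⨆ n, layers t W' W₀ n) := by
  intro g hg x hx
  rw [Submodule.mem_iSup_of_directed _ (layers_mono t W' W₀).directed_le] at hx ⊢
  obtain ⟨n, hn⟩ := hx
  exact ⟨n, layers_stable t h' h₀ n g hg x hn⟩

/-- A finitely generated stable module for `L₁ = ⟨L, t⟩` is generated by a finitely generated
stable module for `L`. -/
theorem RelFG.exists_generators {L L₁ : Subgroup G} [L.Normal] {t : G} (hLL : L ≤ L₁) (ht : t ∈ L₁)
    (hgen : ∀ g ∈ L₁, ∃ e : ℤ, ∃ d ∈ L, g = t ^ e * d) {W' W : Submodule S M}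
    (h : RelFG L₁ W' W) : ∃ W₀ ≤ W, RelFG L W' W₀ ∧
      ∀ x ∈ W, ∃ m : ℕ, t ^ m • x ∈ ⨆ n, layers t W' W₀ n := by
  obtain ⟨X, hX, hXW, hU⟩ := h.fg
  let Y : Submodule S M := Submodule.span S {y | ∃ g ∈ L, ∃ x ∈ X, g • x = y}
  have hXY : X ⊆ Y := fun x hx => Submodule.subset_span ⟨1, one_mem _, x, hx, one_smul _ _⟩
  have hYst : StableUnder L Y := by
    intro g hg y hy
    induction hy using Submodule.span_induction with
    | mem y hy =>
      obtain ⟨g', hg', x, hx, rfl⟩ := hy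
      exact Submodule.subset_span ⟨g * g', mul_mem hg hg', x, hx, mul_smul _ _ _⟩
    | zero => simp
    | add y z _ _ hy hz => simpa using add_mem hy hz
    | smul s y _ hy => rw [smul_comm]; exact Y.smul_mem s hy
  have hYle : ∀ U : Submodule S M, StableUnder L U → X ⊆ U → Y ≤ U := by
    intro U hUs hXU
    rw [Submodule.span_le]
    rintro _ ⟨g, hg, x, hx, rfl⟩
    exact hUs g hg x (hXU hx)
  have h's := h.stable'.mono hLL
  have h₀s := h's.sup hYst
  refine ⟨W' ⊔ Y, sup_le h.le (hYle W (h.stable.mono hLL) hXW), ⟨h's, h₀s, le_sup_left,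
    X, hX, hXY.trans (le_sup_right (a := W')), fun U hUs hWU hXU =>
      sup_le hWU (hYle U hUs hXU)⟩, ?_⟩
  set P := ⨆ n, layers t W' (W' ⊔ Y) n with hP
  have hPs : StableUnder L P := iSup_layers_stable t h's h₀s
  have htP : ∀ k : ℕ, ∀ x ∈ P, t ^ k • x ∈ P := by
    intro k
    induction k with
    | zero => simp
    | succ k ih =>
      intro x hx
      rw [pow_succ', mul_smul]
      exact smul_mem_iSup_layers ht h.stable' (ih x hx)
  have hmono : Monotone fun m : ℕ => P.comap (DistribSMul.toLinearMap S M (t ^ m)) := by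
    refine monotone_nat_of_le_succ fun m x hx => ?_
    have := htP 1 _ hx
    simpa [smul_smul, ← pow_succ'] using this
  have hmem : ∀ x, x ∈ ⨆ m : ℕ, P.comap (DistribSMul.toLinearMap S M (t ^ m)) ↔
      ∃ m : ℕ, t ^ m • x ∈ P := fun x => Submodule.mem_iSup_of_directed _ hmono.directed_le
  have hP0 : W' ⊔ Y ≤ P := le_iSup_layers t W' _
  intro x hx
  rw [← hmem]
  refine hU _ ?_ ?_ ?_ hx
  · intro g hg x hx
    rw [hmem] at hx ⊢
    obtain ⟨m, hm⟩ := hx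
    obtain ⟨e, d, hd, rfl⟩ := hgen g hg
    have hdm : t ^ m • d • x ∈ P := by
      have := hPs _ (Subgroup.Normal.conj_mem ‹_› d hd (t ^ m)) _ hm
      simpa [smul_smul, mul_assoc] using this
    obtain ⟨k, rfl | rfl⟩ := e.eq_nat_or_neg
    · refine ⟨m, ?_⟩
      have := htP k _ hdm
      rw [zpow_natCast, mul_smul, smul_smul, ← pow_add, add_comm, pow_add, mul_smul]
      exact this
    · refine ⟨m + k, ?_⟩
      rw [zpow_neg, zpow_natCast, mul_smul, smul_smul, pow_add, mul_inv_cancel_right]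
      exact hdm
  · exact fun x hx => (hmem x).2 ⟨0, by simpa using hP0 (le_sup_left (a := W') hx)⟩
  · exact fun x hx => (hmem x).2 ⟨0, by simpa using hP0 (le_sup_right (a := W') (hXY hx))⟩

theorem RelFG.of_inf_comap {L L₁ : Subgroup G} {t : G} {W' W₀ V : Submodule S M}
    (h : RelFG L W' W₀) (ht : t ∈ L₁) (h' : StableUnder L₁ W') (hV : W' ≤ V)
    (hVs : StableUnder L (V.comap (DistribSMul.toLinearMap S M t))) :
    RelFG L (W₀ ⊓ V.comap (DistribSMul.toLinearMap S M t)) W₀ :=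
  h.of_intermediate (h.stable.inf hVs) (le_inf h.le fun w hw => hV (h' t ht w hw)) inf_le_left

theorem GenericallyFree.noeth_of_cyclic_extension {L L₁ : Subgroup G} [L.Normal]
    (hL : GenericallyFree S M L) {t : G} (hLL : L ≤ L₁) (ht : t ∈ L₁)
    (hgen : ∀ g ∈ L₁, ∃ e : ℤ, ∃ d ∈ L, g = t ^ e * d) {W' W : Submodule S M}
    (h : RelFG L₁ W' W) {E : ℕ → Submodule S M} (hE : Monotone E)
    (hEs : ∀ n, StableUnder L₁ (E n)) (hWE : ∀ n, W' ≤ E n) (hEW : ∀ n, E n ≤ W) :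
    ∃ N, ∀ n, N ≤ n → E n = E N := by
  obtain ⟨W₀, hW₀, h₀, hW⟩ := h.exists_generators hLL ht hgen
  let V := layers t W' W₀
  let K : ℕ → ℕ → Submodule S M := fun i n =>
    W₀ ⊓ (E i ⊔ V n).comap (DistribSMul.toLinearMap S M (t ^ n))
  have hVs : ∀ n, StableUnder L (V n) := layers_stable t h₀.stable' h₀.stable
  have hKs : ∀ i n, StableUnder L (K i n) := fun i n =>
    h₀.stable.inf ((((hEs i).mono hLL).sup (hVs n)).comap _)
  have hK1 : ∀ {i j n}, i ≤ j → K i n ≤ K j n := fun hij =>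
    inf_le_inf_left _ (Submodule.comap_mono (sup_le_sup_right (hE hij) _))
  have hK2 : ∀ {i}, Monotone (K i) := by
    refine fun {i} => monotone_nat_of_le_succ fun n x hx => ⟨hx.1, ?_⟩
    obtain ⟨e, he, v, hv, hev⟩ := Submodule.mem_sup.1 hx.2
    refine Submodule.mem_sup.2 ⟨t • e, hEs i t ht e he, t • v,
      smul_mem_layers ht h.stable' n hv, ?_⟩
    rw [← smul_add, hev]
    simp [smul_smul, pow_succ']
  have hKW : ∀ i n, W' ≤ K i n := fun i n w hw =>
    ⟨h₀.le hw, Submodule.mem_sup_left (hWE i (h.stable' _ (pow_mem ht n) w hw))⟩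
  obtain ⟨N, hN⟩ := hL.noeth h₀ (fun n => K n n) (monotone_nat_of_le_succ fun n =>
    (hK1 n.le_succ).trans (hK2 n.le_succ)) (fun n => hKs n n) (fun n => hKW n n)
    fun n => inf_le_left
  choose I hI using fun n => hL.noeth h₀ (fun i => K i n) (fun i j hij => hK1 hij)
    (fun i => hKs i n) (fun i => hKW i n) fun i => inf_le_left
  obtain ⟨J, hJN, hJ⟩ : ∃ J, N ≤ J ∧ ∀ n < N, I n ≤ J :=
    ⟨max N ((Finset.range N).sup I), le_max_left _ _, fun n hn =>
      (Finset.le_sup (Finset.mem_range.2 hn)).trans (le_max_right _ _)⟩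
  have hstab : ∀ i, J ≤ i → ∀ n, K i n ≤ K J n := by
    intro i hi n
    rcases lt_or_ge n N with hn | hn
    · exact ((hI n i ((hJ n hn).trans hi)).trans (hI n J (hJ n hn)).symm).le
    · have h1 : K i n ≤ K (max i n) (max i n) :=
        (hK1 (le_max_left i n)).trans (hK2 (le_max_right i n))
      rw [hN _ (hn.trans (le_max_right i n))] at h1
      exact h1.trans ((hK1 hJN).trans (hK2 hn))
  refine ⟨J, fun i hi => le_antisymm ?_ (hE hi)⟩
  have hlay : ∀ n, ∀ x ∈ E i, x ∈ V n → x ∈ E J := by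
    intro n
    induction n with
    | zero => exact fun x _ hx => hWE J hx
    | succ n ih =>
      intro x hxE hx
      obtain ⟨v, hv, _, ⟨w, hw, rfl⟩, rfl⟩ := Submodule.mem_sup.1 hx
      have hwi : w ∈ K i n := by
        refine ⟨hw, Submodule.mem_sup.2 ⟨_, hxE, -v, neg_mem hv, ?_⟩⟩
        abel
      obtain ⟨e, he, v', hv', hev⟩ := Submodule.mem_sup.1 (hstab i hi n hwi).2
      rw [← hev] at hxE ⊢
      have h1 : v + v' ∈ E J := by
        refine ih _ ?_ (add_mem hv hv')
        convert sub_mem hxE (hE hi he) using 1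
        abel
      convert add_mem h1 he using 1
      abel
  intro x hx
  obtain ⟨m, hm⟩ := hW x (hEW i hx)
  rw [Submodule.mem_iSup_of_directed _ (layers_mono t W' W₀).directed_le] at hm
  obtain ⟨n, hn⟩ := hm
  exact ((hEs J).smul_mem_iff (pow_mem ht m)).1 (hlay n _ (hEs i _ (pow_mem ht m) x hx) hn)

theorem GenericallyFree.generic_of_cyclic_extension [IsDomain S] {L L₁ : Subgroup G} [L.Normal]
    (hL : GenericallyFree S M L) {t : G} (hLL : L ≤ L₁) (ht : t ∈ L₁)
    (hgen : ∀ g ∈ L₁, ∃ e : ℤ, ∃ d ∈ L, g = t ^ e * d) {W' W : Submodule S M}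
    (h : RelFG L₁ W' W) : ∃ f : S, f ≠ 0 ∧ ∀ π, Prime π → ¬ π ∣ f → PureSeparated π W' W := by
  obtain ⟨W₀, hW₀, h₀, hW⟩ := h.exists_generators hLL ht hgen
  let V := layers t W' W₀
  have hVm : Monotone V := layers_mono t W' W₀
  have hVs : ∀ n, StableUnder L (V n) := layers_stable t h₀.stable' h₀.stable
  let K : ℕ → Submodule S M := fun n =>
    W₀ ⊓ (V n).comap (DistribSMul.toLinearMap S M (t ^ n))
  have hK : ∀ n, RelFG L (K n) W₀ := fun n =>
    h₀.of_inf_comap (pow_mem ht n) h.stable' (hVm (Nat.zero_le n)) ((hVs n).comap _)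
  obtain ⟨N, hN⟩ := hL.noeth h₀ K (monotone_nat_of_le_succ fun n x hx => ⟨hx.1, by
      have := smul_mem_layers ht h.stable' n hx.2
      simpa [smul_smul, pow_succ'] using this⟩) (fun n => (hK n).stable')
    (fun n w hw => ⟨h₀.le hw, hVm (Nat.zero_le n) (h.stable' _ (pow_mem ht n) w hw)⟩)
    fun n => inf_le_left
  choose f hf0 hf using fun n => hL.generic (hK n)
  set P := ⨆ n, V n with hP
  have hPs : StableUnder L P := iSup_layers_stable t h₀.stable' h₀.stable
  have hPW : P ≤ W := iSup_le (layers_le ht h.stable h.le hW₀)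
  have htP : ∀ x ∈ P, t • x ∈ P := fun x hx => smul_mem_iSup_layers ht h.stable' hx
  let Q := P.map (DistribSMul.toLinearMap S M t)
  have hQP : Q ≤ P := by
    rintro _ ⟨x, hx, rfl⟩
    exact htP x hx
  have hW'Q : W' ≤ Q := fun w hw => ⟨t⁻¹ • w,
    (le_iSup V 0 : W' ≤ P) (h.stable' _ (inv_mem ht) w hw), by simp⟩
  have hPQ : P = Q ⊔ W₀.map LinearMap.id := by
    rw [Submodule.map_id]
    have hW₀P : W₀ ≤ P := le_iSup_layers t W' W₀
    refine le_antisymm (iSup_le fun n => ?_) (sup_le hQP hW₀P)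
    induction n with
    | zero => exact h₀.le.trans le_sup_right
    | succ n ih =>
      refine sup_le ih ?_
      rintro _ ⟨w, hw, rfl⟩
      cases n with
      | zero => exact Submodule.mem_sup_right (by simpa using hw)
      | succ n =>
        refine Submodule.mem_sup_left ⟨t ^ n • w, ?_, by simp [smul_smul, pow_succ']⟩
        exact le_iSup V (n + 1) (Submodule.mem_sup_right ⟨w, hw, rfl⟩)
  obtain ⟨f', hf'0, hf'⟩ := hL.generic (h₀.of_intermediate (V := W₀ ⊓ Q)
    (h₀.stable.inf (hPs.map t)) (le_inf h₀.le hW'Q) inf_le_left)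
  refine ⟨(∏ n ∈ Finset.range (N + 1), f n) * f', mul_ne_zero
    (Finset.prod_ne_zero_iff.2 fun n _ => hf0 n) hf'0, fun π hπ hdvd => ?_⟩
  have hKπ : ∀ n, PureSeparated π (K n) W₀ := by
    have hle : ∀ n ≤ N, PureSeparated π (K n) W₀ := fun n hn => hf n π hπ fun h =>
      hdvd ((h.trans (Finset.dvd_prod_of_mem f
        (Finset.mem_range.2 (Nat.lt_succ_of_le hn)))).mul_right _)
    intro n
    rcases le_total n N with hn | hn
    · exact hle n hn
    · rw [hN n hn]
      exact hle N le_rfl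
  have h1 : PureSeparated π W' P := .iSup hπ hVm fun n => .sup_map (hKπ n)
  have h2 : PureSeparated π Q P := by
    rw [hPQ]
    exact .sup_map (hf' π hπ fun h => hdvd (h.mul_left _))
  let U : ℕ → Submodule S M := fun m => P.comap (DistribSMul.toLinearMap S M (t ^ m))
  have hU : Monotone U := by
    refine monotone_nat_of_le_succ fun m x hx => ?_
    have := htP _ hx
    simpa [U, smul_smul, ← pow_succ'] using this
  have hinj : ∀ g : G, Function.Injective (DistribSMul.toLinearMap S M g) := fun g =>
    MulAction.injective g
  have h3 : ∀ m, PureSeparated π (U m) (U (m + 1)) := by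
    intro m
    convert h2.map (DistribSMul.toLinearMap S M (t ^ (m + 1))⁻¹) (hinj _) hQP using 1
    · ext x
      constructor
      · intro hx
        refine ⟨t • t ^ m • x, ⟨_, hx, rfl⟩, ?_⟩
        simp [smul_smul, pow_succ']
      · rintro ⟨_, ⟨y, hy, rfl⟩, rfl⟩
        change t ^ m • (t ^ (m + 1))⁻¹ • t • y ∈ P
        simpa [smul_smul, pow_succ', mul_assoc] using hy
    · ext x
      constructor
      · intro hx
        refine ⟨t ^ (m + 1) • x, hx, ?_⟩
        simp
      · rintro ⟨y, hy, rfl⟩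
        change t ^ (m + 1) • (t ^ (m + 1))⁻¹ • y ∈ P
        simpa using hy
  have h4 := PureSeparated.iSup hπ hU h3
  have hU0 : U 0 = P := by
    ext x
    simp [U]
  have hUW : ⨆ m, U m = W := by
    refine le_antisymm (iSup_le fun m x hx => ?_) fun x hx => ?_
    · exact (h.stable.smul_mem_iff (pow_mem ht m)).1 (hPW hx)
    · obtain ⟨m, hm⟩ := hW x hx
      exact le_iSup U m hm
  rw [hU0, hUW] at h4
  exact h1.trans hπ h4 (le_iSup V 0) hPW

theorem GenericallyFree.of_cyclic_extension [IsDomain S] {L L₁ : Subgroup G} [L.Normal]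
    (hL : GenericallyFree S M L) {t : G} (hLL : L ≤ L₁) (ht : t ∈ L₁)
    (hgen : ∀ g ∈ L₁, ∃ e : ℤ, ∃ d ∈ L, g = t ^ e * d) : GenericallyFree S M L₁ :=
  ⟨fun h _ => hL.noeth_of_cyclic_extension hLL ht hgen h,
    fun h => hL.generic_of_cyclic_extension hLL ht hgen h⟩

end Extension

section FiniteImage

theorem Subgroup.exists_pow_central {Γ : Type*} [Group Γ] (E : Subgroup Γ) [E.Normal] [Finite E]
    {t : Γ} (ht : ∀ h, h * t * h⁻¹ * t⁻¹ ∈ E) : ∃ n, 0 < n ∧ ∀ h, Commute h (t ^ n) := by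
  have : Finite (MulAut E) := Finite.of_injective _ MulEquiv.toEquiv_injective
  obtain ⟨m, hm, hm1⟩ := (isOfFinOrder_of_finite (MulAut.conjNormal (H := E) t)).exists_pow_eq_one
  have hcomm : ∀ d ∈ E, Commute d (t ^ m) := by
    intro d hd
    have h1 := congrArg Subtype.val (DFunLike.congr_fun hm1 (⟨d, hd⟩ : E))
    rw [← map_pow, MulAut.conjNormal_apply] at h1
    exact (mul_inv_eq_iff_eq_mul.1 h1).symm
  refine ⟨m * Nat.card E, Nat.mul_pos hm Nat.card_pos, fun h => ?_⟩
  have hquot : h * t ^ m * h⁻¹ * (t ^ m)⁻¹ ∈ E := by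
    rw [← QuotientGroup.eq_one_iff]
    have h1 := (QuotientGroup.eq_one_iff _).2 (ht h)
    simp only [QuotientGroup.mk_mul, QuotientGroup.mk_inv, QuotientGroup.mk_pow] at h1 ⊢
    rw [mul_inv_eq_one] at h1 ⊢
    rw [← conj_pow, h1]
  set d := h * t ^ m * h⁻¹ * (t ^ m)⁻¹ with hd
  have h2 : h * t ^ m * h⁻¹ = d * t ^ m := by rw [hd, inv_mul_cancel_right]
  have h3 : h * t ^ (m * Nat.card E) * h⁻¹ = t ^ (m * Nat.card E) := by
    have hdk : d ^ Nat.card E = 1 := by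
      have := congrArg Subtype.val (pow_card_eq_one' (x := (⟨d, hquot⟩ : E)))
      exact this
    rw [pow_mul, ← conj_pow, h2, (hcomm d hquot).mul_pow, hdk, one_mul]
  exact mul_inv_eq_iff_eq_mul.1 h3

variable {G : Type*} [Group G] {M : Type*} [AddCommGroup M] [DistribMulAction G M]

theorem GenericallyFree.of_chain {S : Type*} [CommRing S] [IsDomain S] [IsPrincipalIdealRing S]
    [Module S M] [SMulCommClass G S M] {D : ℕ → Subgroup G} (hD : ∀ n, (D n).Normal)
    (hanti : Antitone D) {t : ℕ → G} (ht : ∀ n, t n ∈ D n)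
    (hgen : ∀ n, ∀ g ∈ D n, ∃ e : ℤ, ∃ d ∈ D (n + 1), g = t n ^ e * d) {N : ℕ}
    (hN : ∀ g ∈ D N, ∀ m : M, g • m = m) : GenericallyFree S M (D 0) := by
  have key : ∀ k ≤ N, GenericallyFree S M (D (N - k)) := by
    intro k
    induction k with
    | zero => exact fun _ => .of_trivial hN
    | succ k ih =>
      intro hk
      have h1 := ih (by omega)
      obtain ⟨j, hj⟩ : ∃ j, N - k = j + 1 := ⟨N - k - 1, by omega⟩
      have h2 : N - (k + 1) = j := by omega
      rw [hj] at h1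
      rw [h2]
      have := hD (j + 1)
      exact h1.of_cyclic_extension (hanti j.le_succ) (ht j) (hgen j)
  simpa using key N le_rfl

theorem GenericallyFree.eq_zero_of_bijective {S : Type*} [CommRing S] [Module S M]
    (hS : ∀ f : S, f ≠ 0 → ∃ π, Prime π ∧ ¬ π ∣ f)
    (hL : GenericallyFree S M (⊤ : Subgroup G)) {x : M}
    (hx : ∀ U : Submodule S M, StableUnder (⊤ : Subgroup G) U → x ∈ U → U = ⊤)
    (hbij : ∀ s : S, s ≠ 0 → Function.Bijective fun m : M => s • m) : x = 0 := by
  have hfg : RelFG (S := S) (M := M) (⊤ : Subgroup G) ⊥ ⊤ :=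
    ⟨fun g _ w hw => by simp [(Submodule.mem_bot S).1 hw], fun _ _ _ _ => Submodule.mem_top, bot_le,
      {x}, Set.finite_singleton x, Set.subset_univ _, fun U hU _ hxU =>
        (hx U hU (hxU rfl)).ge⟩
  obtain ⟨f, hf, hgen⟩ := hL.generic hfg
  obtain ⟨π, hπ, hπf⟩ := hS f hf
  choose d hd using fun m : M => (hbij π hπ.ne_zero).2 m
  obtain ⟨a, ha, hax⟩ := (hgen π hπ hπf).sep (fun n => d^[n] x) (fun _ => 1) (fun _ => 1)
    (fun _ => Submodule.mem_top) (fun _ => hπ.not_dvd_one) (fun _ => hπ.not_dvd_one) (fun n => by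
      have : π • d (d^[n] x) = d^[n] x := hd (d^[n] x)
      simp only [one_smul, one_mul, Function.iterate_succ', Function.comp_apply, Submodule.mem_bot]
      rw [this, sub_self])
  have ha0 : a ≠ 0 := by
    rintro rfl
    exact ha (dvd_zero _)
  exact (hbij a ha0).1 (by simpa using hax)

theorem Polynomial.exists_prime_not_dvd {K : Type*} [Field K] (f : Polynomial K) (hf : f ≠ 0) :
    ∃ π, Prime π ∧ ¬ π ∣ f := by
  have hdeg : (Polynomial.X * f).degree = f.degree + 1 := by
    rw [Polynomial.degree_mul, Polynomial.degree_X, add_comm]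
  have hpos : 0 < (Polynomial.X * f).degree := by
    rw [hdeg, Polynomial.degree_eq_natDegree hf]
    exact_mod_cast Nat.succ_pos _
  have hnu : ¬ IsUnit (Polynomial.X * f + 1) := by
    refine Polynomial.not_isUnit_of_degree_pos _ ?_
    have h1 : (1 : Polynomial K).degree < (Polynomial.X * f).degree := by
      rwa [Polynomial.degree_one]
    rwa [Polynomial.degree_add_eq_left_of_degree_lt h1]
  obtain ⟨π, hπ, hdvd⟩ := WfDvdMonoid.exists_irreducible_factor hnu (by
    intro h0
    have : (Polynomial.X * f).degree = 0 := by
      rw [eq_neg_of_add_eq_zero_left h0, Polynomial.degree_neg, Polynomial.degree_one]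
    exact hpos.ne' this)
  exact ⟨π, hπ.prime, fun h => hπ.not_isUnit (isUnit_of_dvd_one
    ((dvd_add_right (h.mul_left Polynomial.X)).1 hdvd))⟩

variable {K : Type*} [Field K] [Finite K] [Module K M] [SMulCommClass G K M]

/-- An element acting centrally on a simple module for a group with a suitable chain of subgroups
has finite order. -/
theorem exists_pow_smul_eq_of_central
    (hsimple : ∀ W : Submodule K M, StableUnder (⊤ : Subgroup G) W → W = ⊥ ∨ W = ⊤)
    {D : ℕ → Subgroup G} (hD : ∀ n, (D n).Normal) (h0 : D 0 = ⊤)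
    (hanti : Antitone D) {t : ℕ → G} (ht : ∀ n, t n ∈ D n)
    (hgen : ∀ n, ∀ g ∈ D n, ∃ e : ℤ, ∃ d ∈ D (n + 1), g = t n ^ e * d) {N : ℕ}
    (hN : ∀ g ∈ D N, ∀ m : M, g • m = m) {z : G} (hz : ∀ (g : G) (m : M), g • z • m = z • g • m) :
    ∃ n, 0 < n ∧ ∀ m : M, z ^ n • m = m := by
  let a : Module.End K M := DistribSMul.toLinearMap K M z
  have ha : ∀ n m, (a ^ n) m = z ^ n • m := by
    intro n
    induction n with
    | zero => simp
    | succ n ih =>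
      intro m
      rw [pow_succ', Module.End.mul_apply, ih, pow_succ', mul_smul]
      rfl
  have hcomm : ∀ (g : G) (f : Polynomial K) (m : M),
      g • Polynomial.aeval a f m = Polynomial.aeval a f (g • m) := by
    intro g f m
    have hg : ∀ n : ℕ, g • z ^ n • m = z ^ n • g • m := by
      intro n
      induction n with
      | zero => simp
      | succ n ih => rw [pow_succ', mul_smul, hz, ih, mul_smul]
    induction f using Polynomial.induction_on' with
    | add p q hp hq => simp [hp, hq]
    | monomial n r => simp [Polynomial.aeval_monomial, ha, hg, smul_comm g r]
  by_cases halg : ∃ f : Polynomial K, f ≠ 0 ∧ Polynomial.aeval a f = 0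
  · obtain ⟨f, hf, hfa⟩ := halg
    have hint : IsIntegral K a := isAlgebraic_iff_isIntegral.1 ⟨f, hf, hfa⟩
    have : Module.Finite K (Algebra.adjoin K {a}) := Module.Finite.iff_fg.2 hint.fg_adjoin_singleton
    have : Finite (Algebra.adjoin K {a}) := Module.finite_of_finite K
    have hni := not_injective_infinite_finite fun n : ℕ =>
      (⟨a, Algebra.self_mem_adjoin_singleton K a⟩ : Algebra.adjoin K {a}) ^ n
    obtain ⟨i, j, hij, hne⟩ : ∃ i j : ℕ, a ^ i = a ^ j ∧ i ≠ j := by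
      by_contra! hcon
      exact hni fun i j hij => hcon i j (congrArg Subtype.val hij)
    wlog hlt : i < j generalizing i j
    · exact this j i hij.symm hne.symm (by omega)
    refine ⟨j - i, Nat.sub_pos_of_lt hlt, fun m => ?_⟩
    have h1 : z ^ i • m = z ^ j • m := by rw [← ha, ← ha, hij]
    have h2 : z ^ j = z ^ i * z ^ (j - i) := by rw [← pow_add]; congr 1; omega
    rw [h2, mul_smul] at h1
    exact (MulAction.injective (z ^ i) h1).symm
  · push Not at halg
    rcases subsingleton_or_nontrivial M with hM | hM
    · exact ⟨1, one_pos, fun m => Subsingleton.elim _ _⟩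
    exfalso
    obtain ⟨x, hx⟩ := exists_ne (0 : M)
    let : Module (Polynomial K) M := Module.compHom M (Polynomial.aeval a).toRingHom
    have hsmul : ∀ (f : Polynomial K) (m : M), f • m = Polynomial.aeval a f m := fun _ _ => rfl
    have : SMulCommClass G (Polynomial K) M := ⟨fun g f m => by rw [hsmul, hsmul, hcomm]⟩
    have hL := GenericallyFree.of_chain (S := Polynomial K) (M := M) hD hanti ht hgen hN
    rw [h0] at hL
    refine hx (hL.eq_zero_of_bijective Polynomial.exists_prime_not_dvd (fun U hU hxU => ?_)
      fun f hf => ?_)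
    · let U' : Submodule K M :=
        { U.toAddSubmonoid with
          smul_mem' := fun r m hm => by
            have := U.smul_mem (Polynomial.C r) hm
            rwa [hsmul, Polynomial.aeval_C] at this }
      rcases hsimple U' hU with h | h
      · exact absurd ((Submodule.mem_bot K).1 (h ▸ hxU : x ∈ (⊥ : Submodule K M))) hx
      · rw [eq_top_iff]
        intro m _
        exact (h ▸ Submodule.mem_top : m ∈ U')
    · have hker := hsimple (LinearMap.ker (Polynomial.aeval a f)) fun g _ w hw => by
        rw [LinearMap.mem_ker] at hw ⊢
        rw [← hcomm, hw, smul_zero]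
      have hrange := hsimple (LinearMap.range (Polynomial.aeval a f)) fun g _ w hw => by
        obtain ⟨v, rfl⟩ := hw
        exact ⟨g • v, (hcomm g f v).symm⟩
      have hne := halg f hf
      constructor
      · refine LinearMap.ker_eq_bot.1 (hker.resolve_right fun h => hne ?_)
        exact LinearMap.ker_eq_top.1 h
      · refine LinearMap.range_eq_top.1 (hrange.resolve_left fun h => hne ?_)
        exact LinearMap.range_eq_bot.1 h

/-- A simple module over a finite field for a group with a suitable central chain of subgroups is
acted on through a finite quotient. -/
theorem finite_range_toPermHom_of_simple
    (hsimple : ∀ W : Submodule K M, StableUnder (⊤ : Subgroup G) W → W = ⊥ ∨ W = ⊤)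
    {D : ℕ → Subgroup G} (hD : ∀ n, (D n).Normal) (h0 : D 0 = ⊤)
    (hanti : Antitone D) {t : ℕ → G} (ht : ∀ n, t n ∈ D n)
    (hgen : ∀ n, ∀ g ∈ D n, ∃ e : ℤ, ∃ d ∈ D (n + 1), g = t n ^ e * d)
    (hcomm : ∀ n h, ∀ g ∈ D n, h * g * h⁻¹ * g⁻¹ ∈ D (n + 1)) {N : ℕ}
    (hN : ∀ g ∈ D N, ∀ m : M, g • m = m) : Finite (MulAction.toPermHom G M).range := by
  let φ : G →* (MulAction.toPermHom G M).range := (MulAction.toPermHom G M).rangeRestrict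
  have hφ : Function.Surjective φ := MonoidHom.rangeRestrict_surjective _
  have hφ1 : ∀ g h, φ g = φ h ↔ ∀ m : M, g • m = h • m := by
    intro g h
    rw [Subtype.ext_iff, Equiv.ext_iff]
    rfl
  have key : ∀ k ≤ N, Finite ((D (N - k)).map φ) := by
    intro k
    induction k with
    | zero =>
      intro _
      have : (D (N - 0)).map φ = ⊥ := by
        rw [eq_bot_iff]
        rintro _ ⟨g, hg, rfl⟩
        rw [Subgroup.mem_bot, ← map_one φ, hφ1]
        intro m
        rw [hN g hg, one_smul]
      rw [this]
      infer_instance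
    | succ k ih =>
      intro hk
      have h1 := ih (by omega)
      obtain ⟨j, hj⟩ : ∃ j, N - k = j + 1 := ⟨N - k - 1, by omega⟩
      have h2 : N - (k + 1) = j := by omega
      rw [hj] at h1
      rw [h2]
      have hnorm : ((D (j + 1)).map φ).Normal := (hD _).map φ hφ
      obtain ⟨n, hn, hcent⟩ := ((D (j + 1)).map φ).exists_pow_central (t := φ (t j)) (by
        intro h
        obtain ⟨h, rfl⟩ := hφ h
        exact ⟨_, hcomm j h _ (ht j), by simp⟩)
      obtain ⟨i, hi, hone⟩ := exists_pow_smul_eq_of_central hsimple hD h0 hanti ht hgen hN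
        (z := t j ^ n) fun g m => by
          rw [smul_smul, smul_smul]
          refine (hφ1 _ _).1 ?_ m
          rw [map_mul, map_mul, map_pow]
          exact hcent (φ g)
      have hfin : IsOfFinOrder (φ (t j)) := isOfFinOrder_iff_pow_eq_one.2 ⟨n * i, Nat.mul_pos hn hi,
        by
          rw [pow_mul, ← map_pow, ← map_pow, ← map_one φ, hφ1]
          simpa using hone⟩
      have hz : (Subgroup.zpowers (φ (t j)) : Set (MulAction.toPermHom G M).range).Finite :=
        hfin.finite_zpowers
      have hE : ((D (j + 1)).map φ : Set (MulAction.toPermHom G M).range).Finite := Set.toFinite _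
      refine ((hz.prod hE).image fun p => p.1 * p.2).subset ?_ |>.to_subtype
      rintro _ ⟨g, hg, rfl⟩
      obtain ⟨e, d, hd, rfl⟩ := hgen j g hg
      exact ⟨(φ (t j) ^ e, φ d), ⟨⟨e, rfl⟩, ⟨d, hd, rfl⟩⟩, by simp⟩
  have := key N le_rfl
  rw [Nat.sub_self, h0, ← MonoidHom.range_eq_map, MonoidHom.range_eq_top.2 hφ] at this
  exact (Subgroup.topEquiv (G := (MulAction.toPermHom G M).range)).toEquiv.finite_iff.1 this

end FiniteImage

section LeftInverse

variable {K : Type} [Field K] [Finite K] {G : Type} [Group G]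

theorem isSolvable_of_surjective_of_chain {Q : Type*} [Group Q] {φ : G →* Q}
    (hφ : Function.Surjective φ) {D : ℕ → Subgroup G} (h0 : D 0 = ⊤)
    (hcomm : ∀ n h, ∀ g ∈ D n, h * g * h⁻¹ * g⁻¹ ∈ D (n + 1)) {N : ℕ}
    (hN : ∀ g ∈ D N, φ g = 1) : Group.IsSolvable Q := by
  have hder : ∀ n, derivedSeries G n ≤ D n := by
    intro n
    induction n with
    | zero => simp [h0]
    | succ n ih =>
      rw [derivedSeries_succ, Subgroup.commutator_le]
      exact fun g₁ _ g₂ h₂ => hcomm n g₁ g₂ (ih h₂)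
  refine ⟨⟨N, ?_⟩⟩
  rw [← map_derivedSeries_eq hφ, eq_bot_iff]
  rintro _ ⟨g, hg, rfl⟩
  exact hN g (hder N hg)

variable {β : Type} [Fintype β] [DecidableEq β]

/-- A matrix over a group algebra that is left regular in all finite solvable quotients is left
invertible modulo each term of a suitable central chain. -/
theorem exists_left_inverse_of_finite_quotients {D : ℕ → Subgroup G} (hD : ∀ n, (D n).Normal)
    (h0 : D 0 = ⊤) (hanti : Antitone D) {t : ℕ → G} (ht : ∀ n, t n ∈ D n)
    (hgen : ∀ n, ∀ g ∈ D n, ∃ e : ℤ, ∃ d ∈ D (n + 1), g = t n ^ e * d)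
    (hcomm : ∀ n h, ∀ g ∈ D n, h * g * h⁻¹ * g⁻¹ ∈ D (n + 1)) {A : β → β → MonoidAlgebra K G}
    (hA : ∀ (Q : Type) [Group Q] [Finite Q], Group.IsSolvable Q → ∀ (φ : G →* Q)
      (v : β → MonoidAlgebra K Q),
      (∀ i, ∑ k, v k * MonoidAlgebra.mapDomainRingHom K φ (A k i) = 0) → v = 0) (N : ℕ) :
    ∃ B : β → β → MonoidAlgebra K G, ∀ l i,
      MonoidAlgebra.mapDomainRingHom K (QuotientGroup.mk' (D N)) (∑ k, B l k * A k i) =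
        if l = i then 1 else 0 := by
  let R := MonoidAlgebra K G
  let T : Submodule R (β → R) :=
    { carrier := {w | ∃ b : β → R, ∀ i, MonoidAlgebra.mapDomainRingHom K (QuotientGroup.mk' (D N))
        (w i - ∑ k, b k * A k i) = 0}
      zero_mem' := ⟨0, by simp⟩
      add_mem' := by
        rintro w w' ⟨b, hb⟩ ⟨b', hb'⟩
        refine ⟨b + b', fun i => ?_⟩
        have := congrArg₂ (· + ·) (hb i) (hb' i)
        simp only [add_zero, ← map_add] at this
        rw [← this]
        congr 1
        simp only [Pi.add_apply, add_mul, Finset.sum_add_distrib]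
        abel
      smul_mem' := by
        rintro c w ⟨b, hb⟩
        refine ⟨c • b, fun i => ?_⟩
        have := congrArg (MonoidAlgebra.mapDomainRingHom K (QuotientGroup.mk' (D N)) c * ·) (hb i)
        simp only [mul_zero, ← map_mul] at this
        rw [← this]
        simp [mul_sub, Finset.mul_sum, mul_assoc] }
  suffices hT : T = ⊤ by
    have hmem : ∀ l, Pi.single l 1 ∈ T := fun l => hT ▸ Submodule.mem_top
    choose B hB using hmem
    refine ⟨B, fun l i => ?_⟩
    have := hB l i
    rw [map_sub, sub_eq_zero] at this
    rw [← this, Pi.single_apply]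
    by_cases h : l = i
    · rw [if_pos h, if_pos h.symm, map_one]
    · rw [if_neg h, if_neg (Ne.symm h), map_zero]
  by_contra hT
  have hcoat : IsCoatomic (Submodule R (β → R)) := inferInstance
  obtain ⟨T', hT', hTT'⟩ := (hcoat.eq_top_or_exists_le_coatom T).resolve_left hT
  let M := (β → R) ⧸ T'
  have hMs : IsSimpleModule R M := isSimpleModule_iff_isCoatom.2 hT'
  let _ : DistribMulAction G M := DistribMulAction.compHom M (MonoidAlgebra.of K G)
  have hact : ∀ (g : G) (m : M), g • m = (MonoidAlgebra.single g 1 : R) • m := fun _ _ => rfl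
  have hscal : ∀ (g : G) (r : K) (m : M),
      (MonoidAlgebra.single g r : R) • m = r • g • m := by
    intro g r m
    have : (MonoidAlgebra.single g r : R) = r • (MonoidAlgebra.single g 1 : R) := by simp
    rw [hact, this, smul_assoc]
  have : SMulCommClass G K M := ⟨fun g r m => by
    rw [hact, hact, smul_comm]⟩
  have hsimple : ∀ W : Submodule K M, StableUnder (⊤ : Subgroup G) W → W = ⊥ ∨ W = ⊤ := by
    intro W hW
    let W' : Submodule R M :=
      { W.toAddSubmonoid with
        smul_mem' := by
          intro c m hm
          change c • m ∈ W
          induction c using MonoidAlgebra.induction_linear with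
          | zero => simp
          | add f g hf hg => rw [add_smul]; exact W.add_mem hf hg
          | single g r => rw [hscal]; exact W.smul_mem r (hW g (Subgroup.mem_top g) m hm) }
    have hmem : ∀ m, m ∈ W' ↔ m ∈ W := fun _ => Iff.rfl
    refine (eq_bot_or_eq_top W').imp (fun h => ?_) fun h => ?_
    · ext m
      rw [← hmem, h, Submodule.mem_bot, Submodule.mem_bot]
    · ext m
      rw [← hmem, h]
      simp
  have htriv : ∀ g ∈ D N, ∀ m : M, g • m = m := by
    intro g hg m
    obtain ⟨w, rfl⟩ := Submodule.Quotient.mk_surjective T' m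
    rw [hact, ← Submodule.Quotient.mk_smul, Submodule.Quotient.eq]
    refine hTT' ⟨0, fun i => ?_⟩
    have h1 : MonoidAlgebra.mapDomainRingHom K (QuotientGroup.mk' (D N))
        (MonoidAlgebra.single g 1) = 1 := by
      rw [MonoidAlgebra.mapDomainRingHom_apply, MonoidAlgebra.mapDomain_single,
        MonoidAlgebra.one_def]
      congr 1
      exact (QuotientGroup.eq_one_iff g).2 hg
    simp only [Pi.sub_apply, Pi.smul_apply, smul_eq_mul, Pi.zero_apply, zero_mul,
      Finset.sum_const_zero, sub_zero, map_sub, map_mul, h1, one_mul, sub_self]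
  have hfin := finite_range_toPermHom_of_simple hsimple hD h0 hanti ht hgen hcomm htriv
  let Q := (MulAction.toPermHom G M).range
  let φ : G →* Q := (MulAction.toPermHom G M).rangeRestrict
  have hφ : Function.Surjective φ := MonoidHom.rangeRestrict_surjective _
  have hφ1 : ∀ g (m : M), (φ g).1 m = g • m := fun _ _ => rfl
  have hsol : Group.IsSolvable Q := isSolvable_of_surjective_of_chain hφ h0 hcomm
      (N := N) fun g hg => by
    rw [Subtype.ext_iff, Equiv.ext_iff]
    exact fun m => htriv g hg m
  have hfac : ∀ (x : R) (m : M), MonoidAlgebra.mapDomainRingHom K φ x = 0 → x • m = 0 := by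
    intro x m hx
    have h1 : ∀ x : R, x • m = Finsupp.linearCombination K (fun q : Q => q.1 m)
        (MonoidAlgebra.mapDomainRingHom K φ x).coeff := by
      intro x
      induction x using MonoidAlgebra.induction_linear with
      | zero => simp
      | add f g hf hg => rw [add_smul, hf, hg, map_add, MonoidAlgebra.coeff_add, map_add]
      | single g r =>
        rw [hscal, MonoidAlgebra.mapDomainRingHom_apply, MonoidAlgebra.mapDomain_single,
          MonoidAlgebra.coeff_single, Finsupp.linearCombination_single]
        rfl
    rw [h1, hx]
    simp
  have hsurjR : Function.Surjective (MonoidAlgebra.mapDomainRingHom K φ) := by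
    intro y
    induction y using MonoidAlgebra.induction_linear with
    | zero => exact ⟨0, map_zero _⟩
    | add f g hf hg =>
      obtain ⟨a, rfl⟩ := hf
      obtain ⟨b, rfl⟩ := hg
      exact ⟨a + b, map_add _ _ _⟩
    | single q r =>
      obtain ⟨g, rfl⟩ := hφ q
      exact ⟨MonoidAlgebra.single g r, by simp⟩
  have hfinA : Finite (MonoidAlgebra K Q) :=
    Finite.of_injective (fun x : MonoidAlgebra K Q => (x.coeff : Q → K)) fun x y h => by
      ext q
      exact congrFun h q
  let Ψ : (β → MonoidAlgebra K Q) →+ (β → MonoidAlgebra K Q) :=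
    { toFun := fun v i => ∑ k, v k * MonoidAlgebra.mapDomainRingHom K φ (A k i)
      map_zero' := by
        ext1 i
        simp
      map_add' := fun v w => by
        ext1 i
        simp [add_mul, Finset.sum_add_distrib] }
  have hinj : Function.Injective Ψ := (injective_iff_map_eq_zero Ψ).2 fun v hv =>
    hA Q hsol φ v (congrFun hv)
  have hsurj : Function.Surjective Ψ := Finite.injective_iff_surjective.1 hinj
  refine hT'.1 (eq_top_iff.2 fun w _ => ?_)
  obtain ⟨v, hv⟩ := hsurj fun i => MonoidAlgebra.mapDomainRingHom K φ (w i)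
  choose b hb using fun k => hsurjR (v k)
  let w' : β → R := fun i => ∑ k, b k * A k i
  have hw' : w' ∈ T' := hTT' ⟨b, fun i => by simp [w']⟩
  have hdiff : ∀ i, MonoidAlgebra.mapDomainRingHom K φ ((w - w') i) = 0 := by
    intro i
    have := congrFun hv i
    change ∑ k, v k * _ = _ at this
    simp only [Pi.sub_apply, map_sub, w', map_sum, map_mul, hb]
    rw [this, sub_self]
  have h3 : Submodule.Quotient.mk (p := T') (w - w') = 0 := by
    have : w - w' = ∑ i, (w - w') i • Pi.single (M := fun _ : β => R) i 1 := by
      ext1 j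
      simp [Finset.sum_apply, Pi.single_apply]
    rw [this, ← Submodule.mkQ_apply, map_sum]
    exact Finset.sum_eq_zero fun i _ => by
      rw [map_smul]
      exact hfac _ _ (hdiff i)
  have h4 := (Submodule.Quotient.mk_eq_zero T').1 h3
  simpa using T'.add_mem h4 hw'

end LeftInverse

section CentralCoordinates

variable {Γ : Type*} [Group Γ]

/-- Integral coordinates on a group whose first difference between two elements is invariant under
left and right translations. -/
structure CentralCoordinates (Γ : Type*) [Group Γ] where
  coord : ℕ → Γ → ℤ
  left : ∀ i k g h, (∀ j < i, coord j g = coord j h) →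
    coord i (k * g) - coord i (k * h) = coord i g - coord i h
  right : ∀ i k g h, (∀ j < i, coord j g = coord j h) →
    coord i (g * k) - coord i (h * k) = coord i g - coord i h
  inj : ∀ g h, (∀ i, coord i g = coord i h) → g = h

namespace CentralCoordinates

variable (c : CentralCoordinates Γ)

theorem left_eq {N : ℕ} {k g h : Γ} (hgh : ∀ j < N, c.coord j g = c.coord j h) :
    ∀ j < N, c.coord j (k * g) = c.coord j (k * h) := fun j hj => by
  have := c.left j k g h fun i hi => hgh i (hi.trans hj)
  rw [hgh j hj] at this
  omega

theorem right_eq {N : ℕ} {k g h : Γ} (hgh : ∀ j < N, c.coord j g = c.coord j h) :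
    ∀ j < N, c.coord j (g * k) = c.coord j (h * k) := fun j hj => by
  have := c.right j k g h fun i hi => hgh i (hi.trans hj)
  rw [hgh j hj] at this
  omega

/-- The elements whose first `N` coordinates are those of the identity. -/
def sub (N : ℕ) : Subgroup Γ where
  carrier := {g | ∀ j < N, c.coord j g = c.coord j 1}
  one_mem' := fun _ _ => rfl
  mul_mem' := by
    intro g h hg hh j hj
    rw [c.left_eq hh j hj, mul_one, hg j hj]
  inv_mem' := by
    intro g hg j hj
    have := c.left_eq (k := g⁻¹) hg j hj
    rw [inv_mul_cancel, mul_one] at this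
    exact this.symm

theorem sub_zero : c.sub 0 = ⊤ := eq_top_iff.2 fun _ _ _ hj => absurd hj (Nat.not_lt_zero _)

theorem sub_antitone : Antitone c.sub := fun _ _ hMN _ hg j hj => hg j (hj.trans_le hMN)

theorem mem_sub_succ {N : ℕ} {g : Γ} (hg : g ∈ c.sub N) :
    g ∈ c.sub (N + 1) ↔ c.coord N g = c.coord N 1 := by
  refine ⟨fun h => h N N.lt_succ_self, fun h j hj => ?_⟩
  rcases Nat.lt_succ_iff_lt_or_eq.1 hj with hj | rfl
  · exact hg j hj
  · exact h

theorem coord_conj {N : ℕ} {g : Γ} (hg : g ∈ c.sub N) (h : Γ) :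
    c.coord N (h * g * h⁻¹) = c.coord N g := by
  have h1 := c.left N h g 1 hg
  have h2 := c.right N h⁻¹ (h * g) (h * 1) (c.left_eq hg)
  rw [mul_one, mul_inv_cancel] at h2
  rw [mul_one] at h1
  omega

theorem sub_normal (N : ℕ) : (c.sub N).Normal :=
  ⟨fun g hg h j hj => by rw [c.coord_conj (fun i hi => hg i (hi.trans hj)), hg j hj]⟩

/-- The `N`-th coordinate is a homomorphism on the `N`-th term. -/
def coordHom (N : ℕ) : c.sub N →* Multiplicative ℤ where
  toFun g := Multiplicative.ofAdd (c.coord N g - c.coord N 1)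
  map_one' := by simp
  map_mul' g h := by
    have := c.left N g h 1 h.2
    rw [mul_one] at this
    rw [← ofAdd_add]
    congr 1
    push_cast
    omega

theorem coordHom_eq_one {N : ℕ} {g : c.sub N} : c.coordHom N g = 1 ↔ (g : Γ) ∈ c.sub (N + 1) := by
  rw [c.mem_sub_succ g.2, ← sub_eq_zero (b := c.coord N 1)]
  exact Iff.rfl

theorem commutator_mem {N : ℕ} (h : Γ) {g : Γ} (hg : g ∈ c.sub N) :
    h * g * h⁻¹ * g⁻¹ ∈ c.sub (N + 1) := by
  have h1 : h * g * h⁻¹ ∈ c.sub N := (c.sub_normal N).conj_mem g hg h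
  refine (c.coordHom_eq_one (g := ⟨_, h1⟩ * ⟨g, hg⟩⁻¹)).1 ?_
  rw [map_mul, map_inv, mul_inv_eq_one]
  change Multiplicative.ofAdd _ = Multiplicative.ofAdd _
  rw [c.coord_conj hg]

theorem exists_generator (N : ℕ) : ∃ t ∈ c.sub N, ∀ g ∈ c.sub N,
    ∃ e : ℤ, ∃ d ∈ c.sub (N + 1), g = t ^ e * d := by
  obtain ⟨⟨_, ⟨t, rfl⟩⟩, ht⟩ := IsCyclic.exists_generator (α := (c.coordHom N).range)
  refine ⟨t, t.2, fun g hg => ?_⟩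
  obtain ⟨e, he⟩ := Subgroup.mem_zpowers_iff.1 (ht ⟨_, ⟨⟨g, hg⟩, rfl⟩⟩)
  refine ⟨e, (t : Γ) ^ (-e) * g, ?_, by group⟩
  refine (c.coordHom_eq_one (g := t ^ (-e) * ⟨g, hg⟩)).1 ?_
  have := Subtype.ext_iff.1 he
  simp only [Subgroup.coe_zpow] at this
  rw [map_mul, map_zpow, zpow_neg, this, inv_mul_cancel]

/-- The lexicographic order on a group with central coordinates. -/
noncomputable abbrev linearOrder : LinearOrder Γ :=
  LinearOrder.lift' (fun g => toLex fun i => c.coord i g) fun g h hgh =>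
    c.inj g h fun i => congrFun (toLex.injective hgh) i

theorem lt_iff {g h : Γ} : c.linearOrder.lt g h ↔
    ∃ i, (∀ j < i, c.coord j g = c.coord j h) ∧ c.coord i g < c.coord i h := Iff.rfl

theorem mulLeftMono : let _ := c.linearOrder; MulLeftMono Γ := by
  let _ := c.linearOrder
  refine ⟨fun k g h hgh => ?_⟩
  rcases hgh.eq_or_lt with rfl | hlt
  · exact le_rfl
  obtain ⟨i, hi, hlt⟩ := c.lt_iff.1 hlt
  refine le_of_lt (c.lt_iff.2 ⟨i, c.left_eq hi, ?_⟩)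
  have := c.left i k g h hi
  omega

theorem mulRightMono : let _ := c.linearOrder; MulRightMono Γ := by
  let _ := c.linearOrder
  refine ⟨fun k g h hgh => ?_⟩
  rcases hgh.eq_or_lt with rfl | hlt
  · exact le_rfl
  obtain ⟨i, hi, hlt⟩ := c.lt_iff.1 hlt
  refine le_of_lt (c.lt_iff.2 ⟨i, c.right_eq hi, ?_⟩)
  have := c.right i k g h hi
  dsimp only [Function.swap]
  omega

/-- The filtration by coordinates is convex for the lexicographic order. -/
noncomputable abbrev filtration : let _ := c.linearOrder; ConvexFiltration Γ :=
  let _ := c.linearOrder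
  { sub := c.sub
    normal := c.sub_normal
    anti := c.sub_antitone
    convex := fun N d hd g hg hlt => by
      obtain ⟨i, hi, hlt⟩ := c.lt_iff.1 hlt
      have hiN : i < N := by
        by_contra! h
        exact hg fun j hj => (hi j (hj.trans_le h)).symm
      exact c.lt_iff.2 ⟨i, fun j hj => (hd j (hj.trans hiN)).trans (hi j hj), hd i hiN ▸ hlt⟩
    sep := fun g hg => c.inj g 1 fun i => hg (i + 1) i i.lt_succ_self }

end CentralCoordinates

end CentralCoordinates

section Magnus

variable {β : Type*}

/-- Formal power series with integral coefficients in noncommuting variables. -/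
structure Magnus (β : Type*) where
  /-- The coefficients of a power series. -/
  coeff : List β → ℤ

namespace Magnus

instance : CoeFun (Magnus β) fun _ => List β → ℤ := ⟨coeff⟩

/-- The series of the coefficients of the words starting with `a`, stripped of the first letter. -/
def tail (f : Magnus β) (a : β) : Magnus β := ⟨fun w => f (a :: w)⟩

/-- The product of power series. -/
def mulCoeff (f g : Magnus β) : List β → ℤ
  | [] => f [] * g []
  | a :: w => f [] * g (a :: w) + mulCoeff (f.tail a) g w

instance : Mul (Magnus β) := ⟨fun f g => ⟨mulCoeff f g⟩⟩

instance : One (Magnus β) := ⟨⟨fun w => if w = [] then 1 else 0⟩⟩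

theorem ext' {f g : Magnus β} (h : ∀ w, f w = g w) : f = g := by
  cases f
  cases g
  exact congrArg mk (funext h)

theorem mul_nil (f g : Magnus β) : (f * g) [] = f [] * g [] := rfl

theorem mul_cons (f g : Magnus β) (a : β) (w : List β) :
    (f * g) (a :: w) = f [] * g (a :: w) + (f.tail a * g) w := rfl

theorem one_nil : (1 : Magnus β) [] = 1 := rfl

theorem one_cons (a : β) (w : List β) : (1 : Magnus β) (a :: w) = 0 := rfl

theorem zero_mul_apply {f : Magnus β} (hf : ∀ w, f w = 0) (g : Magnus β) (w : List β) :
    (f * g) w = 0 := by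
  induction w generalizing f with
  | nil => rw [mul_nil, hf, zero_mul]
  | cons a w ih => rw [mul_cons, hf, zero_mul, zero_add, ih (f := f.tail a) fun w => hf _]

theorem lin_mul_apply {f f₁ f₂ : Magnus β} {r : ℤ} (hf : ∀ w, f w = r * f₁ w + f₂ w)
    (g : Magnus β) (w : List β) : (f * g) w = r * (f₁ * g) w + (f₂ * g) w := by
  induction w generalizing f f₁ f₂ with
  | nil => simp only [mul_nil, hf]; ring
  | cons a w ih =>
    rw [mul_cons, mul_cons, mul_cons, hf,
      ih (f := f.tail a) (f₁ := f₁.tail a) (f₂ := f₂.tail a) fun w => hf _]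
    ring

theorem mul_assoc_apply (f g h : Magnus β) (w : List β) : (f * g * h) w = (f * (g * h)) w := by
  induction w generalizing f with
  | nil => simp only [mul_nil, mul_assoc]
  | cons a w ih =>
    rw [mul_cons, mul_cons, lin_mul_apply (f := (f * g).tail a) (r := f []) (f₁ := g.tail a)
      (f₂ := f.tail a * g) fun w => rfl, ih, mul_cons g h, mul_nil]
    ring

instance : Monoid (Magnus β) where
  mul_assoc f g h := ext' (mul_assoc_apply f g h)
  one_mul f := ext' fun w => by
    cases w with
    | nil => rw [mul_nil, one_nil, one_mul]
    | cons a w => rw [mul_cons, one_nil, one_mul,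
        zero_mul_apply (f := tail 1 a) fun w => one_cons a w, add_zero]
  mul_one f := ext' fun w => by
    induction w generalizing f with
    | nil => rw [mul_nil, one_nil, mul_one]
    | cons a w ih => rw [mul_cons, ih, one_cons, mul_zero, zero_add, tail]

/-- Right multiplication by a series with constant term `1` does not change leading coefficients. -/
theorem mul_apply_sub_left {f f' g : Magnus β} (hg : g [] = 1) {w : List β}
    (h : ∀ v, v.length < w.length → f v = f' v) :
    (f * g) w - (f' * g) w = f w - f' w := by
  induction w generalizing f f' with
  | nil => simp only [mul_nil, hg, mul_one]
  | cons a w ih =>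
    have := ih (f := f.tail a) (f' := f'.tail a) fun v hv => h _ (Nat.succ_lt_succ hv)
    rw [mul_cons, mul_cons, h [] (Nat.succ_pos _)]
    simp only [tail] at this ⊢
    linarith

theorem mul_apply_eq_right {f g g' : Magnus β} {w : List β}
    (h : ∀ v, v.length ≤ w.length → g v = g' v) : (f * g) w = (f * g') w := by
  induction w generalizing f with
  | nil => rw [mul_nil, mul_nil, h _ le_rfl]
  | cons a w ih =>
    rw [mul_cons, mul_cons, h _ le_rfl, ih fun v hv => h _ (hv.trans (Nat.le_succ _))]

/-- Left multiplication by a series with constant term `1` does not change leading coefficients. -/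
theorem mul_apply_sub_right {f g g' : Magnus β} (hf : f [] = 1) {w : List β}
    (h : ∀ v, v.length < w.length → g v = g' v) :
    (f * g) w - (f * g') w = g w - g' w := by
  cases w with
  | nil => simp only [mul_nil, hf, one_mul]
  | cons a w =>
    rw [mul_cons, mul_cons, hf, mul_apply_eq_right (w := w) fun v hv => h v (Nat.lt_succ_of_le hv)]
    ring

variable [DecidableEq β]

/-- The series `1 + a`. -/
def onePlus (a : β) : Magnus β :=
  ⟨fun
    | [] => 1
    | b :: w => if b = a ∧ w = [] then 1 else 0⟩

/-- The inverse of the series `1 + a`. -/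
def onePlusInv (a : β) : Magnus β :=
  ⟨fun w => if ∀ b ∈ w, b = a then (-1) ^ w.length else 0⟩

theorem onePlusInv_nil (a : β) : onePlusInv a [] = 1 := by simp [onePlusInv]

theorem onePlusInv_cons (a b : β) (w : List β) :
    onePlusInv a (b :: w) = if b = a then - onePlusInv a w else 0 := by
  by_cases h : b = a <;> simp [onePlusInv, h, pow_succ, apply_ite]

theorem onePlus_mul_cons (a : β) (f : Magnus β) (b : β) (w : List β) :
    (onePlus a * f) (b :: w) = f (b :: w) + if b = a then f w else 0 := by
  rw [mul_cons]
  have h1 : onePlus a [] = 1 := rfl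
  rw [h1, one_mul]
  congr 1
  split_ifs with h
  · have : (onePlus a).tail b = 1 := ext' fun w => by
      simp only [tail, onePlus, h, true_and]
      rfl
    rw [this, one_mul]
  · exact zero_mul_apply (fun w => by simp [tail, onePlus, h]) f w

theorem onePlus_mul_nil (a : β) (f : Magnus β) : (onePlus a * f) [] = f [] := by
  rw [mul_nil, onePlus, one_mul]

theorem onePlus_mul_inv (a : β) : onePlus a * onePlusInv a = 1 := ext' fun w => by
  cases w with
  | nil => rw [onePlus_mul_nil, onePlusInv_nil, one_nil]
  | cons b w =>
    rw [onePlus_mul_cons, onePlusInv_cons, one_cons]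
    split_ifs <;> ring

theorem inv_mul_onePlus (a : β) : onePlusInv a * onePlus a = 1 := ext' fun w => by
  induction w with
  | nil => rw [mul_nil, onePlusInv_nil]; rfl
  | cons b w ih =>
    rw [mul_cons, lin_mul_apply (r := if b = a then -1 else 0) (f₁ := onePlusInv a)
      (f₂ := ⟨fun _ => 0⟩), zero_mul_apply (f := ⟨fun _ => 0⟩) fun _ => rfl, ih, one_cons]
    · by_cases h : b = a <;> cases w <;> simp [h, onePlusInv_nil, onePlus, one_nil, one_cons]
    · intro w
      simp only [tail, onePlusInv_cons]
      split_ifs <;> ring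

/-- The unit `1 + a` of the ring of power series. -/
def unit (a : β) : (Magnus β)ˣ := ⟨onePlus a, onePlusInv a, onePlus_mul_inv a, inv_mul_onePlus a⟩

/-- The Magnus embedding of a free group. -/
def embed : FreeGroup β →* (Magnus β)ˣ := FreeGroup.lift unit

theorem embed_nil (g : FreeGroup β) : (embed g : Magnus β) [] = 1 := by
  induction g using FreeGroup.induction_on with
  | C1 => rfl
  | of a => simp only [embed, FreeGroup.lift_apply_of]; rfl
  | inv_of a _ => simp only [embed, map_inv, FreeGroup.lift_apply_of]; exact onePlusInv_nil a
  | mul g h hg hh => rw [map_mul, Units.val_mul, mul_nil, hg, hh, one_mul]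

theorem zpow_unit_mul_cons_of_ne {a b : β} (hab : b ≠ a) (e : ℤ) (f : Magnus β) (w : List β) :
    (((unit a ^ e : (Magnus β)ˣ) : Magnus β) * f) (b :: w) = f (b :: w) := by
  have h1 : ∀ f : Magnus β, (onePlus a * f) (b :: w) = f (b :: w) := fun f => by
    rw [onePlus_mul_cons, if_neg hab, add_zero]
  induction e generalizing f with
  | zero => rw [zpow_zero, Units.val_one, one_mul]
  | succ n ih => rw [add_comm, zpow_add, zpow_one, Units.val_mul, mul_assoc, ← ih f]; exact h1 _
  | pred n ih =>
    rw [sub_eq_add_neg, add_comm, zpow_add, zpow_neg_one, Units.val_mul, mul_assoc, ← h1, ← ih f]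
    exact congrArg (fun u : Magnus β => u (b :: w)) (Units.mul_inv_cancel_left (unit a) _)

theorem zpow_unit_mul_nil (a : β) (e : ℤ) (f : Magnus β) :
    (((unit a ^ e : (Magnus β)ˣ) : Magnus β) * f) [] = f [] := by
  have : unit a ^ e = embed (FreeGroup.of a ^ e) := by
    rw [map_zpow, embed, FreeGroup.lift_apply_of]
  rw [this, mul_nil, embed_nil, one_mul]

theorem zpow_unit_mul_cons_self (a : β) (e : ℤ) (f : Magnus β) {w : List β}
    (hw : (a :: w).IsChain (· ≠ ·)) :
    (((unit a ^ e : (Magnus β)ˣ) : Magnus β) * f) (a :: w) = f (a :: w) + e * f w := by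
  have h0 : ∀ (e : ℤ) (f : Magnus β), (((unit a ^ e : (Magnus β)ˣ) : Magnus β) * f) w = f w := by
    intro e f
    cases w with
    | nil => exact zpow_unit_mul_nil a e f
    | cons b w => exact zpow_unit_mul_cons_of_ne (List.isChain_cons_cons.1 hw).1.symm e f w
  have h1 : ∀ f : Magnus β, ((unit a : Magnus β) * f) (a :: w) = f (a :: w) + f w := fun f => by
    change (onePlus a * f) _ = _
    rw [onePlus_mul_cons, if_pos rfl]
  induction e generalizing f with
  | zero => rw [zpow_zero, Units.val_one, one_mul, zero_mul, add_zero]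
  | succ n ih =>
    rw [add_comm, zpow_add, zpow_one, Units.val_mul, mul_assoc, h1, ih, h0]
    ring
  | pred n ih =>
    have h2 := h1 (((unit a ^ (-(n : ℤ) - 1) : (Magnus β)ˣ) : Magnus β) * f)
    rw [h0, ← mul_assoc, ← Units.val_mul, ← zpow_one_add, add_sub_cancel, ih] at h2
    linarith

open scoped Pointwise

/-- The series that have a longest alternating word, all of which start with `a`. -/
def leading (a : β) : Set (Magnus β) := {f | ∃ n,
  (∃ w, (a :: w).IsChain (· ≠ ·) ∧ w.length = n ∧ f (a :: w) ≠ 0) ∧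
  ∀ b w, (b :: w).IsChain (· ≠ ·) → n ≤ w.length → f (b :: w) ≠ 0 → b = a ∧ w.length = n}

omit [DecidableEq β] in
theorem leading_disjoint : Pairwise (Function.onFun Disjoint (leading (β := β))) := by
  intro a b hab
  refine Set.disjoint_left.2 ?_
  rintro f ⟨n, ⟨w, hw, rfl, hfw⟩, hn⟩ ⟨m, ⟨w', hw', rfl, hfw'⟩, hm⟩
  rcases le_total w.length w'.length with h | h
  · exact hab (hn _ _ hw' h hfw').1.symm
  · exact hab (hm _ _ hw h hfw).1

theorem leading_nonempty (a : β) : (leading a).Nonempty := by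
  refine ⟨onePlus a, 0, ⟨[], by simp, rfl, by simp [onePlus]⟩, fun b w _ _ hne => ?_⟩
  simp only [onePlus, ne_eq, ite_eq_right_iff, not_forall] at hne
  exact ⟨hne.1.1, by simp [hne.1.2]⟩

theorem zpow_unit_smul_leading {a b : β} (hab : a ≠ b) {e : ℤ} (he : e ≠ 0) :
    (unit a ^ e) • leading b ⊆ leading a := by
  rintro _ ⟨f, ⟨n, ⟨w, hw, rfl, hfw⟩, hn⟩, rfl⟩
  refine ⟨w.length + 1, ⟨b :: w, List.isChain_cons_cons.2 ⟨hab, hw⟩, rfl, ?_⟩,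
    fun x v hv hlen hne => ?_⟩
  · change (((unit a ^ e : (Magnus β)ˣ) : Magnus β) * f) _ ≠ 0
    rw [zpow_unit_mul_cons_self _ _ _ (List.isChain_cons_cons.2 ⟨hab, hw⟩)]
    have : f (a :: b :: w) = 0 := by
      by_contra h
      exact hab (hn _ _ (List.isChain_cons_cons.2 ⟨hab, hw⟩) (by simp) h).1
    rw [this, zero_add]
    exact mul_ne_zero he hfw
  · have h0 : f (x :: v) = 0 := by
      by_contra h
      have := (hn _ _ hv (by omega) h).2
      omega
    change (((unit a ^ e : (Magnus β)ˣ) : Magnus β) * f) _ ≠ 0 at hne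
    by_cases hx : x = a
    · subst hx
      refine ⟨rfl, ?_⟩
      rw [zpow_unit_mul_cons_self _ _ _ hv, h0, zero_add] at hne
      cases v with
      | nil => simp at hlen
      | cons y v =>
        have := (hn _ _ (List.isChain_cons_cons.1 hv).2 (by simpa using hlen)
          (right_ne_zero_of_mul hne)).2
        simp [this]
    · rw [zpow_unit_mul_cons_of_ne hx, h0] at hne
      exact absurd rfl hne

theorem embed_injective [Nontrivial β] : Function.Injective (embed (β := β)) := by
  have hZ : ∀ h : FreeGroup Unit, ∃ e : ℤ, h = FreeGroup.of () ^ e := fun h =>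
    ⟨FreeGroup.freeGroupUnitEquivInt h, (FreeGroup.freeGroupUnitEquivInt.left_inv h).symm⟩
  let f : ∀ a : β, FreeGroup Unit →* (Magnus β)ˣ := fun a => FreeGroup.lift fun _ => unit a
  have hinj : Function.Injective (Monoid.CoprodI.lift f) := by
    refine Monoid.CoprodI.lift_injective_of_ping_pong f (Or.inr ?_) leading leading_nonempty
      leading_disjoint fun a b hab h hh => ?_
    · obtain ⟨a⟩ : Nonempty β := inferInstance
      have : Infinite (FreeGroup Unit) := Infinite.of_injective _
        FreeGroup.freeGroupUnitEquivInt.symm.injective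
      exact ⟨a, (Cardinal.natCast_lt_aleph0 (n := 3)).le.trans (Cardinal.aleph0_le_mk _)⟩
    · obtain ⟨e, rfl⟩ := hZ h
      have hf : f a (FreeGroup.of () ^ e) = unit a ^ e := by
        rw [map_zpow]
        exact congrArg (· ^ e) FreeGroup.lift_apply_of
      rw [hf]
      exact zpow_unit_smul_leading hab fun he => hh (by rw [he, zpow_zero])
  have : embed = (Monoid.CoprodI.lift f).comp (freeGroupEquivCoprodI (ι := β)).toMonoidHom := by
    ext a
    simp [embed, f, freeGroupEquivCoprodI]
  rw [this]
  exact hinj.comp freeGroupEquivCoprodI.injective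

end Magnus

end Magnus

section FreeGroupCoordinates

variable {β : Type*} [Fintype β]

theorem exists_code (β : Type*) [Fintype β] : ∃ code : List β → ℕ, Function.Injective code ∧
    ∀ v w, v.length < w.length → code v < code w := by
  let e := Fintype.equivFin β
  let m := Fintype.card β
  let f : β → ℕ := fun b => e b + 1
  have hf : ∀ w : List β, ∀ x ∈ w.map f, x < m + 2 := by
    intro w x hx
    obtain ⟨b, -, rfl⟩ := List.mem_map.1 hx
    have := (e b).2
    change (e b : ℕ) + 1 < Fintype.card β + 2
    omega
  have hfi : Function.Injective f := fun a b h => e.injective (Fin.ext (Nat.succ_injective h))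
  let code : List β → ℕ := fun w => Nat.ofDigits (m + 2) (w.map f)
  have hmono : ∀ v w, v.length < w.length → code v < code w := by
    intro v w h
    have hw : w.map f ≠ [] := by
      intro h0
      rw [List.map_eq_nil_iff.1 h0] at h
      exact absurd h (Nat.not_lt_zero _)
    have h1 := Nat.ofDigits_lt_base_pow_length' (hf v)
    have h2 := Nat.pow_length_le_mul_ofDigits (b := m) hw (by
      obtain ⟨b, -, hb⟩ := List.mem_map.1 (List.getLast_mem hw)
      rw [← hb]
      exact Nat.succ_ne_zero _)
    rw [List.length_map] at h1 h2
    have h3 : (m + 2) ^ (v.length + 1) ≤ (m + 2) ^ w.length := Nat.pow_le_pow_right (by omega) h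
    rw [pow_succ'] at h3
    exact h1.trans_le (Nat.le_of_mul_le_mul_left (h3.trans h2) (by omega))
  refine ⟨code, fun v w h => ?_, hmono⟩
  have hlen : v.length = w.length := by
    rcases lt_trichotomy v.length w.length with h' | h' | h'
    · exact absurd h (hmono _ _ h').ne
    · exact h'
    · exact absurd h (hmono _ _ h').ne'
  exact List.map_injective_iff.2 hfi (Nat.ofDigits_inj_of_len_eq (by omega) (by simpa using hlen)
    (hf v) (hf w) h)

open Classical in
theorem FreeGroup.nonempty_centralCoordinates [Nontrivial β] :
    Nonempty (CentralCoordinates (FreeGroup β)) := by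
  obtain ⟨code, hinj, hmono⟩ := exists_code β
  let c : ℕ → FreeGroup β → ℤ := fun i g =>
    if h : ∃ w, code w = i then (Magnus.embed g : Magnus β) h.choose else 0
  have hc : ∀ w g, c (code w) g = (Magnus.embed g : Magnus β) w := by
    intro w g
    have h : ∃ v, code v = code w := ⟨w, rfl⟩
    simp only [c, dif_pos h]
    rw [hinj h.choose_spec]
  have hc0 : ∀ i, (∀ w, code w ≠ i) → ∀ g, c i g = 0 := fun i hi g =>
    dif_neg fun ⟨w, hw⟩ => hi w hw
  refine ⟨⟨c, fun i k g h hgh => ?_, fun i k g h hgh => ?_, fun g h hgh => ?_⟩⟩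
  · by_cases hi : ∃ w, code w = i
    · obtain ⟨w, rfl⟩ := hi
      simp only [hc, _root_.map_mul, Units.val_mul]
      refine Magnus.mul_apply_sub_right (Magnus.embed_nil k) fun v hv => ?_
      rw [← hc, ← hc]
      exact hgh _ (hmono _ _ hv)
    · simp only [hc0 i (not_exists.1 hi)]
  · by_cases hi : ∃ w, code w = i
    · obtain ⟨w, rfl⟩ := hi
      simp only [hc, _root_.map_mul, Units.val_mul]
      refine Magnus.mul_apply_sub_left (Magnus.embed_nil k) fun v hv => ?_
      rw [← hc, ← hc]
      exact hgh _ (hmono _ _ hv)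
    · simp only [hc0 i (not_exists.1 hi)]
  · refine Magnus.embed_injective (Units.ext (Magnus.ext' fun w => ?_))
    rw [← hc, ← hc, hgh]

end FreeGroupCoordinates

section RightInverse

/-- A matrix over the group algebra of a free group that is left regular in all finite solvable
quotients is right invertible. -/
theorem exists_right_inverse_of_finite_quotients {K : Type} [Field K] [Finite K] {α : Type}
    [Fintype α] [Nontrivial α] {β : Type} [Fintype β] [DecidableEq β]
    {A : β → β → MonoidAlgebra K (FreeGroup α)}
    (hA : ∀ (Q : Type) [Group Q] [Finite Q], Group.IsSolvable Q → ∀ (φ : FreeGroup α →* Q)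
      (v : β → MonoidAlgebra K Q),
      (∀ i, ∑ k, v k * MonoidAlgebra.mapDomainRingHom K φ (A k i) = 0) → v = 0) :
    ∃ C : β → β → MonoidAlgebra K (FreeGroup α), ∀ k l,
      ∑ i, A k i * C i l = if k = l then 1 else 0 := by
  obtain ⟨c⟩ := FreeGroup.nonempty_centralCoordinates (β := α)
  choose t ht hgen using c.exists_generator
  have hB := exists_left_inverse_of_finite_quotients c.sub_normal c.sub_zero c.sub_antitone ht hgen
    (fun n h g hg => c.commutator_mem h hg) hA
  let _ := c.linearOrder
  have := c.mulLeftMono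
  have := c.mulRightMono
  exact exists_right_inverse_of_quotients c.filtration hB

end RightInverse

section CrossedHom

variable {G R R' : Type*} [Group G] [Ring R] [Ring R']

/-- A crossed homomorphism from a group to a ring, with respect to a multiplicative map. -/
def IsCrossedHom (φ : G →* R) (δ : G → R) : Prop := ∀ g h, δ (g * h) = δ g + φ g * δ h

namespace IsCrossedHom

variable {φ : G →* R} {δ : G → R}

theorem map_one (hδ : IsCrossedHom φ δ) : δ 1 = 0 := by
  have := hδ 1 1
  rw [mul_one, _root_.map_one, one_mul] at this
  exact left_eq_add.1 this

theorem map_inv (hδ : IsCrossedHom φ δ) (g : G) : δ g⁻¹ = -(φ g⁻¹ * δ g) := by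
  have := hδ g⁻¹ g
  rw [inv_mul_cancel, hδ.map_one] at this
  exact eq_neg_of_add_eq_zero_left this.symm

theorem map_commutator (hδ : IsCrossedHom φ δ) (g h : G) :
    δ ⁅g, h⁆ = (1 - φ (g * h * g⁻¹)) * δ g + (φ g - φ ⁅g, h⁆) * δ h := by
  simp only [commutatorElement_def, hδ _ _, hδ.map_inv, map_mul, mul_neg, sub_mul, one_mul,
    ← mul_assoc]
  abel

theorem mul_right (hδ : IsCrossedHom φ δ) (r : R) : IsCrossedHom φ fun g => δ g * r :=
  fun g h => by simp only [hδ g h, add_mul, mul_assoc]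

theorem sum {ι : Type*} {δ : ι → G → R} (s : Finset ι) (hδ : ∀ i, IsCrossedHom φ (δ i)) :
    IsCrossedHom φ fun g => ∑ i ∈ s, δ i g :=
  fun g h => by simp only [hδ _ g h, Finset.mul_sum, Finset.sum_add_distrib]

theorem map (hδ : IsCrossedHom φ δ) (f : R →+* R') :
    IsCrossedHom ((f : R →* R').comp φ) fun g => f (δ g) :=
  fun g h => by simp only [hδ g h, map_add, map_mul]; rfl

theorem eq_of_generators {β : Type*} {φ : FreeGroup β →* R} {δ δ' : FreeGroup β → R}
    (hδ : IsCrossedHom φ δ) (hδ' : IsCrossedHom φ δ')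
    (h : ∀ i, δ (FreeGroup.of i) = δ' (FreeGroup.of i)) (g : FreeGroup β) : δ g = δ' g := by
  induction g using FreeGroup.induction_on with
  | C1 => rw [hδ.map_one, hδ'.map_one]
  | of i => exact h i
  | inv_of i _ => rw [hδ.map_inv, hδ'.map_inv, h]
  | mul g g' hg hg' => rw [hδ, hδ', hg, hg']

end IsCrossedHom

/-- The affine group of a ring restricted to a group of linear parts. -/
@[ext] structure AffineGroup {G R : Type*} [Group G] [Ring R] (φ : G →* R) where
  /-- The translation part. -/
  left : R
  /-- The linear part. -/
  right : G

namespace AffineGroup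

variable {φ : G →* R}

instance : Mul (AffineGroup φ) := ⟨fun x y => ⟨x.left + φ x.right * y.left, x.right * y.right⟩⟩

instance : One (AffineGroup φ) := ⟨⟨0, 1⟩⟩

instance : Inv (AffineGroup φ) := ⟨fun x => ⟨-(φ x.right⁻¹ * x.left), x.right⁻¹⟩⟩

@[simp] theorem mul_left (x y : AffineGroup φ) :
    (x * y).left = x.left + φ x.right * y.left := rfl

@[simp] theorem mul_right (x y : AffineGroup φ) : (x * y).right = x.right * y.right := rfl

@[simp] theorem one_left : (1 : AffineGroup φ).left = 0 := rfl

@[simp] theorem one_right : (1 : AffineGroup φ).right = 1 := rfl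

@[simp] theorem inv_left (x : AffineGroup φ) : x⁻¹.left = -(φ x.right⁻¹ * x.left) := rfl

@[simp] theorem inv_right (x : AffineGroup φ) : x⁻¹.right = x.right⁻¹ := rfl

instance : Group (AffineGroup φ) :=
  Group.ofLeftAxioms
    (fun x y z => by ext <;> simp [mul_add, mul_assoc, add_assoc])
    (fun x => by ext <;> simp)
    (fun x => by ext <;> simp)

/-- The affine group as a product set. -/
def equivProd (φ : G →* R) : AffineGroup φ ≃ R × G :=
  ⟨fun x => (x.left, x.right), fun x => ⟨x.1, x.2⟩, fun _ => rfl, fun _ => rfl⟩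

instance [Finite G] [Finite R] : Finite (AffineGroup φ) := Finite.of_equiv _ (equivProd φ).symm

/-- The projection to the linear part. -/
def rightHom (φ : G →* R) : AffineGroup φ →* G := ⟨⟨right, rfl⟩, fun _ _ => rfl⟩

theorem isSolvable [Group.IsSolvable G] : Group.IsSolvable (AffineGroup φ) := by
  let f : Multiplicative R →* AffineGroup φ :=
    ⟨⟨fun r => ⟨r.toAdd, 1⟩, rfl⟩, fun r s => by ext <;> simp⟩
  refine Group.isSolvable_of_ker_le_range f (rightHom φ) fun x hx =>
    ⟨Multiplicative.ofAdd x.left, ?_⟩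
  ext
  · rfl
  · exact (MonoidHom.mem_ker.1 hx).symm

variable {β : Type*}

theorem right_lift (f : β → AffineGroup φ) (g : FreeGroup β) :
    (FreeGroup.lift f g).right = FreeGroup.lift (fun i => (f i).right) g := by
  have : (rightHom φ).comp (FreeGroup.lift f) = FreeGroup.lift fun i => (f i).right := by
    ext i
    simp [rightHom]
  exact DFunLike.congr_fun this g

theorem isCrossedHom_left (f : β → AffineGroup φ) :
    IsCrossedHom (φ.comp (FreeGroup.lift fun i => (f i).right))
      fun g => (FreeGroup.lift f g).left :=
  fun g h => by simp only [map_mul, mul_left, right_lift]; rfl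

end AffineGroup

theorem exists_isCrossedHom {β : Type*} (φ : FreeGroup β →* R) (d : β → R) :
    ∃ δ, IsCrossedHom φ δ ∧ ∀ i, δ (FreeGroup.of i) = d i := by
  let f : β → AffineGroup φ := fun i => ⟨d i, FreeGroup.of i⟩
  have h := AffineGroup.isCrossedHom_left f
  have h1 : FreeGroup.lift (fun i => (f i).right) = MonoidHom.id _ := by
    ext i
    simp [f]
  rw [h1] at h
  exact ⟨_, h, fun i => by simp [f]⟩

end CrossedHom

section RightIdeals

variable {R R' : Type*} [Ring R] [Ring R'] {β : Type*} [Fintype β]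

/-- The linear combinations with right coefficients of a family of ring elements. -/
def rightComb (d : β → R) : (β → R) →+ R where
  toFun b := ∑ i, d i * b i
  map_zero' := by simp
  map_add' b b' := by simp [mul_add, Finset.sum_add_distrib]

theorem rightComb_apply (d b : β → R) : rightComb d b = ∑ i, d i * b i := rfl

theorem mul_mem_range_rightComb {d : β → R} {x : R} (hx : x ∈ (rightComb d).range) (r : R) :
    x * r ∈ (rightComb d).range := by
  obtain ⟨b, rfl⟩ := hx
  exact ⟨fun i => b i * r, by simp [rightComb_apply, Finset.sum_mul, mul_assoc]⟩

theorem range_rightComb_le {γ : Type*} [Fintype γ] {d : β → R} {d' : γ → R}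
    (h : ∀ i, d i ∈ (rightComb d').range) : (rightComb d).range ≤ (rightComb d').range := by
  rintro _ ⟨b, rfl⟩
  exact AddSubgroup.sum_mem _ fun i _ => mul_mem_range_rightComb (h i) _

theorem map_mem_range_rightComb (f : R →+* R') {d : β → R} {x : R}
    (hx : x ∈ (rightComb d).range) : f x ∈ (rightComb fun i => f (d i)).range := by
  obtain ⟨b, rfl⟩ := hx
  exact ⟨fun i => f (b i), by simp [rightComb_apply]⟩

theorem mem_range_rightComb_self [DecidableEq β] (d : β → R) (i : β) :
    d i ∈ (rightComb d).range :=
  ⟨Pi.single i 1, by simp [rightComb_apply, Pi.single_apply]⟩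

/-- The group elements congruent to `1` modulo a right ideal. -/
def congruenceSubgroup {G : Type*} [Group G] (φ : G →* R) (d : β → R) : Subgroup G where
  carrier := {g | φ g - 1 ∈ (rightComb d).range}
  one_mem' := by
    simp only [Set.mem_ofPred_eq, map_one, sub_self]
    exact zero_mem _
  mul_mem' {g h} hg hh := by
    have := add_mem (mul_mem_range_rightComb hg (φ h)) hh
    simpa [sub_mul] using this
  inv_mem' {g} hg := by
    have := neg_mem (mul_mem_range_rightComb hg (φ g⁻¹))
    simpa [sub_mul, ← map_mul] using this

theorem mem_congruenceSubgroup {G : Type*} [Group G] {φ : G →* R} {d : β → R} {g : G} :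
    g ∈ congruenceSubgroup φ d ↔ φ g - 1 ∈ (rightComb d).range := Iff.rfl

theorem mem_congruenceSubgroup_of_mem {G : Type*} [Group G] {φ : G →* R} {d : β → R} {g h : G}
    (hg : g ∈ congruenceSubgroup φ d) (h1 : φ g - φ h ∈ (rightComb d).range) :
    h ∈ congruenceSubgroup φ d := by
  have := sub_mem (mem_congruenceSubgroup.1 hg) h1
  rw [mem_congruenceSubgroup]
  simpa using this

end RightIdeals

section Augmentation

variable {K : Type*} [Field K] {G : Type*} [Group G]

/-- The augmentation of a group algebra. -/
noncomputable def augmentation (K G : Type*) [Field K] [Group G] : MonoidAlgebra K G →+* K :=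
  (MonoidAlgebra.lift K K G 1 : MonoidAlgebra K G →ₐ[K] K)

@[simp] theorem augmentation_single (g : G) (r : K) :
    augmentation K G (MonoidAlgebra.single g r) = r := by
  simp [augmentation]

theorem augmentation_of (g : G) : augmentation K G (MonoidAlgebra.of K G g) = 1 := by
  simp [MonoidAlgebra.of]

theorem augmentation_mapDomain {H : Type*} [Group H] (f : G →* H) (x : MonoidAlgebra K G) :
    augmentation K H (MonoidAlgebra.mapDomainRingHom K f x) = augmentation K G x := by
  induction x using MonoidAlgebra.induction_linear with
  | zero => simp
  | add x y hx hy => rw [map_add, map_add, map_add, hx, hy]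
  | single g r => simp

variable {β : Type*} [Fintype β]

/-- The augmentation ideal of the group algebra of a free group is generated by the elements
`x - 1`, where `x` is a generator. -/
theorem mem_range_rightComb_of_augmentation_eq_zero [DecidableEq β]
    {x : MonoidAlgebra K (FreeGroup β)} (hx : augmentation K _ x = 0) :
    x ∈ (rightComb fun i => MonoidAlgebra.of K (FreeGroup β) (FreeGroup.of i) - 1).range := by
  set d : β → MonoidAlgebra K (FreeGroup β) :=
    fun i => MonoidAlgebra.of K (FreeGroup β) (FreeGroup.of i) - 1
  have hgen : congruenceSubgroup (MonoidAlgebra.of K (FreeGroup β)) d = ⊤ := by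
    rw [eq_top_iff, ← FreeGroup.closure_range_of, Subgroup.closure_le]
    rintro _ ⟨i, rfl⟩
    exact mem_range_rightComb_self d i
  have h : ∀ x, x - MonoidAlgebra.single 1 (augmentation K _ x) ∈ (rightComb d).range := by
    intro x
    induction x using MonoidAlgebra.induction_linear with
    | zero => simp
    | add x y hx hy =>
      have := add_mem hx hy
      rw [map_add, MonoidAlgebra.single_add]
      convert this using 1
      abel
    | single g r =>
      have hg : g ∈ congruenceSubgroup (MonoidAlgebra.of K (FreeGroup β)) d :=
        hgen ▸ Subgroup.mem_top g
      have := mul_mem_range_rightComb hg (MonoidAlgebra.single 1 r)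
      simpa [sub_mul, MonoidAlgebra.of, MonoidAlgebra.single_mul_single] using this
  simpa [hx] using h x

end Augmentation

section Fox

variable (K : Type*) [Field K] {β : Type*} [DecidableEq β]

/-- The Fox derivative of a word with respect to a generator. -/
noncomputable def fox (i : β) : FreeGroup β → MonoidAlgebra K (FreeGroup β) :=
  (exists_isCrossedHom (MonoidAlgebra.of K (FreeGroup β)) (Pi.single i 1)).choose

theorem isCrossedHom_fox (i : β) : IsCrossedHom (MonoidAlgebra.of K (FreeGroup β)) (fox K i) :=
  (exists_isCrossedHom (MonoidAlgebra.of K (FreeGroup β)) (Pi.single i 1)).choose_spec.1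

theorem fox_of (i j : β) : fox K i (FreeGroup.of j) = if j = i then 1 else 0 := by
  rw [fox, (exists_isCrossedHom (MonoidAlgebra.of K (FreeGroup β)) (Pi.single i 1)).choose_spec.2,
    Pi.single_apply]

variable {K} [Fintype β]

theorem IsCrossedHom.eq_rightComb {R : Type*} [Ring R] (f : MonoidAlgebra K (FreeGroup β) →+* R)
    {δ : FreeGroup β → R}
    (hδ : IsCrossedHom ((f : _ →* R).comp (MonoidAlgebra.of K (FreeGroup β))) δ)
    (u : FreeGroup β) :
    δ u = rightComb (fun i => f (fox K i u)) fun i => δ (FreeGroup.of i) := by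
  refine hδ.eq_of_generators (δ' := fun u => rightComb (fun i => f (fox K i u)) fun i =>
    δ (FreeGroup.of i)) ?_ (fun j => ?_) u
  · exact IsCrossedHom.sum _ fun i => ((isCrossedHom_fox K i).map f).mul_right _
  · simp [rightComb_apply, fox_of]

theorem IsCrossedHom.eq_rightComb_mapDomain {Q : Type*} [Group Q] (π : FreeGroup β →* Q)
    {δ : FreeGroup β → MonoidAlgebra K Q}
    (hδ : IsCrossedHom ((MonoidAlgebra.of K Q).comp π) δ) (u : FreeGroup β) :
    δ u = rightComb (fun i => MonoidAlgebra.mapDomainRingHom K π (fox K i u))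
      fun i => δ (FreeGroup.of i) := by
  refine IsCrossedHom.eq_rightComb _ ?_ u
  convert hδ using 1
  ext g
  simp

end Fox

section Counting

variable {K : Type} [Field K] [Finite K] {β : Type} [Fintype β] [DecidableEq β]

/-- The map sending `d` to the value at `u` of the crossed homomorphism with values `d` at the
generators. -/
noncomputable def foxMap (K : Type) [Field K] {β : Type} [Fintype β] [DecidableEq β] {Q : Type}
    [Group Q] (u : FreeGroup β) (π : β → Q) : (β → MonoidAlgebra K Q) →+ MonoidAlgebra K Q :=
  rightComb fun i => MonoidAlgebra.mapDomainRingHom K (FreeGroup.lift π) (fox K i u)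

variable {Q : Type} [Group Q]

omit [Finite K] in
theorem left_lift (u : FreeGroup β) (f : β → AffineGroup (MonoidAlgebra.of K Q)) :
    (FreeGroup.lift f u).left = foxMap K u (fun i => (f i).right) fun i => (f i).left := by
  rw [(AffineGroup.isCrossedHom_left f).eq_rightComb_mapDomain _ u]
  simp [foxMap]

omit [Group Q] in
theorem MonoidAlgebra.finite [Finite Q] : Finite (MonoidAlgebra K Q) :=
  Finite.of_injective (fun x : MonoidAlgebra K Q => (x.coeff : Q → K)) fun x y h => by
    ext q
    exact congrFun h q

theorem sum_card_ker_eq [Finite Q] {w u : FreeGroup β}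
    (h : MeasureEquivIn w u (AffineGroup (MonoidAlgebra.of K Q))) [Fintype (β → Q)] :
    ∑ π : β → Q, Nat.card (foxMap K w π).ker = ∑ π : β → Q, Nat.card (foxMap K u π).ker := by
  have hfin := MonoidAlgebra.finite (K := K) (Q := Q)
  have := Fintype.ofFinite Q
  have key : ∀ u : FreeGroup β, ∑ π : β → Q, Nat.card (foxMap K u π).ker =
      ∑ q : Q, Nat.card {f : β → AffineGroup (MonoidAlgebra.of K Q) //
        FreeGroup.lift f u = ⟨0, q⟩} := by
    intro u
    rw [← Nat.card_sigma, ← Nat.card_sigma]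
    refine Nat.card_congr ?_
    exact
      { toFun := fun x => ⟨FreeGroup.lift x.1 u, fun i => ⟨x.2.1 i, x.1 i⟩, by
          ext1
          · rw [left_lift]
            exact x.2.2
          · rw [AffineGroup.right_lift]⟩
        invFun := fun x => ⟨fun i => (x.2.1 i).right, fun i => (x.2.1 i).left, by
          rw [AddMonoidHom.mem_ker, ← left_lift, x.2.2]⟩
        left_inv := fun x => rfl
        right_inv := fun x => by
          obtain ⟨q, f, hf⟩ := x
          have h1 : FreeGroup.lift (fun i => (f i).right) u = q := by
            rw [← AffineGroup.right_lift, hf]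
          subst h1
          rfl }
  rw [key, key]
  exact Finset.sum_congr rfl fun q _ => h _

omit [Finite K] in
theorem foxMap_range_le {u : FreeGroup β} (hu : ∀ i, augmentation K _ (fox K i u) = 0)
    (π : β → Q) :
    (foxMap K u π).range ≤ (rightComb fun i => MonoidAlgebra.of K Q (π i) - 1).range := by
  refine range_rightComb_le fun i => ?_
  have := map_mem_range_rightComb (MonoidAlgebra.mapDomainRingHom K (FreeGroup.lift π))
    (mem_range_rightComb_of_augmentation_eq_zero (hu i))
  convert this using 5
  rw [map_sub, map_one]
  simp

/-- If the Fox maps of `w` have maximal range, then so do those of every word that is measure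
equivalent to `w`. -/
theorem foxMap_range_eq [Finite Q] {w u : FreeGroup β}
    (h : MeasureEquivIn w u (AffineGroup (MonoidAlgebra.of K Q)))
    (hu : ∀ i, augmentation K _ (fox K i u) = 0)
    (hw : ∀ π : β → Q,
      (rightComb fun i => MonoidAlgebra.of K Q (π i) - 1).range ≤ (foxMap K w π).range)
    (π : β → Q) :
    (foxMap K u π).range = (rightComb fun i => MonoidAlgebra.of K Q (π i) - 1).range := by
  have hfin := MonoidAlgebra.finite (K := K) (Q := Q)
  have := Fintype.ofFinite (β → Q)
  have hle : ∀ π : β → Q, (foxMap K u π).range ≤ (foxMap K w π).range :=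
    fun π => (foxMap_range_le hu π).trans (hw π)
  have hcard : ∀ (v : FreeGroup β) (π : β → Q), Nat.card (foxMap K v π).ker *
      Nat.card (foxMap K v π).range = Nat.card (β → MonoidAlgebra K Q) := fun v π => by
    rw [← AddSubgroup.index_ker, AddSubgroup.card_mul_index]
  have hker : ∀ π : β → Q, Nat.card (foxMap K w π).ker ≤ Nat.card (foxMap K u π).ker := by
    intro π
    refine le_of_mul_le_mul_right ?_ (Nat.card_pos (α := (foxMap K w π).range))
    rw [hcard, ← hcard u π]
    exact Nat.mul_le_mul_left _ (Nat.card_le_card_of_injective _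
      (AddSubgroup.inclusion_injective (hle π)))
  have heq := (Finset.sum_eq_sum_iff_of_le fun π _ => hker π).1 (sum_card_ker_eq h) π
    (Finset.mem_univ _)
  refine le_antisymm (foxMap_range_le hu π) ((hw π).trans (le_of_eq ?_))
  refine (AddSubgroup.eq_of_le_of_card_ge (hle π) (le_of_eq ?_)).symm
  have h1 := hcard w π
  rw [← hcard u π, heq] at h1
  exact Nat.eq_of_mul_eq_mul_left (Nat.card_pos (α := (foxMap K u π).ker)) h1

omit [Finite K] [Fintype β] in
theorem augmentation_fox_eq_zero {u : FreeGroup β}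
    (hu : ∀ f : FreeGroup β →* Multiplicative K, f u = 1) (i : β) :
    augmentation K _ (fox K i u) = 0 :=
  hu
    { toFun := fun g => Multiplicative.ofAdd (augmentation K _ (fox K i g))
      map_one' := by rw [(isCrossedHom_fox K i).map_one, map_zero]; rfl
      map_mul' := fun g g' => by
        rw [isCrossedHom_fox K i, map_add, map_mul, augmentation_of, one_mul, ofAdd_add] }

omit [Fintype β] [DecidableEq β] in
theorem MeasureEquivIn.map_eq_one [Finite β] [Finite Q] {w u : FreeGroup β}
    (h : MeasureEquivIn w u Q) (hw : ∀ f : FreeGroup β →* Q, f w = 1) (f : FreeGroup β →* Q) :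
    f u = 1 := by
  have h1 : {f : β → Q | FreeGroup.lift f u = 1} = Set.univ := by
    refine Set.eq_of_subset_of_ncard_le (Set.subset_univ _) ?_ (Set.toFinite _)
    have h2 : {f : β → Q | FreeGroup.lift f w = 1} = Set.univ :=
      Set.eq_univ_of_forall fun f => hw _
    rw [← h2]
    exact (h 1).le
  have h4 : FreeGroup.lift (fun j => f (FreeGroup.of j)) u = 1 := by
    have := Set.mem_univ fun j => f (FreeGroup.of j)
    rwa [← h1] at this
  have h5 : FreeGroup.lift (fun j => f (FreeGroup.of j)) = f := by
    ext j
    simp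
  rwa [h5] at h4

end Counting

section Regularity

variable {K : Type} [Field K] [Finite K] {β : Type} [Fintype β] [DecidableEq β]

/-- If every `x - 1` is a right combination of the images of the Fox derivatives of `u` in all
finite solvable quotients, then the coefficient matrix of the Fox derivatives with respect to the
elements `x - 1` is left regular in all finite solvable quotients. -/
theorem eq_zero_of_range_foxMap {u : FreeGroup β}
    (hu : ∀ i, augmentation K _ (fox K i u) = 0)
    (hr : ∀ (Q : Type) [Group Q] [Finite Q], Group.IsSolvable Q → ∀ π : β → Q, ∀ l,
      MonoidAlgebra.of K Q (π l) - 1 ∈ (foxMap K u π).range)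
    {A : β → β → MonoidAlgebra K (FreeGroup β)}
    (hA : ∀ i, fox K i u = ∑ k, (MonoidAlgebra.of K _ (FreeGroup.of k) - 1) * A k i)
    (Q : Type) [Group Q] [Finite Q] (hQ : Group.IsSolvable Q) (φ : FreeGroup β →* Q)
    (v : β → MonoidAlgebra K Q)
    (hv : ∀ i, ∑ k, v k * MonoidAlgebra.mapDomainRingHom K φ (A k i) = 0) : v = 0 := by
  have hfin := MonoidAlgebra.finite (K := K) (Q := Q)
  have hfin' : Finite (MonoidAlgebra K Q)ᵐᵒᵖ := Finite.of_equiv _ MulOpposite.opEquiv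
  let ψ : Q →* (MonoidAlgebra K Q)ᵐᵒᵖ :=
    { toFun := fun q => MulOpposite.op (MonoidAlgebra.single q⁻¹ 1)
      map_one' := by simp [MonoidAlgebra.one_def]
      map_mul' := fun q r => by
        rw [← MulOpposite.op_mul, MonoidAlgebra.single_mul_single, mul_inv_rev, one_mul] }
  let Q' := AffineGroup ψ
  have hQ' : Group.IsSolvable Q' := AffineGroup.isSolvable
  let π : β → Q' := fun k => ⟨MulOpposite.op (v k * MonoidAlgebra.single (φ (FreeGroup.of k))⁻¹ 1),
    φ (FreeGroup.of k)⟩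
  let pr := MonoidAlgebra.mapDomainRingHom K (AffineGroup.rightHom ψ)
  let Θ : MonoidAlgebra K Q' →ₗ[K] MonoidAlgebra K Q :=
    (Finsupp.linearCombination K fun x : Q' => x.left.unop * MonoidAlgebra.single x.right 1) ∘ₗ
      (MonoidAlgebra.coeffLinearEquiv K : MonoidAlgebra K Q' ≃ₗ[K] _).toLinearMap
  have hΘ1 : ∀ (x : Q') (r : K), Θ (MonoidAlgebra.single x r) =
      r • (x.left.unop * MonoidAlgebra.single x.right 1) := by
    intro x r
    simp [Θ]
  have hΘ : ∀ x y : MonoidAlgebra K Q', Θ (x * y) = Θ x * pr y + augmentation K _ x • Θ y := by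
    intro x y
    induction x using MonoidAlgebra.induction_linear with
    | zero => simp
    | add x x' hx hx' =>
      simp only [add_mul, map_add, hx, hx', add_smul]
      abel
    | single x r =>
      induction y using MonoidAlgebra.induction_linear with
      | zero => simp
      | add y y' hy hy' =>
        simp only [mul_add, map_add, hy, hy', smul_add]
        abel
      | single y s =>
        have h1 : pr (MonoidAlgebra.single y s) = MonoidAlgebra.single y.right s := by
          simp [pr, AffineGroup.rightHom]
        have h2 : (ψ x.right * y.left).unop = y.left.unop * MonoidAlgebra.single x.right⁻¹ 1 := rfl
        have h3 : (MonoidAlgebra.single y.right s : MonoidAlgebra K Q) =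
          s • MonoidAlgebra.single y.right 1 := by simp
        rw [MonoidAlgebra.single_mul_single, hΘ1, hΘ1, hΘ1, h1, augmentation_single,
          AffineGroup.mul_left, AffineGroup.mul_right, MulOpposite.unop_add, h2, add_mul,
          mul_assoc, MonoidAlgebra.single_mul_single, inv_mul_cancel_left, h3, mul_one, smul_add,
          smul_smul, smul_mul_assoc, mul_smul_comm, smul_smul, mul_assoc,
          MonoidAlgebra.single_mul_single, mul_one]
  have hΘ0 : ∀ k, Θ (MonoidAlgebra.of K Q' (π k) - 1) = v k := by
    intro k
    rw [map_sub, MonoidAlgebra.one_def, MonoidAlgebra.of_apply, hΘ1, hΘ1]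
    simp [π, mul_assoc, MonoidAlgebra.single_mul_single, ← MonoidAlgebra.one_def]
  have hpr : ∀ x, pr (MonoidAlgebra.mapDomainRingHom K (FreeGroup.lift π) x) =
      MonoidAlgebra.mapDomainRingHom K φ x := by
    have : (AffineGroup.rightHom ψ).comp (FreeGroup.lift π) = φ := by
      ext k
      simp [π, AffineGroup.rightHom]
    intro x
    rw [← this]
    induction x using MonoidAlgebra.induction_linear with
    | zero => simp
    | add x y hx hy => rw [map_add, map_add, map_add, hx, hy]
    | single g r => simp [pr]
  have hfox : ∀ i, Θ (MonoidAlgebra.mapDomainRingHom K (FreeGroup.lift π) (fox K i u)) = 0 := by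
    intro i
    rw [hA, map_sum, map_sum, ← hv i]
    refine Finset.sum_congr rfl fun k _ => ?_
    rw [map_mul, hΘ, hpr, map_sub, map_one]
    have h1 : MonoidAlgebra.mapDomainRingHom K (FreeGroup.lift π)
        (MonoidAlgebra.of K _ (FreeGroup.of k)) = MonoidAlgebra.of K Q' (π k) := by simp
    rw [h1, hΘ0, map_sub, augmentation_of, map_one, sub_self, zero_smul, add_zero]
  ext1 l
  obtain ⟨b, hb⟩ := hr Q' hQ' π l
  rw [← hΘ0, ← hb, foxMap, rightComb_apply, map_sum]
  refine Finset.sum_eq_zero fun i _ => ?_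
  rw [hΘ, hfox, zero_mul, augmentation_mapDomain, hu, zero_smul, add_zero]

/-- If every `x - 1` is a right combination of the images of the Fox derivatives of `u` in all
finite solvable quotients, then this also holds in the group algebra of the free group. -/
theorem sub_one_mem_range_of_foxMap [Nontrivial β] {u : FreeGroup β}
    (hu : ∀ i, augmentation K _ (fox K i u) = 0)
    (hr : ∀ (Q : Type) [Group Q] [Finite Q], Group.IsSolvable Q → ∀ π : β → Q, ∀ l,
      MonoidAlgebra.of K Q (π l) - 1 ∈ (foxMap K u π).range) (l : β) :
    MonoidAlgebra.of K _ (FreeGroup.of l) - 1 ∈ (rightComb fun i => fox K i u).range := by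
  choose A hA using fun i => mem_range_rightComb_of_augmentation_eq_zero (hu i)
  obtain ⟨C, hC⟩ := exists_right_inverse_of_finite_quotients
    (A := fun k i => A i k) (eq_zero_of_range_foxMap hu hr fun i => (hA i).symm)
  refine ⟨fun i => C i l, ?_⟩
  simp only [rightComb_apply, ← hA, Finset.sum_mul, mul_assoc]
  rw [Finset.sum_comm]
  simp only [← Finset.mul_sum, hC, mul_ite, mul_one, mul_zero, Finset.sum_ite_eq',
    Finset.mem_univ, if_true]

end Regularity

section SurfaceRelator

variable {K : Type} [Field K] {d : ℕ} {Q : Type} [Group Q]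

theorem mem_congruenceSubgroup_orientableRelator (π : Fin d × Bool → Q) (i : Fin d × Bool) :
    π i ∈ congruenceSubgroup (MonoidAlgebra.of K Q) fun i =>
      MonoidAlgebra.mapDomainRingHom K (FreeGroup.lift π) (fox K i (orientableRelator d)) := by
  set S := congruenceSubgroup (MonoidAlgebra.of K Q) fun i =>
      MonoidAlgebra.mapDomainRingHom K (FreeGroup.lift π) (fox K i (orientableRelator d))
  set J := (rightComb fun i => MonoidAlgebra.mapDomainRingHom K (FreeGroup.lift π)
    (fox K i (orientableRelator d))).range with hJ
  let φ : FreeGroup (Fin d × Bool) →* MonoidAlgebra K Q :=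
    (MonoidAlgebra.of K Q).comp (FreeGroup.lift π)
  let r : Fin d → FreeGroup (Fin d × Bool) := fun i =>
    ⁅FreeGroup.of (i, false), FreeGroup.of (i, true)⁆
  have hφ : ∀ i, φ (FreeGroup.of i) = MonoidAlgebra.of K Q (π i) := fun i => by simp [φ]
  have main : ∀ (l : List (Fin d)) (P : FreeGroup (Fin d × Bool)), l.Nodup →
      FreeGroup.lift π P ∈ S →
      (∀ δ : FreeGroup (Fin d × Bool) → MonoidAlgebra K Q, IsCrossedHom φ δ →
        (∀ i, i.1 ∉ l → δ (FreeGroup.of i) = 0) → φ P * δ (l.map r).prod ∈ J) →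
      ∀ i ∈ l, ∀ b, π (i, b) ∈ S := by
    intro l
    induction l with
    | nil => simp
    | cons k l ih =>
      intro P hl hP h
      obtain ⟨hk, hl⟩ := List.nodup_cons.1 hl
      have hrest : ∀ δ : FreeGroup (Fin d × Bool) → MonoidAlgebra K Q, IsCrossedHom φ δ →
          (∀ i, i.1 ≠ k → δ (FreeGroup.of i) = 0) → δ (l.map r).prod = 0 := by
        intro δ hδ h0
        have : ∀ l' : List (Fin d), k ∉ l' → δ (l'.map r).prod = 0 := by
          intro l'
          induction l' with
          | nil => exact fun _ => hδ.map_one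
          | cons j l' ih' =>
            intro hj
            rw [List.mem_cons, not_or] at hj
            rw [List.map_cons, List.prod_cons, hδ, ih' hj.2, mul_zero, add_zero, hδ.map_commutator,
              h0 _ (Ne.symm hj.1), h0 _ (Ne.symm hj.1), mul_zero, mul_zero, add_zero]
        exact this l hk
      have hval : ∀ b : Bool, ∃ δ : FreeGroup (Fin d × Bool) → MonoidAlgebra K Q,
          IsCrossedHom φ δ ∧ δ (FreeGroup.of (k, b)) = 1 ∧ δ (FreeGroup.of (k, !b)) = 0 ∧
          φ P * δ (r k) ∈ J := by
        intro b
        obtain ⟨δ, hδ, hδ1⟩ := exists_isCrossedHom φ (Pi.single (k, b) 1)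
        refine ⟨δ, hδ, by simp [hδ1], by simp [hδ1], ?_⟩
        have := h δ hδ fun i hi => by
          rw [hδ1, Pi.single_apply, if_neg]
          rintro rfl
          exact hi List.mem_cons_self
        rwa [List.map_cons, List.prod_cons, hδ, hrest δ hδ fun i hi => by
          rw [hδ1, Pi.single_apply, if_neg]
          rintro rfl
          exact hi rfl, mul_zero, add_zero] at this
      have hxyx : φ P - φ (P * (FreeGroup.of (k, false) * FreeGroup.of (k, true) *
          (FreeGroup.of (k, false))⁻¹)) ∈ J := by
        obtain ⟨δ, hδ, h1, h0, hm⟩ := hval false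
        rw [hδ.map_commutator, h1] at hm
        rw [Bool.not_false] at h0
        rw [h0] at hm
        rw [map_mul φ P]
        simpa [mul_sub] using hm
      have hxy : φ (P * FreeGroup.of (k, false)) - φ (P * r k) ∈ J := by
        obtain ⟨δ, hδ, h1, h0, hm⟩ := hval true
        rw [hδ.map_commutator, h1] at hm
        rw [Bool.not_true] at h0
        rw [h0] at hm
        rw [map_mul φ P, map_mul φ P]
        simpa [mul_sub] using hm
      have h1 := mem_congruenceSubgroup_of_mem hP hxyx
      have h1' := (S.mul_mem_cancel_left hP).1 (by rwa [map_mul] at h1)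
      have h2 : FreeGroup.lift π (P * (FreeGroup.of (k, false) * FreeGroup.of (k, true))) ∈ S := by
        refine mem_congruenceSubgroup_of_mem h1 ?_
        have := neg_mem (mul_mem_range_rightComb hxy (φ (FreeGroup.of (k, true))))
        rw [sub_mul, ← map_mul, ← map_mul] at this
        convert this using 1
        rw [neg_sub]
        change φ _ - φ _ = _
        congr 2
        · simp only [r, commutatorElement_def]
          group
        · group
      have h2' := (S.mul_mem_cancel_left hP).1 (by rwa [map_mul] at h2)
      have hx : π (k, false) ∈ S := by
        have := S.mul_mem (S.inv_mem h1') h2'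
        rw [← map_inv, ← map_mul] at this
        simpa [mul_assoc] using this
      have hy : π (k, true) ∈ S := by
        rw [map_mul, FreeGroup.lift_apply_of, FreeGroup.lift_apply_of] at h2'
        exact (S.mul_mem_cancel_left hx).1 h2'
      have hPr : FreeGroup.lift π (P * r k) ∈ S := by
        rw [map_mul]
        refine S.mul_mem hP ?_
        simp only [r, commutatorElement_def, map_mul, map_inv, FreeGroup.lift_apply_of]
        exact S.mul_mem (S.mul_mem (S.mul_mem hx hy) (S.inv_mem hx)) (S.inv_mem hy)
      intro i hi b
      rcases List.mem_cons.1 hi with rfl | hi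
      · cases b
        · exact hx
        · exact hy
      · refine ih (P * r k) hl hPr (fun δ hδ h0 => ?_) i hi b
        have := h δ hδ fun i hi => h0 i fun h => hi (List.mem_cons_of_mem _ h)
        rwa [List.map_cons, List.prod_cons, hδ, hδ.map_commutator, h0 _ hk, h0 _ hk, mul_zero,
          mul_zero, zero_add, zero_add, ← mul_assoc, ← map_mul] at this
  refine main (List.finRange d) 1 (List.nodup_finRange d) (by rw [map_one]; exact S.one_mem)
    (fun δ hδ _ => ?_) i.1 (List.mem_finRange _) i.2
  rw [map_one, one_mul, ← List.ofFn_eq_map]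
  exact ⟨_, (hδ.eq_rightComb_mapDomain _ _).symm⟩

theorem range_foxMap_orientableRelator (π : Fin d × Bool → Q) :
    (rightComb fun i => MonoidAlgebra.of K Q (π i) - 1).range ≤
      (foxMap K (orientableRelator d) π).range :=
  range_rightComb_le fun i => mem_congruenceSubgroup_orientableRelator π i

theorem sub_one_mem_range_of_measureEquivIn [Finite K] (hd : 1 ≤ d)
    {u : FreeGroup (Fin d × Bool)} (h : ∀ (Q : Type) [Group Q] [Finite Q], Group.IsSolvable Q →
      MeasureEquivIn (orientableRelator d) u Q) :
    (∀ f : FreeGroup (Fin d × Bool) →* Multiplicative K, f u = 1) ∧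
      ∀ l, MonoidAlgebra.of K _ (FreeGroup.of l) - 1 ∈ (rightComb fun i => fox K i u).range := by
  have hu : ∀ f : FreeGroup (Fin d × Bool) →* Multiplicative K, f u = 1 := by
    refine (h (Multiplicative K) inferInstance).map_eq_one fun f => ?_
    rw [orientableRelator, map_list_prod]
    refine List.prod_eq_one fun x hx => ?_
    obtain ⟨y, hy, rfl⟩ := List.mem_map.1 hx
    obtain ⟨i, rfl⟩ := List.mem_ofFn.1 hy
    rw [map_commutatorElement, commutatorElement_eq_one_iff_mul_comm, mul_comm]
  have : Nontrivial (Fin d × Bool) := ⟨(⟨0, hd⟩, false), (⟨0, hd⟩, true), by simp⟩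
  have hu' := augmentation_fox_eq_zero hu
  refine ⟨hu, sub_one_mem_range_of_foxMap hu' fun Q _ _ hQ π l => ?_⟩
  have hfin := MonoidAlgebra.finite (K := K) (Q := Q)
  rw [foxMap_range_eq (h _ AffineGroup.isSolvable) hu' range_foxMap_orientableRelator]
  exact mem_range_rightComb_self _ l

end SurfaceRelator

section SurfaceLike

variable {K : Type*} [Field K] {β : Type*}

/-- The homological conditions satisfied by the surface relator: it is trivial in the abelianization
with coefficients in `K`, and a functional on the group algebra that vanishes on its values under
all derivations is constant on the group. -/
structure IsSurfaceLike (K : Type*) [Field K] {β : Type*} (u : FreeGroup β) : Prop where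
  /-- Additive functions vanish at the word. -/
  map_eq_zero : ∀ f : FreeGroup β → K, (∀ g h, f (g * h) = f g + f h) → f u = 0
  /-- Functionals that vanish on the derivations of the word are constant. -/
  const_of_vanish : ∀ c : MonoidAlgebra K (FreeGroup β) →ₗ[K] K,
    (∀ δ, IsCrossedHom (MonoidAlgebra.of K (FreeGroup β)) δ → c (δ u) = 0) →
      ∀ g, c (MonoidAlgebra.of K _ g) = c 1

theorem isSurfaceLike_of_sub_one_mem_range [Fintype β] [DecidableEq β] {u : FreeGroup β}
    (hu : ∀ f : FreeGroup β →* Multiplicative K, f u = 1)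
    (hm : ∀ l, MonoidAlgebra.of K _ (FreeGroup.of l) - 1 ∈
      (rightComb fun i => fox K i u).range) : IsSurfaceLike K u := by
  refine ⟨fun f hf => ?_, fun c hc g => ?_⟩
  · let f' : FreeGroup β →* Multiplicative K :=
      MonoidHom.mk' (fun g => Multiplicative.ofAdd (f g)) fun g h => by rw [hf]; rfl
    exact hu f'
  · have hcr : ∀ l x, c (MonoidAlgebra.of K _ (FreeGroup.of l) * x) = c x := by
      intro l x
      obtain ⟨b, hb⟩ := mul_mem_range_rightComb (hm l) x
      rw [← sub_eq_zero, ← map_sub, ← sub_one_mul, ← hb, rightComb_apply, map_sum]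
      exact Finset.sum_eq_zero fun i _ => hc _ ((isCrossedHom_fox K i).mul_right (b i))
    have : ∀ g x, c (MonoidAlgebra.of K _ g * x) = c x := by
      intro g
      induction g using FreeGroup.induction_on with
      | C1 => intro x; rw [_root_.map_one, one_mul]
      | of l => exact hcr l
      | inv_of l _ =>
        intro x
        rw [← hcr l, ← mul_assoc, ← (MonoidAlgebra.of K (FreeGroup β)).map_mul, mul_inv_cancel,
          _root_.map_one, one_mul]
      | mul g h hg hh => intro x; rw [(MonoidAlgebra.of K (FreeGroup β)).map_mul, mul_assoc, hg, hh]
    simpa using this g 1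

namespace IsSurfaceLike

variable {u : FreeGroup β}

theorem map (hu : IsSurfaceLike K u) (φ : FreeGroup β ≃* FreeGroup β) :
    IsSurfaceLike K (φ u) := by
  refine ⟨fun f hf => hu.map_eq_zero (fun g => f (φ g)) fun g h => by rw [_root_.map_mul, hf],
    fun c hc g => ?_⟩
  let Φ := MonoidAlgebra.domCongr K K φ
  have hΦ : ∀ g, Φ (MonoidAlgebra.of K _ g) = MonoidAlgebra.of K _ (φ g) := fun g => by
    simp [Φ, MonoidAlgebra.of]
  have := hu.const_of_vanish (c ∘ₗ Φ.toLinearMap) (fun δ hδ => ?_) (φ.symm g)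
  · change c (Φ _) = c (Φ 1) at this
    rwa [hΦ, φ.apply_symm_apply, _root_.map_one] at this
  · have := hc (fun g => Φ (δ (φ.symm g))) fun g h => by
      simp only [_root_.map_mul, hδ _ _, _root_.map_add, hΦ, φ.apply_symm_apply]
    simpa using this

/-- For every nonzero additive function `e`, some quadratic function with polarization of the form
`e g * E h` does not vanish at a surface-like word. -/
theorem exists_quadratic (hu : IsSurfaceLike K u) {e : FreeGroup β → K}
    (he : ∀ g h, e (g * h) = e g + e h) {g₀ : FreeGroup β} (hg₀ : e g₀ ≠ 0) :
    ∃ D E : FreeGroup β → K, (∀ g h, E (g * h) = E g + E h) ∧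
      (∀ g h, D (g * h) = D g + D h + e g * E h) ∧ D u ≠ 0 := by
  by_contra! H
  let c : MonoidAlgebra K (FreeGroup β) →ₗ[K] K :=
    Finsupp.linearCombination K e ∘ₗ (MonoidAlgebra.coeffLinearEquiv K).toLinearMap
  have hcs : ∀ g r, c (MonoidAlgebra.single g r) = r * e g := fun g r => by simp [c]
  have hc : ∀ g x, c (MonoidAlgebra.of K _ g * x) = c x + e g * augmentation K _ x := by
    intro g x
    induction x using MonoidAlgebra.induction_linear with
    | zero => simp
    | add x y hx hy => rw [mul_add, map_add, map_add, map_add, hx, hy]; ring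
    | single h r =>
      rw [MonoidAlgebra.of_apply, MonoidAlgebra.single_mul_single, hcs, hcs, augmentation_single,
        he]
      ring
  have h1 : e 1 = 0 := by simpa using he 1 1
  have := hu.const_of_vanish c (fun δ hδ => ?_) g₀
  · rw [MonoidAlgebra.of_apply, MonoidAlgebra.one_def, hcs, hcs, h1] at this
    simp [hg₀] at this
  · refine H (fun g => c (δ g)) (fun g => augmentation K _ (δ g)) (fun g h => ?_) fun g h => ?_
    · rw [hδ, map_add, _root_.map_mul, augmentation_of, one_mul]
    · rw [hδ, map_add, hc]; ring

end IsSurfaceLike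

end SurfaceLike

section Letters

variable {β : Type*}

/-- The inverse of a letter. -/
def flipLetter (x : β × Bool) : β × Bool := (x.1, !x.2)

@[simp] theorem flipLetter_fst (x : β × Bool) : (flipLetter x).1 = x.1 := rfl

@[simp] theorem flipLetter_snd (x : β × Bool) : (flipLetter x).2 = !x.2 := rfl

@[simp] theorem flipLetter_flipLetter (x : β × Bool) : flipLetter (flipLetter x) = x := by
  simp [flipLetter]

theorem flipLetter_ne (x : β × Bool) : flipLetter x ≠ x := fun h => by
  simpa using congrArg Prod.snd h

theorem flipLetter_eq_iff {x y : β × Bool} : flipLetter x = y ↔ x = flipLetter y :=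
  ⟨fun h => by rw [← h, flipLetter_flipLetter], fun h => by rw [h, flipLetter_flipLetter]⟩

theorem fst_eq_iff {x y : β × Bool} : x.1 = y.1 ↔ x = y ∨ x = flipLetter y := by
  obtain ⟨i, b⟩ := x
  obtain ⟨j, c⟩ := y
  cases b <;> cases c <;> simp [flipLetter]

/-- The element of the free group represented by a letter. -/
def letterVal (x : β × Bool) : FreeGroup β := FreeGroup.mk [x]

theorem letterVal_true (i : β) : letterVal (i, true) = FreeGroup.of i := rfl

theorem letterVal_false (i : β) : letterVal (i, false) = (FreeGroup.of i)⁻¹ := rfl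

@[simp] theorem letterVal_flipLetter (x : β × Bool) :
    letterVal (flipLetter x) = (letterVal x)⁻¹ := by
  simp [letterVal, FreeGroup.inv_mk, FreeGroup.invRev, flipLetter]

theorem mk_cons (x : β × Bool) (l : List (β × Bool)) :
    FreeGroup.mk (x :: l) = letterVal x * FreeGroup.mk l := by
  rw [letterVal, FreeGroup.mul_mk, List.singleton_append]

theorem mk_append (l l' : List (β × Bool)) :
    FreeGroup.mk (l ++ l') = FreeGroup.mk l * FreeGroup.mk l' := FreeGroup.mul_mk.symm

theorem mk_nil : FreeGroup.mk ([] : List (β × Bool)) = 1 := rfl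

theorem mk_eq_prod (l : List (β × Bool)) : FreeGroup.mk l = (l.map letterVal).prod := by
  induction l with
  | nil => rfl
  | cons x l ih => rw [mk_cons, ih, List.map_cons, List.prod_cons]

/-- A list of letters is inverse-closed. -/
def InvClosed (l : List (β × Bool)) : Prop := ∀ x ∈ l, flipLetter x ∈ l

variable {K : Type*} [Field K]

theorem InvClosed.sum_eq_zero [DecidableEq β] {l : List (β × Bool)} (hl : InvClosed l)
    (hn : l.Nodup) {f : β × Bool → K} (hf : ∀ x ∈ l, f (flipLetter x) = -f x) :
    (l.map f).sum = 0 := by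
  rw [← List.sum_toFinset f hn]
  refine Finset.sum_involution (fun x _ => flipLetter x) (fun x hx => ?_)
    (fun x _ _ => flipLetter_ne x) (fun x hx => ?_) fun x _ => flipLetter_flipLetter x
  · rw [hf x (List.mem_toFinset.1 hx), add_neg_cancel]
  · exact List.mem_toFinset.2 (hl x (List.mem_toFinset.1 hx))

/-- The additive function on a free group with prescribed values at the generators. -/
def addFun (v : β → K) (g : FreeGroup β) : K :=
  (FreeGroup.lift (fun i => Multiplicative.ofAdd (v i)) g).toAdd

theorem addFun_mul (v : β → K) (g h : FreeGroup β) :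
    addFun v (g * h) = addFun v g + addFun v h := by
  simp [addFun]

@[simp] theorem addFun_of (v : β → K) (i : β) : addFun v (FreeGroup.of i) = v i := by
  simp [addFun]

section Additive

variable {f : FreeGroup β → K} (hf : ∀ g h, f (g * h) = f g + f h)

include hf

theorem additive_one : f 1 = 0 := by simpa using hf 1 1

theorem additive_inv (g : FreeGroup β) : f g⁻¹ = -f g := by
  have := hf g g⁻¹
  rw [mul_inv_cancel, additive_one hf] at this
  exact eq_neg_of_add_eq_zero_right this.symm

theorem additive_mk (l : List (β × Bool)) :
    f (FreeGroup.mk l) = (l.map fun x => f (letterVal x)).sum := by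
  induction l with
  | nil => rw [mk_nil, additive_one hf]; rfl
  | cons x l ih => rw [mk_cons, hf, ih, List.map_cons, List.sum_cons]

theorem additive_mk_eq_zero [DecidableEq β] {l : List (β × Bool)} (hl : InvClosed l)
    (hn : l.Nodup) : f (FreeGroup.mk l) = 0 := by
  rw [additive_mk hf]
  exact hl.sum_eq_zero hn fun x _ => by rw [letterVal_flipLetter, additive_inv hf]

end Additive

section Quadratic

variable {e D E : FreeGroup β → K} (he : ∀ g h, e (g * h) = e g + e h)
  (hE : ∀ g h, E (g * h) = E g + E h) (hD : ∀ g h, D (g * h) = D g + D h + e g * E h)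

include hE hD

theorem quadratic_one : D 1 = 0 := by
  simpa [additive_one hE] using hD 1 1

theorem quadratic_inv {g : FreeGroup β} (hg : e g = 0) : D g⁻¹ = -D g := by
  have := hD g g⁻¹
  rw [mul_inv_cancel, quadratic_one hE hD, hg, zero_mul, add_zero] at this
  exact eq_neg_of_add_eq_zero_right this.symm

include he

theorem quadratic_commutator {g h : FreeGroup β} (hg : e g = 0) (hh : e h = 0) :
    e ⁅g, h⁆ = 0 ∧ D ⁅g, h⁆ = 0 := by
  rw [commutatorElement_def]
  simp only [he, hD, additive_inv he, quadratic_inv hE hD hg, quadratic_inv hE hD hh, hg, hh]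
  constructor <;> ring

theorem quadratic_prod_commutator {l : List ((β × Bool) × (β × Bool))}
    (hl : ∀ p ∈ l, e (letterVal p.1) = 0 ∧ e (letterVal p.2) = 0) :
    e (l.map fun p => ⁅letterVal p.1, letterVal p.2⁆).prod = 0 ∧
      D (l.map fun p => ⁅letterVal p.1, letterVal p.2⁆).prod = 0 := by
  induction l with
  | nil => exact ⟨additive_one he, quadratic_one hE hD⟩
  | cons p l ih =>
    obtain ⟨h1, h2⟩ := ih fun q hq => hl q (List.mem_cons_of_mem _ hq)
    obtain ⟨h3, h4⟩ := hl p List.mem_cons_self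
    obtain ⟨h5, h6⟩ := quadratic_commutator he hE hD h3 h4
    rw [List.map_cons, List.prod_cons, he, hD, h1, h2, h5, h6]
    simp

theorem quadratic_mk {l : List (β × Bool)} (hl : ∀ x ∈ l, e (letterVal x) = 0) :
    e (FreeGroup.mk l) = 0 ∧ D (FreeGroup.mk l) = (l.map fun x => D (letterVal x)).sum := by
  induction l with
  | nil => exact ⟨additive_one he, quadratic_one hE hD⟩
  | cons x l ih =>
    obtain ⟨h1, h2⟩ := ih fun y hy => hl y (List.mem_cons_of_mem _ hy)
    rw [mk_cons, he, hD, h1, h2, hl x List.mem_cons_self]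
    simp

theorem quadratic_mk_eq_zero [DecidableEq β] {l : List (β × Bool)} (hc : InvClosed l)
    (hn : l.Nodup) (hl : ∀ x ∈ l, e (letterVal x) = 0) :
    e (FreeGroup.mk l) = 0 ∧ D (FreeGroup.mk l) = 0 := by
  refine ⟨(quadratic_mk he hE hD hl).1, (quadratic_mk he hE hD hl).2.trans ?_⟩
  exact hc.sum_eq_zero hn fun x hx => by
    rw [letterVal_flipLetter, quadratic_inv hE hD (hl x hx)]

end Quadratic

variable [DecidableEq β] {u : FreeGroup β}

theorem addFun_single_eq_zero {i : β} {x : β × Bool} (hx : x.1 ≠ i) :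
    addFun (Pi.single i (1 : K)) (letterVal x) = 0 := by
  obtain ⟨j, b⟩ := x
  have : addFun (Pi.single i (1 : K)) (FreeGroup.of j) = 0 := by simp_all
  cases b
  · rw [letterVal_false, additive_inv (addFun_mul _), this, neg_zero]
  · rw [letterVal_true, this]

/-- Every generator occurs in a surface-like word. -/
theorem IsSurfaceLike.exists_mem (hu : IsSurfaceLike K u) {l : List (β × Bool)}
    (hl : u = FreeGroup.mk l) (i : β) : ∃ x ∈ l, x.1 = i := by
  by_contra! H
  have he := addFun_mul (Pi.single i (1 : K))
  obtain ⟨D, E, hE, hD, h⟩ := hu.exists_quadratic he (g₀ := FreeGroup.of i) (by simp)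
  refine h ?_
  have hf := addFun_mul fun j => D (FreeGroup.of j)
  rw [hl, (quadratic_mk he hE hD fun x hx => addFun_single_eq_zero (H x hx)).2,
    ← hu.map_eq_zero _ hf, hl, additive_mk hf]
  congr 1
  refine List.map_congr_left fun x hx => ?_
  have hx := addFun_single_eq_zero (K := K) (H x hx)
  obtain ⟨j, b⟩ := x
  cases b
  · rw [letterVal_false, additive_inv he, neg_eq_zero] at hx
    rw [letterVal_false, quadratic_inv hE hD hx, additive_inv hf, addFun_of]
  · rw [letterVal_true, addFun_of]

/-- In a surface-like word that is a product of commutators and of a list of distinct letters, a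
letter and its inverse always separate another such pair. -/
theorem IsSurfaceLike.not_invClosed (hu : IsSurfaceLike K u)
    {ps : List ((β × Bool) × (β × Bool))} {a : β × Bool} {R₁ R₂ : List (β × Bool)}
    (hl : u = (ps.map fun p => ⁅letterVal p.1, letterVal p.2⁆).prod *
      FreeGroup.mk (a :: R₁ ++ flipLetter a :: R₂))
    (hps : ∀ p ∈ ps, p.1.1 ≠ a.1 ∧ p.2.1 ≠ a.1)
    (hn : (a :: R₁ ++ flipLetter a :: R₂).Nodup)
    (hc : InvClosed (a :: R₁ ++ flipLetter a :: R₂)) : ¬ InvClosed R₁ := by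
  intro hR₁
  obtain ⟨⟨ha₁, ha₂⟩, hn₁, ⟨ha₃, hn₂⟩, hd⟩ : (a ∉ R₁ ∧ a ∉ flipLetter a :: R₂) ∧ R₁.Nodup ∧
      (flipLetter a ∉ R₂ ∧ R₂.Nodup) ∧ ∀ x ∈ R₁, ∀ y ∈ flipLetter a :: R₂, x ≠ y := by
    rwa [List.cons_append, List.nodup_cons, List.nodup_append, List.mem_append, not_or,
      List.nodup_cons] at hn
  have hmem : ∀ x ∈ R₁ ++ R₂, x.1 ≠ a.1 := by
    intro x hx h
    rw [List.mem_append] at hx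
    rcases fst_eq_iff.1 h with rfl | rfl
    · exact hx.elim ha₁ fun h => ha₂ (List.mem_cons_of_mem _ h)
    · exact hx.elim (fun h => hd _ h _ List.mem_cons_self rfl) ha₃
  have hR₂ : InvClosed R₂ := by
    intro x hx
    have h1 := hc x (by simp [hx])
    have h2 := hmem x (by simp [hx])
    have h3 : flipLetter x ≠ a := fun h => h2 (by rw [← h]; rfl)
    have h5 : flipLetter x ≠ flipLetter a := fun h => h2 (by
      rw [← flipLetter_fst x, h, flipLetter_fst])
    have h6 : flipLetter x ∉ R₁ := fun h => by
      have h7 := hR₁ _ h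
      rw [flipLetter_flipLetter] at h7
      exact hd x h7 x (List.mem_cons_of_mem _ hx) rfl
    simp only [List.cons_append, List.mem_cons, List.mem_append] at h1
    tauto
  have he := addFun_mul (Pi.single a.1 (1 : K))
  obtain ⟨D, E, hE, hD, h⟩ := hu.exists_quadratic he (g₀ := FreeGroup.of a.1) (by simp)
  refine h ?_
  obtain ⟨h1, h2⟩ := quadratic_prod_commutator he hE hD (l := ps) fun p hp =>
    ⟨addFun_single_eq_zero (hps p hp).1, addFun_single_eq_zero (hps p hp).2⟩
  obtain ⟨h3, h4⟩ := quadratic_mk_eq_zero he hE hD hR₁ hn₁ fun x hx =>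
    addFun_single_eq_zero (hmem x (by simp [hx]))
  obtain ⟨-, h6⟩ := quadratic_mk_eq_zero he hE hD hR₂ hn₂ fun x hx =>
    addFun_single_eq_zero (hmem x (by simp [hx]))
  have h7 := additive_mk_eq_zero hE hR₁ hn₁
  have h8 := additive_mk_eq_zero hE hR₂ hn₂
  have h9 := quadratic_one hE hD
  rw [← mul_inv_cancel (letterVal a), hD] at h9
  rw [hl, mk_append, mk_cons, mk_cons, letterVal_flipLetter]
  simp only [hD, hE, he, h1, h2, h3, h4, h6, h7, h8]
  linear_combination h9

end Letters

section CyclicWords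

variable {β : Type*} {L : ℕ}

/-- The product of the first letters of a cyclic word. -/
def initialProd (w : ZMod L → β × Bool) (n : ℕ) : FreeGroup β :=
  ((List.range n).map fun j : ℕ => letterVal (w j)).prod

theorem initialProd_succ (w : ZMod L → β × Bool) (n : ℕ) :
    initialProd w (n + 1) = initialProd w n * letterVal (w n) := by
  simp [initialProd, List.range_succ]

variable [DecidableEq β]

theorem toWord_letterVal_mul (x : β × Bool) (g : FreeGroup β) :
    (letterVal x * g).toWord = x :: g.toWord ∨
      g.toWord = flipLetter x :: (letterVal x * g).toWord := by
  have : (letterVal x * g).toWord = FreeGroup.reduce (x :: g.toWord) := by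
    conv_lhs => rw [← FreeGroup.mk_toWord (x := g), ← mk_cons, FreeGroup.toWord_mk]
  rw [this, FreeGroup.reduce.cons, FreeGroup.reduce_toWord]
  cases h : g.toWord with
  | nil => exact Or.inl rfl
  | cons y l =>
    dsimp only
    split_ifs with hxy
    · refine Or.inr ?_
      congr 1
      ext <;> simp [hxy]
    · exact Or.inl rfl

variable {K : Type*} [Field K] [NeZero L]

/-- Removing the letter `a` does not disconnect the Whitehead graph of a cyclic word. -/
def NoCut (w : ZMod L → β × Bool) (a : β × Bool) : Prop :=
  ∀ A : β × Bool → Prop, (∀ j, flipLetter (w (j - 1)) ≠ a → w j ≠ a →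
    (A (flipLetter (w (j - 1))) ↔ A (w j))) → ∀ x y, x ≠ a → y ≠ a → A x → A y

/-- The boundary map of the Whitehead graph of a cyclic word. -/
def whiteheadBoundary (K : Type*) [Field K] (w : ZMod L → β × Bool) :
    (ZMod L → K) →ₗ[K] (β × Bool → K) :=
  Fintype.linearCombination K fun j => Pi.single (w j) 1 - Pi.single (flipLetter (w (j - 1))) 1

variable (w : ZMod L → β × Bool)

theorem whiteheadBoundary_apply (z : ZMod L → K) (y : β × Bool) :
    whiteheadBoundary K w z y = (∑ j, if w j = y then z j else 0) -
      ∑ j, if w j = flipLetter y then z (j + 1) else 0 := by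
  have : (∑ j, if w j = flipLetter y then z (j + 1) else 0) =
      ∑ j, if flipLetter (w (j - 1)) = y then z j else 0 :=
    Fintype.sum_equiv (Equiv.addRight 1) _ _ fun j => by
      simp only [Equiv.coe_addRight, add_sub_cancel_right, flipLetter_eq_iff]
  rw [this, ← Finset.sum_sub_distrib, whiteheadBoundary, Fintype.linearCombination_apply,
    Finset.sum_apply]
  refine Finset.sum_congr rfl fun j _ => ?_
  simp only [Pi.smul_apply, Pi.sub_apply, Pi.single_apply, smul_eq_mul, eq_comm (a := y)]
  split_ifs <;> simp

theorem apply_whiteheadBoundary (f : (β × Bool → K) →ₗ[K] K) (z : ZMod L → K) :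
    f (whiteheadBoundary K w z) =
      ∑ j, z j * (f (Pi.single (w j) 1) - f (Pi.single (flipLetter (w (j - 1))) 1)) := by
  simp [whiteheadBoundary, Fintype.linearCombination_apply]

variable [Fintype β]

theorem sum_whiteheadBoundary (z : ZMod L → K) : ∑ y, whiteheadBoundary K w z y = 0 := by
  have := apply_whiteheadBoundary w (∑ y, LinearMap.proj y) z
  simpa using this

theorem linearMap_pi_apply (f : (β × Bool → K) →ₗ[K] K) (v : β × Bool → K) :
    f v = ∑ y, v y * f (Pi.single y 1) := by
  conv_lhs => rw [← Finset.univ_sum_single v]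
  rw [map_sum]
  refine Finset.sum_congr rfl fun y _ => ?_
  rw [← smul_eq_mul, ← map_smul, ← Pi.single_smul, smul_eq_mul, mul_one]

/-- A long cyclic word has a nonconstant circulation. -/
theorem exists_circulation (hL : Fintype.card (β × Bool) < L) :
    ∃ z : ZMod L → K, z ≠ 0 ∧ z 0 = 0 ∧ whiteheadBoundary K w z = 0 := by
  let T : (ZMod L → K) →ₗ[K] (β × Bool → K) := LinearMap.pi fun y =>
    if y = w 0 then LinearMap.proj 0 else LinearMap.proj y ∘ₗ whiteheadBoundary K w
  have hT : LinearMap.ker T ≠ ⊥ := 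
    LinearMap.ker_ne_bot_of_finrank_lt (by simpa [ZMod.card] using hL)
  obtain ⟨z, hz, hz0⟩ := Submodule.exists_mem_ne_zero_of_ne_bot hT
  have h1 : ∀ y, T z y = 0 := fun y => by rw [LinearMap.mem_ker.1 hz]; rfl
  have h2 : ∀ y, y ≠ w 0 → whiteheadBoundary K w z y = 0 := fun y hy => by
    simpa [T, hy] using h1 y
  refine ⟨z, hz0, by simpa [T] using h1 (w 0), funext fun y => ?_⟩
  by_cases hy : y = w 0
  · rw [hy, Pi.zero_apply, ← sum_whiteheadBoundary w z, eq_comm]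
    exact Finset.sum_eq_single _ (fun y _ hy => h2 y hy) (by simp)
  · exact h2 y hy

variable {w}

/-- Circulations extend across a letter. -/
theorem exists_circulation_extension (hw : ∀ j, w (j + 1) ≠ flipLetter (w j)) {a : β × Bool}
    (ha : NoCut w (flipLetter a)) {z : ZMod L → K} (hz : whiteheadBoundary K w z = 0) :
    ∃ z' : ZMod L → K, whiteheadBoundary K w z' = 0 ∧ (∀ j, w j = a → z' (j + 1) = z j) ∧
      ∀ j, w j = flipLetter a → z' j = z (j + 1) := by
  let f : ZMod L → K := fun j => if w j = flipLetter a then z (j + 1) else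
    if w (j - 1) = a then z (j - 1) else 0
  let V : Submodule K (ZMod L → K) :=
    { carrier := {g | ∀ j, w j = flipLetter a ∨ w (j - 1) = a → g j = 0}
      add_mem' := fun hg hh j hj => by simp [hg j hj, hh j hj]
      zero_mem' := fun j _ => rfl
      smul_mem' := fun c g hg j hj => by simp [hg j hj] }
  have hf1 : ∀ j, w j = a → f (j + 1) = z j := fun j hj => by
    have := hw j
    rw [hj] at this
    simp [f, this, hj]
  have hf2 : ∀ j, w j = flipLetter a → f j = z (j + 1) := fun j hj => if_pos hj
  have hfa : whiteheadBoundary K w f (flipLetter a) = 0 := by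
    have := congrFun hz a
    rw [whiteheadBoundary_apply, Pi.zero_apply, sub_eq_zero] at this
    rw [whiteheadBoundary_apply, sub_eq_zero, flipLetter_flipLetter]
    refine Eq.trans ?_ (this.symm.trans ?_) <;> refine Finset.sum_congr rfl fun j _ => ?_
    · split_ifs with h
      · exact hf2 j h
      · rfl
    · split_ifs with h
      · exact (hf1 j h).symm
      · rfl
  have key : whiteheadBoundary K w f ∈ V.map (whiteheadBoundary K w) := by
    by_contra hv
    obtain ⟨F, hF, hV⟩ := Submodule.exists_le_ker_of_notMem hv
    refine hF ?_
    have hF' : ∀ j, flipLetter (w (j - 1)) ≠ flipLetter a → w j ≠ flipLetter a →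
        F (Pi.single (flipLetter (w (j - 1))) 1) = F (Pi.single (w j) 1) := by
      intro j h1 h2
      have h3 : (Pi.single j 1 : ZMod L → K) ∈ V := by
        rintro i (hi | hi) <;> refine Pi.single_eq_of_ne ?_ _ <;> rintro rfl
        · exact h2 hi
        · exact h1 (by rw [hi])
      have h4 := hV (Submodule.mem_map_of_mem h3)
      rw [LinearMap.mem_ker, apply_whiteheadBoundary,
        Finset.sum_eq_single j (fun i _ hi => by rw [Pi.single_eq_of_ne hi, zero_mul]) (by simp),
        Pi.single_eq_same, one_mul, sub_eq_zero] at h4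
      exact h4.symm
    have hF2 : ∀ y, y ≠ flipLetter a → F (Pi.single y 1) = F (Pi.single a 1) := fun y hy =>
      ha (fun y => F (Pi.single y 1) = F (Pi.single a 1))
        (fun j h1 h2 => by rw [hF' j h1 h2]) a y (flipLetter_ne a).symm hy rfl
    rw [linearMap_pi_apply F]
    have h5 : ∀ y, whiteheadBoundary K w f y * F (Pi.single y 1) =
        whiteheadBoundary K w f y * F (Pi.single a 1) := fun y => by
      by_cases hy : y = flipLetter a
      · rw [hy, hfa, zero_mul, zero_mul]
      · rw [hF2 y hy]
    rw [Finset.sum_congr rfl fun y _ => h5 y, ← Finset.sum_mul, sum_whiteheadBoundary, zero_mul]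
  obtain ⟨g, hg, hgf⟩ := key
  refine ⟨f - g, by rw [map_sub, hgf, sub_self], fun j hj => ?_, fun j hj => ?_⟩
  · rw [Pi.sub_apply, hf1 j hj, hg (j + 1) (Or.inr (by simpa using hj)), sub_zero]
  · rw [Pi.sub_apply, hf2 j hj, hg j (Or.inl hj), sub_zero]

/-- A circulation extends to an equivariant family of circulations indexed by the group. -/
theorem exists_circulation_family (hw : ∀ j, w (j + 1) ≠ flipLetter (w j))
    (hcut : ∀ a, NoCut w a) {z : ZMod L → K} (hz : whiteheadBoundary K w z = 0) :
    ∃ y : FreeGroup β → ZMod L → K, y 1 = z ∧ (∀ g, whiteheadBoundary K w (y g) = 0) ∧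
      ∀ g j, y (letterVal (w j) * g) j = y g (j + 1) := by
  let C := {z : ZMod L → K // whiteheadBoundary K w z = 0}
  have hext : ∀ (a : β × Bool) (z : C), ∃ z' : C, (∀ j, w j = a → z'.1 (j + 1) = z.1 j) ∧
      ∀ j, w j = flipLetter a → z'.1 j = z.1 (j + 1) := fun a z => by
    obtain ⟨z', h1, h2⟩ := exists_circulation_extension hw (hcut (flipLetter a)) z.2
    exact ⟨⟨z', h1⟩, h2⟩
  choose ext hext₁ hext₂ using hext
  let y : List (β × Bool) → C := fun l => l.foldr (fun b => ext (flipLetter b)) ⟨z, hz⟩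
  refine ⟨fun g => (y g.toWord).1, by simp [y], fun g => (y g.toWord).2, fun g j => ?_⟩
  dsimp only
  rcases toWord_letterVal_mul (w j) g with h | h
  · rw [h]
    exact hext₂ (flipLetter (w j)) _ j (by simp)
  · rw [h]
    refine (hext₁ (flipLetter (flipLetter (w j))) _ j (by simp)).symm

theorem sum_range_natCast {M : Type*} [AddCommMonoid M] (f : ZMod L → M) :
    ∑ j ∈ Finset.range L, f j = ∑ j, f j := by
  refine Finset.sum_bij (fun j _ => (j : ZMod L)) (by simp) (fun i hi j hj h => ?_)
    (fun j _ => ⟨j.val, by simpa using j.val_lt, by simp⟩) fun _ _ => rfl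
  have := congrArg ZMod.val h
  rwa [ZMod.val_natCast_of_lt (Finset.mem_range.1 hi),
    ZMod.val_natCast_of_lt (Finset.mem_range.1 hj)] at this

/-- A cyclically reduced surface-like word whose Whitehead graph has no cut vertices is short. -/
theorem IsSurfaceLike.le_card (hu : IsSurfaceLike K (initialProd w L))
    (hw : ∀ j, w (j + 1) ≠ flipLetter (w j)) (hcut : ∀ a, NoCut w a) :
    L ≤ Fintype.card (β × Bool) := by
  by_contra! hL
  obtain ⟨z, hz0, hz1, hz⟩ := exists_circulation (K := K) w hL
  obtain ⟨y, hy1, hy, hyw⟩ := exists_circulation_family hw hcut hz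
  let Y : MonoidAlgebra K (FreeGroup β) →ₗ[K] (ZMod L → K) :=
    Finsupp.linearCombination K y ∘ₗ (MonoidAlgebra.coeffLinearEquiv K).toLinearMap
  have hYs : ∀ g r, Y (MonoidAlgebra.single g r) = r • y g := fun g r => by simp [Y]
  have hYof : ∀ g, Y (MonoidAlgebra.of K _ g) = y g := fun g => by
    rw [MonoidAlgebra.of_apply, hYs, one_smul]
  have hY : ∀ v, whiteheadBoundary K w (Y v) = 0 := fun v => by
    induction v using MonoidAlgebra.induction_linear with
    | zero => simp
    | add v v' hv hv' => rw [map_add, map_add, hv, hv', add_zero]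
    | single g r => rw [hYs, map_smul, hy, smul_zero]
  have hYw : ∀ v j, Y (MonoidAlgebra.of K _ (letterVal (w j)) * v) j = Y v (j + 1) := by
    intro v j
    induction v using MonoidAlgebra.induction_linear with
    | zero => simp
    | add v v' hv hv' => rw [mul_add, map_add, map_add, Pi.add_apply, hv, hv', Pi.add_apply]
    | single g r =>
      rw [MonoidAlgebra.of_apply, MonoidAlgebra.single_mul_single, one_mul, hYs, hYs,
        Pi.smul_apply, hyw, Pi.smul_apply]
  have hYi : ∀ (n : ℕ) v, Y (MonoidAlgebra.of K _ (initialProd w n) * v) 0 = Y v n := by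
    intro n
    induction n with
    | zero => intro v; simp [initialProd, ← MonoidAlgebra.one_def]
    | succ n ih =>
      intro v
      rw [initialProd_succ, (MonoidAlgebra.of K (FreeGroup β)).map_mul, mul_assoc, ih, hYw,
        Nat.cast_succ]
  have hconst := hu.const_of_vanish (LinearMap.proj 0 ∘ₗ Y) fun δ hδ => ?_
  · refine hz0 (funext fun j => ?_)
    have h1 := hconst (initialProd w j.val)
    have h2 := hYi j.val 1
    have h3 : Y 1 = z := by rw [← hy1, ← hYof, (MonoidAlgebra.of K (FreeGroup β)).map_one]
    rw [mul_one, h3, ZMod.natCast_zmod_val] at h2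
    rw [← h2]
    change Y _ 0 = Y 1 0 at h1
    rw [h1, h3, hz1]
    rfl
  · change Y (δ (initialProd w L)) 0 = 0
    have h1 : ∀ n : ℕ, Y (δ (initialProd w n)) 0 =
        ∑ j ∈ Finset.range n, Y (δ (letterVal (w j))) j := by
      intro n
      induction n with
      | zero => simp [initialProd, hδ.map_one]
      | succ n ih =>
        rw [initialProd_succ, hδ, map_add, Pi.add_apply, ih, hYi, Finset.sum_range_succ]
    rw [h1, sum_range_natCast fun j => Y (δ (letterVal (w j))) j]
    have h2 : ∀ j, Y (δ (letterVal (w j))) j =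
        ∑ i, ((if w j = (i, true) then Y (δ (FreeGroup.of i)) j else 0) -
          if w j = flipLetter (i, true) then Y (δ (FreeGroup.of i)) (j + 1) else 0) := by
      intro j
      have h3 := hYw (δ (FreeGroup.of (w j).1)) j
      rw [Finset.sum_eq_single (w j).1 (fun i _ hi => ?_) (by simp)]
      · rcases h : w j with ⟨i, b⟩
        rw [h] at h3
        cases b
        · rw [letterVal_false] at h3 ⊢
          rw [hδ.map_inv, map_neg, Pi.neg_apply, h3]
          simp [flipLetter]
        · simp [flipLetter, letterVal_true]
      · rw [if_neg fun h => hi (by rw [h]), if_neg fun h => hi (by rw [h]; rfl), sub_zero]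
    rw [Finset.sum_congr rfl fun j _ => h2 j, Finset.sum_comm]
    refine Finset.sum_eq_zero fun i _ => ?_
    rw [Finset.sum_sub_distrib, ← whiteheadBoundary_apply, hY]
    rfl

end CyclicWords

section Whitehead

open scoped Finset

variable {β : Type*} {L : ℕ}

theorem initialProd_add (w : ZMod L → β × Bool) (m n : ℕ) :
    initialProd w (m + n) = initialProd w m * initialProd (fun j : ZMod L => w (j + m)) n := by
  induction n with
  | zero => simp [initialProd]
  | succ n ih =>
    rw [← add_assoc, initialProd_succ, ih, initialProd_succ, mul_assoc]
    congr 4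
    push_cast
    ring

theorem initialProd_rotate (w : ZMod L → β × Bool) (k : ℕ) :
    initialProd (fun j : ZMod L => w (j + k)) L =
      (initialProd w k)⁻¹ * initialProd w L * initialProd w k := by
  have := initialProd_add w L k
  rw [add_comm, initialProd_add] at this
  rw [mul_assoc, eq_inv_mul_iff_mul_eq, this]
  simp

variable [DecidableEq β]

theorem norm_letterVal_le (x : β × Bool) : (letterVal x).norm ≤ 1 := FreeGroup.norm_mk_le

theorem norm_prod_range_le (f : ℕ → FreeGroup β) (n : ℕ) :
    ((List.range n).map f).prod.norm ≤ ∑ j ∈ Finset.range n, (f j).norm := by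
  induction n with
  | zero => simp
  | succ n ih =>
    rw [List.range_succ, List.map_append, List.prod_append, Finset.sum_range_succ]
    refine (FreeGroup.norm_mul_le _ _).trans (add_le_add ih ?_)
    simp

theorem norm_initialProd_le (w : ZMod L → β × Bool) (n : ℕ) : (initialProd w n).norm ≤ n := by
  refine (norm_prod_range_le _ n).trans
    ((Finset.sum_le_sum fun j _ => norm_letterVal_le _).trans ?_)
  simp

/-- A cyclic word is minimal if no automorphism makes it shorter. -/
def IsMinimalWord (w : ZMod L → β × Bool) : Prop :=
  ∀ φ : FreeGroup β ≃* FreeGroup β, L ≤ (φ (initialProd w L)).norm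

variable {w : ZMod L → β × Bool}

theorem IsMinimalWord.ne_flipLetter [NeZero L] (hw : IsMinimalWord w) (j : ZMod L) :
    w (j + 1) ≠ flipLetter (w j) := by
  intro h
  have h1 := hw (MulAut.conj (initialProd w j.val)⁻¹)
  rw [MulAut.conj_apply, inv_inv, ← initialProd_rotate, ZMod.natCast_zmod_val] at h1
  obtain _ | _ | n := L
  · exact NeZero.ne 0 rfl
  · have : Subsingleton (ZMod (0 + 1)) := inferInstanceAs (Subsingleton (Fin 1))
    rw [Subsingleton.elim (j + 1) j] at h
    exact flipLetter_ne _ h.symm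
  · have h2 : initialProd (fun i : ZMod _ => w (i + j)) 2 = 1 := by
      simp [initialProd, List.range_succ, add_comm 1 j, h]
    have h3 := initialProd_add (fun i : ZMod (n + 1 + 1) => w (i + j)) 2 n
    rw [h2, one_mul, show 2 + n = n + 1 + 1 by ring] at h3
    rw [h3] at h1
    have := norm_initialProd_le (fun i : ZMod (n + 1 + 1) => w (i + (2 : ℕ) + j)) n
    omega

section Automorphism

variable (x : β × Bool) (χ : β × Bool → Prop) [DecidablePred χ]

/-- The endomorphism of a free group that fixes the generator of the letter `x` and multiplies the
other letters by `c` on the sides selected by `χ`. -/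
def whiteheadHom (c : FreeGroup β) : FreeGroup β →* FreeGroup β :=
  FreeGroup.lift fun i => if i = x.1 then FreeGroup.of i else
    (if χ (i, true) then c else 1) * FreeGroup.of i * (if χ (i, false) then c else 1)⁻¹

theorem whiteheadHom_letterVal_of_eq (c : FreeGroup β) {y : β × Bool} (hy : y.1 = x.1) :
    whiteheadHom x χ c (letterVal y) = letterVal y := by
  obtain ⟨i, b⟩ := y
  cases b <;> simp_all [whiteheadHom, letterVal_true, letterVal_false]

theorem whiteheadHom_letterVal_of_ne (c : FreeGroup β) {y : β × Bool} (hy : y.1 ≠ x.1) :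
    whiteheadHom x χ c (letterVal y) =
      (if χ y then c else 1) * letterVal y * (if χ (flipLetter y) then c else 1)⁻¹ := by
  obtain ⟨i, b⟩ := y
  cases b
  · simp only [letterVal_false, flipLetter, Bool.not_false, _root_.map_inv, whiteheadHom,
      FreeGroup.lift_apply_of, if_neg hy]
    group
  · simp only [letterVal_true, flipLetter, Bool.not_true, whiteheadHom,
      FreeGroup.lift_apply_of, if_neg hy]

theorem whiteheadHom_comp_inv (c : FreeGroup β) (hc : whiteheadHom x χ c c = c) :
    (whiteheadHom x χ c).comp (whiteheadHom x χ c⁻¹) = MonoidHom.id _ := by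
  refine FreeGroup.ext_hom _ _ fun i => ?_
  rw [MonoidHom.comp_apply, MonoidHom.id_apply, ← letterVal_true]
  by_cases hi : i = x.1
  · rw [whiteheadHom_letterVal_of_eq _ _ _ hi, whiteheadHom_letterVal_of_eq _ _ _ hi]
  · rw [whiteheadHom_letterVal_of_ne (y := (i, true)) _ _ _ hi, map_mul, map_mul,
      whiteheadHom_letterVal_of_ne (y := (i, true)) _ _ _ hi, map_inv]
    split_ifs <;> simp [hc, mul_assoc]

/-- The Whitehead automorphism of a free group with multiplier `x`. -/
def whiteheadAut : FreeGroup β ≃* FreeGroup β :=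
  MonoidHom.toMulEquiv (whiteheadHom x χ (letterVal x)) (whiteheadHom x χ (letterVal x)⁻¹)
    (by
      have := whiteheadHom_comp_inv x χ (letterVal x)⁻¹ (by
        rw [map_inv, whiteheadHom_letterVal_of_eq x χ _ rfl])
      rwa [inv_inv] at this)
    (whiteheadHom_comp_inv x χ (letterVal x) (whiteheadHom_letterVal_of_eq x χ _ rfl))

theorem whiteheadAut_letterVal (hx : χ x) (hx' : ¬ χ (flipLetter x)) (y : β × Bool) :
    whiteheadAut x χ (letterVal y) = (if χ y then letterVal x else 1) *
      (if y.1 = x.1 then 1 else letterVal y) * (if χ (flipLetter y) then letterVal x else 1)⁻¹ := by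
  change whiteheadHom x χ (letterVal x) (letterVal y) = _
  by_cases hy : y.1 = x.1
  · rw [whiteheadHom_letterVal_of_eq _ _ _ hy, if_pos hy]
    rcases fst_eq_iff.1 hy with rfl | rfl
    · simp [hx, hx']
    · simp [hx, hx']
  · rw [whiteheadHom_letterVal_of_ne _ _ _ hy, if_neg hy]

variable {x χ}

/-- In a minimal cyclic word, a cut of the Whitehead graph separating a letter from its inverse
contains at least as many edges as there are occurrences of the letter. -/
theorem IsMinimalWord.card_le [NeZero L] (hw : IsMinimalWord w) (hx : χ x)
    (hx' : ¬ χ (flipLetter x)) :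
    #{j | (w j).1 = x.1} ≤ #{j | ¬ (χ (flipLetter (w (j - 1))) ↔ χ (w j))} := by
  let p : β × Bool → FreeGroup β := fun y => if χ y then letterVal x else 1
  let m : ZMod L → FreeGroup β := fun j => (if (w j).1 = x.1 then 1 else letterVal (w j)) *
    ((p (flipLetter (w j)))⁻¹ * p (w (j + 1)))
  have h1 : ∀ n : ℕ, whiteheadAut x χ (initialProd w n) =
      p (w 0) * ((List.range n).map fun j : ℕ => m j).prod * (p (w n))⁻¹ := by
    intro n
    induction n with
    | zero => simp [initialProd]
    | succ n ih =>
      rw [initialProd_succ, map_mul, ih, whiteheadAut_letterVal x χ hx hx', List.range_succ,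
        List.map_append, List.prod_append]
      change _ * (p (w n))⁻¹ * (p (w n) * _ * (p (flipLetter (w n)))⁻¹) = _
      simp only [m, List.map_cons, List.map_nil, List.prod_singleton, Nat.cast_succ]
      group
  have h2 := hw ((whiteheadAut x χ).trans (MulAut.conj (p (w 0))⁻¹))
  have h3 : ((whiteheadAut x χ).trans (MulAut.conj (p (w 0))⁻¹)) (initialProd w L) =
      ((List.range L).map fun j : ℕ => m j).prod := by
    rw [MulEquiv.trans_apply, h1, MulAut.conj_apply]
    simp [mul_assoc]
  rw [h3] at h2
  have h4 : ∀ j, (m j).norm ≤ (if (w j).1 = x.1 then 0 else 1) +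
      if ¬ (χ (flipLetter (w j)) ↔ χ (w (j + 1))) then 1 else 0 := by
    intro j
    refine (FreeGroup.norm_mul_le _ _).trans (add_le_add ?_ ?_)
    · split_ifs
      · simp
      · exact norm_letterVal_le _
    · have := norm_letterVal_le x
      by_cases ha : χ (flipLetter (w j)) <;> by_cases hb : χ (w (j + 1)) <;> simp [p, ha, hb, this]
  have h5 := h2.trans ((norm_prod_range_le _ L).trans (Finset.sum_le_sum fun j _ => h4 j))
  rw [sum_range_natCast (L := L) fun j => (if (w j).1 = x.1 then 0 else 1) +
      if ¬ (χ (flipLetter (w j)) ↔ χ (w (j + 1))) then 1 else 0, Finset.sum_add_distrib] at h5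
  have h6 : (∑ j : ZMod L, if ¬ (χ (flipLetter (w j)) ↔ χ (w (j + 1))) then 1 else 0) =
      ∑ j : ZMod L, if ¬ (χ (flipLetter (w (j - 1))) ↔ χ (w j)) then 1 else 0 :=
    Fintype.sum_equiv (Equiv.addRight 1) _ _ fun j => by simp
  have h7 : (∑ j : ZMod L, if (w j).1 = x.1 then 0 else 1) +
      (∑ j : ZMod L, if (w j).1 = x.1 then 1 else 0) = L := by
    rw [← Finset.sum_add_distrib]
    refine (Finset.sum_congr rfl fun j _ => ?_).trans (b := ∑ j : ZMod L, 1) ?_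
    · split_ifs <;> rfl
    · simp [ZMod.card]
  rw [Finset.card_filter, Finset.card_filter]
  omega

end Automorphism

open Classical in
theorem IsMinimalWord.not_of_closed [NeZero L] (hw : IsMinimalWord w)
    (hgen : ∀ i, ∃ j, (w j).1 = i) {a : β × Bool} {A : β × Bool → Prop} (ha : ¬ A a)
    (ha' : ¬ A (flipLetter a)) (hA : ∀ j, flipLetter (w (j - 1)) ≠ a → w j ≠ a →
      (A (flipLetter (w (j - 1))) ↔ A (w j))) (x : β × Bool) : ¬ A x := by
  intro hx
  have hclosed : ∀ j, A (flipLetter (w (j - 1))) ↔ A (w j) := by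
    by_contra! H
    obtain ⟨j₀, hj₀⟩ := H
    have h1 := hw.card_le (x := a) (χ := fun y => A y ∨ y = a) (Or.inr rfl)
      (not_or.2 ⟨ha', flipLetter_ne a⟩)
    have h2 : j₀ ∈ ({j | flipLetter (w (j - 1)) = a ∨ w j = a} : Finset (ZMod L)) := by
      by_contra h
      rw [Finset.mem_filter_univ, not_or] at h
      have := hA j₀ h.1 h.2
      tauto
    have h3 : ({j | ¬ ((A (flipLetter (w (j - 1))) ∨ flipLetter (w (j - 1)) = a) ↔
        (A (w j) ∨ w j = a))} : Finset (ZMod L)) ⊆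
        ({j | flipLetter (w (j - 1)) = a ∨ w j = a} : Finset (ZMod L)).erase j₀ := by
      intro j hj
      rw [Finset.mem_filter_univ] at hj
      simp only [Finset.mem_erase, Finset.mem_filter_univ] at h2 ⊢
      refine ⟨?_, ?_⟩
      · rintro rfl
        rcases h2 with h2 | h2 <;> simp only [h2] at hj hj₀ <;> tauto
      · have := hA j
        tauto
    have h4 := Finset.card_le_card h3
    rw [Finset.card_erase_of_mem h2, Finset.filter_or] at h4
    have h5 := Finset.card_pos.2 ⟨_, h2⟩
    rw [Finset.filter_or] at h5
    have h6 := Finset.card_union_le ({j | flipLetter (w (j - 1)) = a} : Finset (ZMod L))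
      ({j | w j = a} : Finset (ZMod L))
    have h7 : #{j | flipLetter (w (j - 1)) = a} = #{j | w j = flipLetter a} :=
      Finset.card_equiv (Equiv.subRight 1) fun j => by simp [flipLetter_eq_iff]
    have h8 : #{j | (w j).1 = a.1} = #{j | w j = flipLetter a} + #{j | w j = a} := by
      rw [← Finset.card_union_of_disjoint]
      · congr 1
        ext j
        simp [fst_eq_iff, or_comm]
      · refine Finset.disjoint_filter.2 fun j _ h h' => flipLetter_ne a (h.symm.trans h')
    omega
  have hinv : ∀ y, A y → A (flipLetter y) := by
    by_contra! H
    obtain ⟨y, hy, hy'⟩ := H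
    have h1 := hw.card_le hy hy'
    obtain ⟨j, hj⟩ := hgen y.1
    have h2 : 0 < #{j | (w j).1 = y.1} := Finset.card_pos.2 ⟨j, by simpa using hj⟩
    have h3 : ({j | ¬ (A (flipLetter (w (j - 1))) ↔ A (w j))} : Finset (ZMod L)) = ∅ :=
      Finset.filter_eq_empty_iff.2 fun j _ => not_not.2 (hclosed j)
    rw [h3, Finset.card_empty] at h1
    omega
  have hinv' : ∀ y, A (flipLetter y) ↔ A y := fun y =>
    ⟨fun h => by simpa using hinv _ h, hinv y⟩
  have hstep : ∀ j, A (w (j + 1)) ↔ A (w j) := fun j => by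
    rw [← hclosed (j + 1), add_sub_cancel_right, hinv']
  have hall : ∀ n : ℕ, A (w n) ↔ A (w 0) := fun n => by
    induction n with
    | zero => simp
    | succ n ih => rw [Nat.cast_succ, hstep, ih]
  have hfst : ∀ y, A y ↔ A (w 0) := fun y => by
    obtain ⟨j, hj⟩ := hgen y.1
    rw [← hall j.val, ZMod.natCast_zmod_val]
    rcases fst_eq_iff.1 hj with h | h
    · rw [h]
    · rw [h, hinv']
  exact ha ((hfst a).2 ((hfst x).1 hx))

theorem IsMinimalWord.noCut [NeZero L] (hw : IsMinimalWord w) (hgen : ∀ i, ∃ j, (w j).1 = i)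
    (a : β × Bool) : NoCut w a := by
  intro A hA x y hx hy hAx
  by_contra hAy
  by_cases h : A (flipLetter a)
  · exact hw.not_of_closed hgen (a := a) (A := fun z => z ≠ a ∧ ¬ A z) (by simp) (by simp [h])
      (fun j h1 h2 => by simp [h1, h2, hA j h1 h2]) y ⟨hy, hAy⟩
  · exact hw.not_of_closed hgen (a := a) (A := fun z => z ≠ a ∧ A z) (by simp) (by simp [h])
      (fun j h1 h2 => by simp [h1, h2, hA j h1 h2]) x ⟨hx, hAx⟩

end Whitehead

section ShortWords

variable {β : Type*} [DecidableEq β] {K : Type*} [Field K]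

theorem addFun_single_mk (i : β) (l : List (β × Bool)) :
    addFun (Pi.single i (1 : K)) (FreeGroup.mk l) = l.count (i, true) - l.count (i, false) := by
  rw [additive_mk (addFun_mul _)]
  induction l with
  | nil => simp
  | cons x l ih =>
    rw [List.map_cons, List.sum_cons, ih, List.count_cons, List.count_cons]
    obtain ⟨j, b⟩ := x
    by_cases hj : j = i
    · subst hj
      cases b
      · simp [letterVal_false, additive_inv (addFun_mul _)]
        ring
      · simp [letterVal_true]
        ring
    · rw [addFun_single_eq_zero (x := (j, b)) hj]
      simp [hj]

omit [DecidableEq β] in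
theorem initialProd_getElem {l : List (β × Bool)} [NeZero l.length] :
    initialProd (fun j : ZMod l.length => l[j.val]'(ZMod.val_lt j)) l.length =
      FreeGroup.mk l := by
  rw [mk_eq_prod, initialProd]
  congr 1
  refine List.ext_getElem (by simp) fun n h1 h2 => ?_
  have hn : n < l.length := by simpa using h1
  simp [ZMod.val_natCast, Nat.mod_eq_of_lt hn]

/-- Up to automorphism, a surface-like word contains every letter exactly once. -/
theorem IsSurfaceLike.exists_nodup [Fintype β] [Nonempty β] (h2 : (2 : K) ≠ 0) {u : FreeGroup β}
    (hu : IsSurfaceLike K u) : ∃ (φ : FreeGroup β ≃* FreeGroup β) (l : List (β × Bool)),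
      φ u = FreeGroup.mk l ∧ l.Nodup ∧ ∀ x, x ∈ l := by
  let s : Set ℕ := Set.range fun φ : FreeGroup β ≃* FreeGroup β => (φ u).norm
  obtain ⟨φ, hφ⟩ : sInf s ∈ s := Nat.sInf_mem ⟨_, MulEquiv.refl _, rfl⟩
  have hmin : ∀ ψ : FreeGroup β ≃* FreeGroup β, (φ u).norm ≤ (ψ u).norm := fun ψ =>
    hφ.trans_le (Nat.sInf_le ⟨ψ, rfl⟩)
  obtain ⟨l, hl, hlen⟩ : ∃ l, φ u = FreeGroup.mk l ∧ (φ u).norm = l.length :=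
    ⟨_, FreeGroup.mk_toWord.symm, rfl⟩
  have hv := hu.map φ
  have hmem := hv.exists_mem hl
  have : NeZero l.length := ⟨fun h => by
    obtain ⟨x, hx, -⟩ := hmem (Classical.arbitrary β)
    simp [List.length_eq_zero_iff.1 h] at hx⟩
  have hprod := initialProd_getElem (l := l)
  set w : ZMod l.length → β × Bool := fun j => l[j.val]'(ZMod.val_lt j)
  have hw : IsMinimalWord w := fun ψ => by
    rw [hprod, ← hl, ← hlen]
    exact hmin (φ.trans ψ)
  have hgen : ∀ i, ∃ j, (w j).1 = i := fun i => by
    obtain ⟨x, hx, rfl⟩ := hmem i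
    obtain ⟨n, hn, rfl⟩ := List.getElem_of_mem hx
    exact ⟨n, by simp [w, ZMod.val_natCast, Nat.mod_eq_of_lt hn]⟩
  have hle : l.length ≤ Fintype.card (β × Bool) :=
    (hprod ▸ hl ▸ hv : IsSurfaceLike K (initialProd w l.length)).le_card hw.ne_flipLetter
      (hw.noCut hgen)
  have hcount : ∀ i, (l.count (i, true) : K) = l.count (i, false) := fun i => by
    rw [← sub_eq_zero, ← addFun_single_mk, ← hl]
    exact hv.map_eq_zero _ (addFun_mul _)
  have hpos : ∀ i, 0 < l.count (i, true) + l.count (i, false) := fun i => by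
    obtain ⟨⟨j, b⟩, hx, rfl⟩ := hmem i
    have := List.count_pos_iff.2 hx
    cases b <;> simp only [] <;> omega
  have htwo : ∀ i, 2 ≤ l.count (i, true) + l.count (i, false) := fun i => by
    have h0 := hpos i
    have h3 := hcount i
    by_contra! h
    obtain ⟨h4, h5⟩ | ⟨h4, h5⟩ : l.count (i, true) = 0 ∧ l.count (i, false) = 1 ∨
      l.count (i, true) = 1 ∧ l.count (i, false) = 0 := by omega
    · simp [h4, h5] at h3
    · simp [h4, h5] at h3
  have hsum : ∑ i, (l.count (i, true) + l.count (i, false)) = l.length := by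
    rw [← Multiset.coe_card, ← Multiset.sum_count_eq_card (s := Finset.univ) (by simp),
      Fintype.sum_prod_type]
    simp only [Fintype.sum_bool, Multiset.coe_count]
    congr!
  have heq : ∀ i, 2 = l.count (i, true) + l.count (i, false) := fun i => by
    refine (Finset.sum_eq_sum_iff_of_le fun i _ => htwo i).1 ?_ i (Finset.mem_univ i)
    refine (Finset.sum_le_sum fun i _ => htwo i).antisymm ?_
    rw [hsum]
    simpa [Fintype.card_prod] using hle
  have hone : ∀ i, l.count (i, true) = 1 ∧ l.count (i, false) = 1 := fun i => by
    have h3 := heq i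
    have h4 := hcount i
    by_contra h
    obtain ⟨h5, h6⟩ | ⟨h5, h6⟩ : l.count (i, true) = 0 ∧ l.count (i, false) = 2 ∨
      l.count (i, true) = 2 ∧ l.count (i, false) = 0 := by omega
    · rw [h5, h6] at h4
      exact h2 (by simpa using h4.symm)
    · rw [h5, h6] at h4
      exact h2 (by simpa using h4)
  have hall : ∀ x, l.count x = 1 := fun ⟨i, b⟩ => by
    cases b
    · exact (hone i).2
    · exact (hone i).1
  exact ⟨φ, l, hl, List.nodup_iff_count_le_one.2 fun x => (hall x).le,
    fun x => List.count_pos_iff.1 (by simp [hall x])⟩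

end ShortWords

section Classification

variable {β : Type*}

/-- The product of the commutators of the given pairs of letters. -/
def prodCommutator (ps : List ((β × Bool) × (β × Bool))) : FreeGroup β :=
  (ps.map fun p => ⁅letterVal p.1, letterVal p.2⁆).prod

/-- The generators that occur in a list of pairs of letters. -/
def pairGens (ps : List ((β × Bool) × (β × Bool))) : List β :=
  ps.flatMap fun p => [p.1.1, p.2.1]

theorem map_eq_self_of_forall_mem {l : List (β × Bool)} {f : FreeGroup β →* FreeGroup β}
    (h : ∀ x ∈ l, f (letterVal x) = letterVal x) : f (FreeGroup.mk l) = FreeGroup.mk l := by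
  rw [mk_eq_prod, map_list_prod, List.map_map]
  exact congrArg List.prod (List.map_congr_left h)

theorem map_prodCommutator {ps : List ((β × Bool) × (β × Bool))}
    {f : FreeGroup β →* FreeGroup β}
    (h : ∀ x : β × Bool, x.1 ∈ pairGens ps → f (letterVal x) = letterVal x) :
    f (prodCommutator ps) = prodCommutator ps := by
  rw [prodCommutator, map_list_prod, List.map_map]
  refine congrArg List.prod (List.map_congr_left fun p hp => ?_)
  rw [Function.comp_apply, map_commutatorElement, h, h]
  · exact List.mem_flatMap.2 ⟨p, hp, by simp⟩
  · exact List.mem_flatMap.2 ⟨p, hp, by simp⟩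

variable [DecidableEq β]

/-- The endomorphism of a free group that maps the letter `x` to `p * x * q` and fixes the other
generators. -/
def transvectionHom (x : β × Bool) (p q : FreeGroup β) : FreeGroup β →* FreeGroup β :=
  FreeGroup.lift fun i => if i = x.1 then
    (if x.2 then p * FreeGroup.of i * q else q⁻¹ * FreeGroup.of i * p⁻¹) else FreeGroup.of i

theorem transvectionHom_self (x : β × Bool) (p q : FreeGroup β) :
    transvectionHom x p q (letterVal x) = p * letterVal x * q := by
  obtain ⟨i, b⟩ := x
  cases b <;> simp [transvectionHom, letterVal_true, letterVal_false, mul_assoc]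

theorem transvectionHom_of_ne {x y : β × Bool} (hy : y.1 ≠ x.1) (p q : FreeGroup β) :
    transvectionHom x p q (letterVal y) = letterVal y := by
  obtain ⟨i, b⟩ := y
  cases b <;> simp_all [transvectionHom, letterVal_true, letterVal_false]

theorem transvectionHom_comp_inv {x : β × Bool} {p q : FreeGroup β}
    (hp : transvectionHom x p q p = p) (hq : transvectionHom x p q q = q) :
    (transvectionHom x p q).comp (transvectionHom x p⁻¹ q⁻¹) = MonoidHom.id _ := by
  have h : ∀ y, transvectionHom x p q (transvectionHom x p⁻¹ q⁻¹ (letterVal y)) =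
      letterVal y := fun y => by
    by_cases hy : y.1 = x.1
    · have hx : transvectionHom x p q (transvectionHom x p⁻¹ q⁻¹ (letterVal x)) =
          letterVal x := by
        rw [transvectionHom_self, map_mul, map_mul, map_inv, map_inv, hp, hq,
          transvectionHom_self]
        group
      rcases fst_eq_iff.1 hy with rfl | rfl
      · exact hx
      · rw [letterVal_flipLetter, map_inv, map_inv, hx]
    · rw [transvectionHom_of_ne hy, transvectionHom_of_ne hy]
  exact FreeGroup.ext_hom _ _ fun i => h (i, true)

theorem exists_transvection {x : β × Bool} {p q : FreeGroup β}
    (hp : ∀ f : FreeGroup β →* FreeGroup β,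
      (∀ y : β × Bool, y.1 ≠ x.1 → f (letterVal y) = letterVal y) → f p = p)
    (hq : ∀ f : FreeGroup β →* FreeGroup β,
      (∀ y : β × Bool, y.1 ≠ x.1 → f (letterVal y) = letterVal y) → f q = q) :
    ∃ θ : FreeGroup β ≃* FreeGroup β, θ (letterVal x) = p * letterVal x * q ∧
      ∀ y : β × Bool, y.1 ≠ x.1 → θ (letterVal y) = letterVal y := by
  have h1 := hp _ fun y hy => transvectionHom_of_ne hy p q
  have h2 := hq _ fun y hy => transvectionHom_of_ne hy p q
  have h3 := hp _ fun y hy => transvectionHom_of_ne hy p⁻¹ q⁻¹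
  have h4 := hq _ fun y hy => transvectionHom_of_ne hy p⁻¹ q⁻¹
  refine ⟨MonoidHom.toMulEquiv (transvectionHom x p q) (transvectionHom x p⁻¹ q⁻¹) ?_
    (transvectionHom_comp_inv h1 h2), transvectionHom_self x p q,
    fun y hy => transvectionHom_of_ne hy p q⟩
  have := transvectionHom_comp_inv (x := x) (p := p⁻¹) (q := q⁻¹) (by rw [map_inv, h3])
    (by rw [map_inv, h4])
  rwa [inv_inv, inv_inv] at this

/-- The handle normalisation step in the classification of surfaces. -/
theorem exists_handle_aut {a b : β × Bool} (hab : a.1 ≠ b.1) {P₁ P₂ P₃ P₄ : List (β × Bool)}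
    (hP : ∀ x ∈ P₁ ++ P₂ ++ P₃ ++ P₄, x.1 ≠ a.1 ∧ x.1 ≠ b.1) :
    ∃ θ : FreeGroup β ≃* FreeGroup β,
      θ (FreeGroup.mk (a :: (P₁ ++ b :: P₂) ++ flipLetter a :: (P₃ ++ flipLetter b :: P₄))) =
        ⁅letterVal a, letterVal b⁆ * FreeGroup.mk (P₃ ++ P₂ ++ P₁ ++ P₄) ∧
      ∀ y : β × Bool, y.1 ≠ a.1 → y.1 ≠ b.1 → θ (letterVal y) = letterVal y := by
  have hfix : ∀ f : FreeGroup β →* FreeGroup β,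
      (∀ y : β × Bool, y.1 ≠ a.1 → y.1 ≠ b.1 → f (letterVal y) = letterVal y) →
      f (FreeGroup.mk P₁) = FreeGroup.mk P₁ ∧ f (FreeGroup.mk P₂) = FreeGroup.mk P₂ ∧
      f (FreeGroup.mk P₃) = FreeGroup.mk P₃ ∧ f (FreeGroup.mk P₄) = FreeGroup.mk P₄ :=
    fun f hf => by
      refine ⟨?_, ?_, ?_, ?_⟩ <;>
        exact map_eq_self_of_forall_mem fun x hx => hf x (hP x (by simp [hx])).1
          (hP x (by simp [hx])).2
  obtain ⟨θ₁, h1, h2⟩ := exists_transvection (x := a) (p := 1)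
    (q := FreeGroup.mk P₃ * FreeGroup.mk P₂) (fun f _ => map_one f) (fun f hf => by
      obtain ⟨-, h2, h3, -⟩ := hfix f fun y hy _ => hf y hy
      rw [map_mul, h2, h3])
  obtain ⟨θ₂, h3, h4⟩ := exists_transvection (x := b)
    (p := (FreeGroup.mk P₃ * FreeGroup.mk P₂ * FreeGroup.mk P₁)⁻¹) (q := FreeGroup.mk P₃)
    (fun f hf => by
      obtain ⟨h1, h2, h3, -⟩ := hfix f fun y _ hy => hf y hy
      rw [map_inv, map_mul, map_mul, h1, h2, h3])
    (fun f hf => (hfix f fun y _ hy => hf y hy).2.2.1)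
  obtain ⟨h5, h6, h7, h8⟩ := hfix θ₁.toMonoidHom fun y hy _ => h2 y hy
  obtain ⟨h9, h10, h11, h12⟩ := hfix θ₂.toMonoidHom fun y _ hy => h4 y hy
  simp only [MulEquiv.toMonoidHom_eq_coe, MonoidHom.coe_coe] at h5 h6 h7 h8 h9 h10 h11 h12
  refine ⟨θ₂.trans θ₁, ?_, fun y hya hyb => by
    rw [MulEquiv.trans_apply, h4 y hyb, h2 y hya]⟩
  simp only [mk_append, mk_cons, List.cons_append, letterVal_flipLetter, map_mul, map_inv,
    MulEquiv.trans_apply, h1, h3, h4 a hab, h2 b hab.symm, h5, h6, h7, h8, h9, h10, h11, h12,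
    commutatorElement_def]
  group

variable {K : Type*} [Field K]

theorem IsSurfaceLike.exists_eq_prodCommutator {n : ℕ} {u : FreeGroup β}
    (hu : IsSurfaceLike K u) {ps : List ((β × Bool) × (β × Bool))} {v : List (β × Bool)}
    (hn : v.length ≤ n) (huv : u = prodCommutator ps * FreeGroup.mk v) (hv : v.Nodup)
    (hc : InvClosed v) (hps : (pairGens ps).Nodup) (hd : ∀ x ∈ v, x.1 ∉ pairGens ps)
    (hgen : ∀ i, i ∈ pairGens ps ∨ ∃ x ∈ v, x.1 = i) :
    ∃ (φ : FreeGroup β ≃* FreeGroup β) (ps : List ((β × Bool) × (β × Bool))),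
      φ u = prodCommutator ps ∧ (pairGens ps).Nodup ∧ ∀ i, i ∈ pairGens ps := by
  induction n generalizing u ps v with
  | zero =>
    obtain rfl := List.length_eq_zero_iff.1 (Nat.le_zero.1 hn)
    exact ⟨MulEquiv.refl _, ps, by simp [huv, mk_nil], hps, by simpa using hgen⟩
  | succ n ih =>
    obtain _ | ⟨a, R⟩ := v
    · exact ⟨MulEquiv.refl _, ps, by simp [huv, mk_nil], hps, by simpa using hgen⟩
    obtain ⟨R₁, R₂, rfl⟩ := List.append_of_mem ((List.mem_cons.1
      (hc a List.mem_cons_self)).resolve_left (flipLetter_ne a))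
    rw [← List.cons_append] at *
    have hR₁ := hu.not_invClosed huv (fun p hp => ⟨fun h => hd a (by simp) (List.mem_flatMap.2
      ⟨p, hp, by simp [h]⟩), fun h => hd a (by simp) (List.mem_flatMap.2
      ⟨p, hp, by simp [h]⟩)⟩) hv hc
    obtain ⟨b, hb, hb'⟩ : ∃ b ∈ R₁, flipLetter b ∉ R₁ := by
      by_contra! h
      exact hR₁ h
    have hba : b.1 ≠ a.1 := fun h => by
      simp only [List.cons_append, List.nodup_cons, List.nodup_append] at hv
      rcases fst_eq_iff.1 h with rfl | rfl
      · exact hv.1 (by simp [hb])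
      · exact hv.2.2.2 _ hb _ List.mem_cons_self rfl
    have hb₂ : flipLetter b ∈ R₂ := by
      have h1 := hc b (by simp [hb])
      have h2 : flipLetter b ≠ a := fun h => hba (by rw [← h]; rfl)
      have h3 : flipLetter b ≠ flipLetter a := fun h => hba (by
        rw [← flipLetter_fst b, h, flipLetter_fst])
      simp only [List.cons_append, List.mem_cons, List.mem_append] at h1
      tauto
    obtain ⟨P₁, P₂, rfl⟩ := List.append_of_mem hb
    obtain ⟨P₃, P₄, rfl⟩ := List.append_of_mem hb₂
    have hperm : (a :: (P₁ ++ b :: P₂) ++ flipLetter a :: (P₃ ++ flipLetter b :: P₄)).Perm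
        ([a, flipLetter a, b, flipLetter b] ++ (P₃ ++ P₂ ++ P₁ ++ P₄)) := by
      rw [List.perm_iff_count]
      intro x
      simp only [List.count_append, List.count_cons, List.count_nil]
      ring
    have hv' := hperm.nodup_iff.1 hv
    have hP : ∀ x ∈ P₃ ++ P₂ ++ P₁ ++ P₄, x.1 ≠ a.1 ∧ x.1 ≠ b.1 := fun x hx => by
      have h := (List.nodup_append.1 hv').2.2
      refine ⟨fun hxa => ?_, fun hxb => ?_⟩
      · rcases fst_eq_iff.1 hxa with rfl | rfl
        · exact h _ (by simp) _ hx rfl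
        · exact h _ (by simp) _ hx rfl
      · rcases fst_eq_iff.1 hxb with rfl | rfl
        · exact h _ (by simp) _ hx rfl
        · exact h _ (by simp) _ hx rfl
    obtain ⟨θ, h1, h2⟩ := exists_handle_aut hba.symm (P₁ := P₁) (P₂ := P₂) (P₃ := P₃) (P₄ := P₄)
      fun x hx => hP x (by simp only [List.mem_append] at hx ⊢; tauto)
    have ha₀ : a.1 ∉ pairGens ps := hd a (by simp)
    have hb₀ : b.1 ∉ pairGens ps := hd b (by simp)
    have hgens : pairGens (ps ++ [(a, b)]) = pairGens ps ++ [a.1, b.1] := by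
      simp [pairGens]
    obtain ⟨φ, qs, h3⟩ := ih (hu.map θ) (ps := ps ++ [(a, b)]) (v := P₃ ++ P₂ ++ P₁ ++ P₄)
      (by simp at hn ⊢; omega)
      (by
        have h4 : θ (prodCommutator ps) = prodCommutator ps :=
          map_prodCommutator (f := θ.toMonoidHom) fun x hx =>
            h2 x (fun h => ha₀ (h ▸ hx)) fun h => hb₀ (h ▸ hx)
        rw [huv, map_mul, h1, h4]
        simp [prodCommutator, mul_assoc])
      (List.nodup_append.1 hv').2.1
      (fun x hx => by
        have h4 := hc x (hperm.mem_iff.2 (List.mem_append_right _ hx))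
        rw [hperm.mem_iff, List.mem_append] at h4
        refine h4.resolve_left fun h5 => ?_
        have h6 := hP x hx
        simp only [List.mem_cons, List.not_mem_nil, or_false] at h5
        rcases h5 with h5 | h5 | h5 | h5 <;> have h7 := congrArg Prod.fst h5 <;>
          simp only [flipLetter_fst] at h7 <;> tauto)
      (by
        rw [hgens, List.nodup_append]
        refine ⟨hps, by simpa using hba.symm, fun x hx y hy => ?_⟩
        rintro rfl
        simp only [List.mem_cons, List.not_mem_nil, or_false] at hy
        rcases hy with rfl | rfl <;> contradiction)
      (fun x hx => by
        have h4 := hP x hx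
        have h5 := hd x (hperm.mem_iff.2 (List.mem_append_right _ hx))
        rw [hgens]
        simp [h4, h5])
      (fun i => by
        rw [hgens, List.mem_append]
        refine (hgen i).elim (fun h => Or.inl (Or.inl h)) ?_
        rintro ⟨x, hx, rfl⟩
        rw [hperm.mem_iff, List.mem_append] at hx
        rcases hx with hx | hx
        · refine Or.inl (Or.inr ?_)
          simp only [List.mem_cons, List.not_mem_nil, or_false] at hx ⊢
          rcases hx with rfl | rfl | rfl | rfl <;> simp
        · exact Or.inr ⟨x, hx, rfl⟩)
    exact ⟨θ.trans φ, qs, h3⟩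

omit [DecidableEq β] in
/-- A permutation of the letters that commutes with inversion extends to an automorphism. -/
theorem exists_aut_of_bijective {m : β → β × Bool} (hm : (fun i => (m i).1).Bijective) :
    ∃ φ : FreeGroup β ≃* FreeGroup β, ∀ i, φ (FreeGroup.of i) = letterVal (m i) := by
  let σ := Equiv.ofBijective _ hm
  let f : FreeGroup β →* FreeGroup β := FreeGroup.lift fun i => letterVal (m i)
  let g : FreeGroup β →* FreeGroup β :=
    FreeGroup.lift fun i => letterVal (σ.symm i, (m (σ.symm i)).2)
  have hσ : ∀ i, (m (σ.symm i)).1 = i := σ.apply_symm_apply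
  have hσ' : ∀ i, σ.symm (m i).1 = i := σ.symm_apply_apply
  refine ⟨MonoidHom.toMulEquiv f g (FreeGroup.ext_hom _ _ fun i => ?_)
    (FreeGroup.ext_hom _ _ fun i => ?_),
    fun i => FreeGroup.lift_apply_of (f := fun i => letterVal (m i))⟩
  · have h := hσ' i
    simp only [MonoidHom.comp_apply, MonoidHom.id_apply, f, FreeGroup.lift_apply_of]
    obtain ⟨⟨j, b⟩, hmi⟩ : ∃ y, y = m i := ⟨_, rfl⟩
    rw [← hmi] at h ⊢
    subst h
    cases b
    · simp [letterVal_false, g, ← hmi]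
    · simp [letterVal_true, g, ← hmi]
  · have h := hσ i
    simp only [MonoidHom.comp_apply, MonoidHom.id_apply, g, FreeGroup.lift_apply_of]
    obtain ⟨⟨j, b⟩, hmi⟩ : ∃ y, y = m (σ.symm i) := ⟨_, rfl⟩
    rw [← hmi] at h ⊢
    dsimp only at h
    subst h
    cases b
    · simp [letterVal_false, f, ← hmi]
    · simp [letterVal_true, f, ← hmi]

theorem exists_aut_orientableRelator {d : ℕ} {ps : List (((Fin d × Bool) × Bool) ×
    ((Fin d × Bool) × Bool))} (hn : (pairGens ps).Nodup) (hgen : ∀ i, i ∈ pairGens ps) :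
    ∃ φ : FreeGroup (Fin d × Bool) ≃* FreeGroup (Fin d × Bool),
      φ (orientableRelator d) = prodCommutator ps := by
  have hlen : ps.length = d := by
    have h1 : (pairGens ps).length = Fintype.card (Fin d × Bool) := by
      rw [← List.toFinset_card_of_nodup hn, ← Finset.card_univ]
      congr 1
      ext i
      simp [hgen]
    have h2 : (pairGens ps).length = ps.length * 2 := by simp [pairGens, List.length_flatMap]
    rw [h2, Fintype.card_prod, Fintype.card_fin, Fintype.card_bool] at h1
    omega
  let m : Fin d × Bool → (Fin d × Bool) × Bool := fun i =>
    if i.2 then ps[i.1.val].2 else ps[i.1.val].1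
  obtain ⟨φ, hφ⟩ := exists_aut_of_bijective (m := m) (Function.Surjective.bijective_of_finite
    fun i => by
      obtain ⟨p, hp, hi⟩ := List.mem_flatMap.1 (hgen i)
      obtain ⟨k, hk, rfl⟩ := List.getElem_of_mem hp
      simp only [List.mem_cons, List.not_mem_nil, or_false] at hi
      rcases hi with rfl | rfl
      · exact ⟨(⟨k, hlen ▸ hk⟩, false), by simp [m]⟩
      · exact ⟨(⟨k, hlen ▸ hk⟩, true), by simp [m]⟩)
  refine ⟨φ, ?_⟩
  rw [orientableRelator, map_list_prod, prodCommutator]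
  congr 1
  refine List.ext_getElem (by simp [hlen]) fun n h1 h2 => ?_
  simp [map_commutatorElement, hφ, m]

end Classification

/-- If `u` is measure equivalent to the orientable surface word
`w = [x₁,y₁]⋯[x_d,y_d]` in every finite solvable group, then `u` lies in the
`Aut(F)`-orbit of `w`. -/
theorem stmt0 (d : ℕ) (hd : 1 ≤ d) (u : FreeGroup (Fin d × Bool))
    (h : ∀ (Q : Type) [Group Q] [Finite Q], IsSolvable Q →
      MeasureEquivIn (orientableRelator d) u Q) :
    ∃ φ : FreeGroup (Fin d × Bool) ≃* FreeGroup (Fin d × Bool),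
      u = φ (orientableRelator d) := by
  have h3 : (2 : ZMod 3) ≠ 0 := by decide
  have : Fact (Nat.Prime 3) := ⟨Nat.prime_three⟩
  obtain ⟨h1, h2⟩ := sub_one_mem_range_of_measureEquivIn (K := ZMod 3) hd h
  have hu := isSurfaceLike_of_sub_one_mem_range h1 h2
  have : Nonempty (Fin d × Bool) := ⟨(⟨0, hd⟩, true)⟩
  obtain ⟨φ, l, hl, hn, hmem⟩ := hu.exists_nodup h3
  obtain ⟨ψ, ps, hψ, hps, hgen⟩ := (hu.map φ).exists_eq_prodCommutator (ps := []) le_rfl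
    (by simp [prodCommutator, hl]) hn (fun x _ => hmem _) (by simp [pairGens])
    (by simp [pairGens]) fun i => Or.inr ⟨(i, true), hmem _, rfl⟩
  obtain ⟨χ, hχ⟩ := exists_aut_orientableRelator hps hgen
  refine ⟨χ.trans (φ.trans ψ).symm, ?_⟩
  rw [MulEquiv.trans_apply, hχ, ← hψ, MulEquiv.symm_trans_apply]
  simp
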